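/- arXiv:1208.1509 — 4 statements merged into one kernel-verified Lean document; each statement's English description precedes it below -/
import Mathlib

section
/- Let μ and ν be finite Borel measures on ℝ with finite first moments. Then the set Π_M(μ,ν) of martingale transport plans from μ to ν is nonempty if and only if μ ≤C ν. -/
open MeasureTheory Set Filter Topology

noncomputable section

/-- Convex order of finite measures on `ℝ` with finite first moments. -/
def ConvexOrder (μ ν : MeasureTheory.Measure ℝ) : Prop :=
  μ Set.univ = ν Set.univ ∧
  (∫ x, x ∂μ) = (∫ x, x ∂ν) ∧
  ∀ k : ℝ, (∫ x, max (x - k) 0 ∂μ) ≤ ∫ x, max (x - k) 0 ∂ν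

/-- Extended convex order: integrals of nonnegative convex functions increase. -/
def ExtConvexOrder (μ ν : MeasureTheory.Measure ℝ) : Prop :=
  ∀ φ : ℝ → ℝ, ConvexOn ℝ Set.univ φ → (∀ x, 0 ≤ φ x) →
    (∫⁻ x, ENNReal.ofReal (φ x) ∂μ) ≤ ∫⁻ x, ENNReal.ofReal (φ x) ∂ν

/-- `π` is a transport plan with marginals `μ` and `ν`. -/
def IsCoupling (μ ν : MeasureTheory.Measure ℝ) (π : MeasureTheory.Measure (ℝ × ℝ)) : Prop :=
  π.map Prod.fst = μ ∧ π.map Prod.snd = ν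

/-- `π ∈ Π_M(μ,ν)`: a coupling satisfying the martingale condition. -/
def IsMartingaleCoupling (μ ν : MeasureTheory.Measure ℝ) (π : MeasureTheory.Measure (ℝ × ℝ)) : Prop :=
  IsCoupling μ ν π ∧
  ∀ ρ : ℝ → ℝ, Continuous ρ → (∃ M : ℝ, ∀ x, |ρ x| ≤ M) →
    (∫ p : ℝ × ℝ, ρ p.1 * (p.2 - p.1) ∂π) = 0

/-- `S` is the shadow `S^ν(μ)` of `μ` in `ν`. -/
def IsShadow (μ ν S : MeasureTheory.Measure ℝ) : Prop :=
  S ≤ ν ∧ ConvexOrder μ S ∧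
  ∀ η : MeasureTheory.Measure ℝ, η ≤ ν → ConvexOrder μ η → ConvexOrder S η

/-- `π` is the left-curtain coupling between `μ` and `ν`. -/
def IsLeftCurtain (μ ν : MeasureTheory.Measure ℝ) (π : MeasureTheory.Measure (ℝ × ℝ)) : Prop :=
  IsMartingaleCoupling μ ν π ∧
  ∀ x : ℝ, IsShadow (μ.restrict (Set.Iic x)) ν
    (MeasureTheory.Measure.map Prod.snd (π.restrict ((Set.Iic x) ×ˢ (Set.univ : Set ℝ))))

/-- `π` is left-monotone. -/
def IsLeftMonotone (π : MeasureTheory.Measure (ℝ × ℝ)) : Prop :=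
  ∃ Γ : Set (ℝ × ℝ), MeasurableSet Γ ∧ π Γᶜ = 0 ∧
    ∀ x x' ym yp y' : ℝ, (x, ym) ∈ Γ → (x, yp) ∈ Γ → (x', y') ∈ Γ →
      x < x' → ym < y' → y' < yp → False

/-- The sufficient integrability condition on the cost function. -/
def SuffInt (c : ℝ → ℝ → ℝ) (μ ν : MeasureTheory.Measure ℝ) : Prop :=
  ∃ a b : ℝ → ℝ, MeasureTheory.Integrable a μ ∧ MeasureTheory.Integrable b ν ∧
    ∀ x y : ℝ, a x + b y ≤ c x y

/-- `π` is an optimal martingale transport plan (with finite cost) for the cost `c`. -/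
def IsOptimalMart (c : ℝ → ℝ → ℝ) (μ ν : MeasureTheory.Measure ℝ)
    (π : MeasureTheory.Measure (ℝ × ℝ)) : Prop :=
  IsMartingaleCoupling μ ν π ∧
  MeasureTheory.Integrable (fun p : ℝ × ℝ => c p.1 p.2) π ∧
  ∀ π' : MeasureTheory.Measure (ℝ × ℝ), IsMartingaleCoupling μ ν π' →
    MeasureTheory.Integrable (fun p : ℝ × ℝ => c p.1 p.2) π' →
    (∫ p : ℝ × ℝ, c p.1 p.2 ∂π) ≤ ∫ p : ℝ × ℝ, c p.1 p.2 ∂π'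

lemma easy_dir (μ ν : Measure ℝ) [IsFiniteMeasure μ] [IsFiniteMeasure ν]
    (hμ : Integrable (fun x : ℝ => x) μ) (hν : Integrable (fun x : ℝ => x) ν)
    (π : Measure (ℝ × ℝ)) (h : IsMartingaleCoupling μ ν π) : ConvexOrder μ ν := by
  obtain ⟨⟨h1, h2⟩, hm⟩ := h
  have huniv1 : μ univ = π univ := by
    rw [← h1, Measure.map_apply measurable_fst MeasurableSet.univ, preimage_univ]
  have huniv2 : ν univ = π univ := by
    rw [← h2, Measure.map_apply measurable_snd MeasurableSet.univ, preimage_univ]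
  have : IsFiniteMeasure π := ⟨by rw [← huniv1]; exact measure_lt_top μ _⟩
  have i1 : Integrable (fun p : ℝ × ℝ => p.1) π := by
    rw [← h1] at hμ
    exact hμ.comp_measurable measurable_fst
  have i2 : Integrable (fun p : ℝ × ℝ => p.2) π := by
    rw [← h2] at hν
    exact hν.comp_measurable measurable_snd
  have e1 : ∀ F : ℝ → ℝ, Measurable F → ∫ x, F x ∂μ = ∫ p, F p.1 ∂π := by
    intro F hF
    rw [← h1, integral_map measurable_fst.aemeasurable hF.aestronglyMeasurable]
  have e2 : ∀ F : ℝ → ℝ, Measurable F → ∫ x, F x ∂ν = ∫ p, F p.2 ∂π := by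
    intro F hF
    rw [← h2, integral_map measurable_snd.aemeasurable hF.aestronglyMeasurable]
  refine ⟨huniv1.trans huniv2.symm, ?_, ?_⟩
  · have := hm (fun _ => 1) continuous_const ⟨1, by simp⟩
    simp only [one_mul] at this
    rw [integral_sub i2 i1] at this
    rw [e1 (fun x => x) measurable_id, e2 (fun x => x) measurable_id]
    linarith
  · intro k
    rw [e1 (fun x => max (x - k) 0) (by fun_prop), e2 (fun x => max (x - k) 0) (by fun_prop)]
    have key : ∀ n : ℕ, ∫ p, max (p.1 - k) 0 ∂π ≤ ∫ p, max (p.2 - k) 0 ∂π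
        + 1 / ((n : ℝ) + 1) * π.real univ := by
      intro n
      have hn : (0 : ℝ) < (n : ℝ) + 1 := by positivity
      set N : ℝ := (n : ℝ) + 1
      let ρ : ℝ → ℝ := fun x => min 1 (max 0 (N * (x - k)))
      have hρc : Continuous ρ := by fun_prop
      have hρ0 : ∀ x, 0 ≤ ρ x := fun x => le_min zero_le_one (le_max_left _ _)
      have hρ1 : ∀ x, ρ x ≤ 1 := fun x => min_le_left _ _
      have hb : ∃ M : ℝ, ∀ x, |ρ x| ≤ M := ⟨1, fun x => by
        rw [abs_of_nonneg (hρ0 x)]; exact hρ1 x⟩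
      have hz := hm ρ hρc hb
      have iz : Integrable (fun p : ℝ × ℝ => ρ p.1 * (p.2 - p.1)) π := by
        refine (i2.sub i1).bdd_mul (c := 1) (by fun_prop) (ae_of_all _ fun p => ?_)
        rw [Real.norm_eq_abs, abs_of_nonneg (hρ0 _)]; exact hρ1 _
      have j1 : Integrable (fun p : ℝ × ℝ => max (p.1 - k) 0) π :=
        (i1.sub (integrable_const k)).pos_part
      have j2 : Integrable (fun p : ℝ × ℝ => max (p.2 - k) 0) π :=
        (i2.sub (integrable_const k)).pos_part
      have hle : ∀ p : ℝ × ℝ, max (p.1 - k) 0 + ρ p.1 * (p.2 - p.1) ≤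
          max (p.2 - k) 0 + 1 / N := by
        intro p
        have hN : 0 < 1 / N := by positivity
        have a1 : ρ p.1 * (p.2 - k) ≤ max (p.2 - k) 0 := by
          calc ρ p.1 * (p.2 - k) ≤ ρ p.1 * max (p.2 - k) 0 :=
                mul_le_mul_of_nonneg_left (le_max_left _ _) (hρ0 _)
            _ ≤ 1 * max (p.2 - k) 0 := mul_le_mul_of_nonneg_right (hρ1 _) (le_max_right _ _)
            _ = _ := one_mul _
        have a2 : max (p.1 - k) 0 ≤ ρ p.1 * (p.1 - k) + 1 / N := by
          rcases le_total (p.1 - k) 0 with h0 | h0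
          · have : ρ p.1 = 0 := by
              have : N * (p.1 - k) ≤ 0 := mul_nonpos_of_nonneg_of_nonpos hn.le h0
              simp [ρ, max_eq_left this]
            rw [this, max_eq_right h0]; linarith
          · rw [max_eq_left h0]
            rcases le_total (p.1 - k) (1 / N) with h3 | h3
            · have := mul_nonneg (hρ0 p.1) h0
              linarith
            · have : ρ p.1 = 1 := by
                have : 1 ≤ N * (p.1 - k) := by
                  rw [div_le_iff₀ hn] at h3; linarith
                simp only [ρ]
                rw [max_eq_right (by linarith), min_eq_left this]
              rw [this]; linarith
        nlinarith
      have := integral_mono (j1.add iz) (j2.add (integrable_const (1 / N))) hle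
      simp only [Pi.add_apply] at this
      rw [integral_add j1 iz, integral_add j2 (integrable_const _), hz, integral_const,
        smul_eq_mul] at this
      linarith
    have ht : Tendsto (fun n : ℕ => ∫ p, max (p.2 - k) 0 ∂π
        + 1 / ((n : ℝ) + 1) * π.real univ) atTop (𝓝 (∫ p, max (p.2 - k) 0 ∂π + 0 * π.real univ)) :=
      tendsto_const_nhds.add (tendsto_one_div_add_atTop_nhds_zero_nat.mul_const _)
    have := ge_of_tendsto' ht key
    simpa using this

lemma quantile_exists (m : Measure ℝ) [IsFiniteMeasure m] :
    ∃ Q : ℝ → ℝ, Measurable Q ∧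
      (∀ s ∈ Ioo 0 (m.real univ), ∀ x, Q s ≤ x ↔ s ≤ m.real (Iic x)) ∧
      Measure.map Q (volume.restrict (Ioo 0 (m.real univ))) = m := by
  classical
  set M := m.real univ with hM
  let F : ℝ → ℝ := fun x => m.real (Iic x)
  have hFmono : Monotone F := fun x y hxy => measureReal_mono (Iic_subset_Iic.2 hxy)
  have hFM : ∀ x, F x ≤ M := fun x => measureReal_mono (subset_univ _)
  have hF0 : ∀ x, 0 ≤ F x := fun x => measureReal_nonneg
  have htop : Tendsto F atTop (𝓝 M) := by
    have := tendsto_measure_Iic_atTop m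
    exact (ENNReal.tendsto_toReal (measure_ne_top m _)).comp this
  have hbot : Tendsto F atBot (𝓝 0) := by
    have := tendsto_measure_iInter_atBot (μ := m) (s := fun x : ℝ => Iic x)
      (fun _ => measurableSet_Iic.nullMeasurableSet) (fun x y hxy => Iic_subset_Iic.2 hxy)
      ⟨0, measure_ne_top _ _⟩
    have h2 : (⋂ x : ℝ, Iic x) = ∅ := by
      ext y; simp only [mem_iInter, mem_Iic, mem_empty_iff_false, iff_false, not_forall, not_le]
      exact exists_lt y
    rw [h2, measure_empty] at this
    exact (ENNReal.tendsto_toReal ENNReal.zero_ne_top).comp this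
  have hrc : ∀ x, Tendsto F (𝓝[>] x) (𝓝 (F x)) := by
    intro x
    have h : Tendsto (fun y => m (Iic y)) (𝓝[>] x) (𝓝 (m (⋂ r > x, Iic r))) := by
      refine tendsto_measure_biInter_gt (fun _ _ => measurableSet_Iic.nullMeasurableSet)
        (fun i j _ hij => Iic_subset_Iic.2 hij) ⟨x + 1, by simp, measure_ne_top _ _⟩
    have h2 : (⋂ r > x, Iic r) = Iic x := by
      ext y; simp only [mem_iInter, mem_Iic]
      exact ⟨fun h => le_of_forall_gt_imp_ge_of_dense h, fun h r hr => h.trans hr.le⟩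
    rw [h2] at h
    exact (ENNReal.tendsto_toReal (measure_ne_top m _)).comp h
  let Q : ℝ → ℝ := fun s => if s ∈ Ioo 0 M then sInf {x | s ≤ F x} else 0
  have gal : ∀ s ∈ Ioo 0 M, ∀ x, Q s ≤ x ↔ s ≤ F x := by
    intro s hs x
    have hne : {x | s ≤ F x}.Nonempty := by
      obtain ⟨y, hy⟩ := (htop.eventually (lt_mem_nhds hs.2)).exists
      exact ⟨y, hy.le⟩
    have hbd : BddBelow {x | s ≤ F x} := by
      obtain ⟨y, hy⟩ := (hbot.eventually (gt_mem_nhds hs.1)).exists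
      refine ⟨y, fun z hz => ?_⟩
      by_contra hlt
      exact absurd (hFmono (not_le.1 hlt).le) (not_le.2 (lt_of_lt_of_le hy hz))
    simp only [Q, if_pos hs]
    constructor
    · intro h
      refine ge_of_tendsto (hrc x) ?_
      filter_upwards [self_mem_nhdsWithin] with y hy
      obtain ⟨z, hz, hzy⟩ := exists_lt_of_csInf_lt hne (lt_of_le_of_lt h hy)
      exact le_trans hz (hFmono hzy.le)
    · intro h
      exact csInf_le hbd h
  have hQ : Measurable Q := by
    refine measurable_of_Iic fun x => ?_
    have : Q ⁻¹' Iic x = (Ioo 0 M ∩ Iic (F x)) ∪ ((Ioo 0 M)ᶜ ∩ {_s | (0 : ℝ) ≤ x}) := by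
      ext s
      by_cases hs : s ∈ Ioo 0 M
      · have := gal s hs x
        simp only [mem_preimage, mem_Iic, mem_union, mem_inter_iff, mem_compl_iff, hs, true_and,
          not_true, false_and, or_false, this]
      · simp only [mem_preimage, mem_Iic, mem_union, mem_inter_iff, mem_compl_iff, hs, false_and,
          not_false_iff, true_and, false_or, Q, if_false, mem_ofPred_eq]
    rw [this]
    exact (measurableSet_Ioo.inter measurableSet_Iic).union
      (measurableSet_Ioo.compl.inter (MeasurableSet.const _))
  refine ⟨Q, hQ, gal, ?_⟩
  refine Measure.ext_of_Iic _ _ fun x => ?_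
  rw [Measure.map_apply hQ measurableSet_Iic, Measure.restrict_apply (hQ measurableSet_Iic)]
  have h1 : Q ⁻¹' Iic x ∩ Ioo 0 M = Iic (F x) ∩ Ioo 0 M := by
    ext s
    constructor
    · rintro ⟨a, b⟩; exact ⟨(gal s b x).1 a, b⟩
    · rintro ⟨a, b⟩; exact ⟨(gal s b x).2 a, b⟩
  rw [h1]
  have h2 : volume (Iic (F x) ∩ Ioo 0 M) = ENNReal.ofReal (F x) := by
    apply le_antisymm
    · calc volume (Iic (F x) ∩ Ioo 0 M) ≤ volume (Ioc 0 (F x)) := measure_mono fun s hs => ⟨hs.2.1, hs.1⟩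
        _ = _ := by rw [Real.volume_Ioc, sub_zero]
    · calc ENNReal.ofReal (F x) = volume (Ioo 0 (F x)) := by rw [Real.volume_Ioo, sub_zero]
        _ ≤ volume (Iic (F x) ∩ Ioo 0 M) := measure_mono fun s hs => ⟨hs.2.le, hs.1, hs.2.trans_le (hFM x)⟩
  rw [h2]
  exact ENNReal.ofReal_toReal (measure_ne_top m _)

lemma sub_le_aux (L T : Measure ℝ) (w : ℝ → ℝ) (hw : Measurable w)
    (U : ℝ → ℝ) (hU : Measurable U)
    (h1 : Measure.map U T = L.withDensity (fun u => ENNReal.ofReal (w u)))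
    (a : ℝ → ENNReal) (ha : ∀ᵐ s ∂T, a s ≤ (ENNReal.ofReal (w (U s)))⁻¹) :
    Measure.map U (T.withDensity a) ≤ L.restrict {u | 0 < w u} := by
  refine Measure.le_iff.2 fun A hA => ?_
  have hS : MeasurableSet {u | 0 < w u} := measurableSet_lt measurable_const hw
  rw [Measure.map_apply hU hA, withDensity_apply _ (hU hA)]
  calc ∫⁻ s in U ⁻¹' A, a s ∂T ≤ ∫⁻ s in U ⁻¹' A, (ENNReal.ofReal (w (U s)))⁻¹ ∂T :=
        lintegral_mono_ae (ae_restrict_of_ae ha)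
    _ = ∫⁻ u in A, (ENNReal.ofReal (w u))⁻¹ ∂(Measure.map U T) := by
        rw [setLIntegral_map hA (by fun_prop) hU]
    _ = ∫⁻ u in A, ENNReal.ofReal (w u) * (ENNReal.ofReal (w u))⁻¹ ∂L := by
        rw [h1, setLIntegral_withDensity_eq_setLIntegral_mul _ (by fun_prop) (by fun_prop) hA]
        rfl
    _ ≤ ∫⁻ u in A, {u | 0 < w u}.indicator 1 u ∂L := by
        refine lintegral_mono fun u => ?_
        by_cases hu : 0 < w u
        · rw [indicator_of_mem (by exact hu)]
          exact ENNReal.mul_inv_le_one _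
        · simp [ENNReal.ofReal_of_nonpos (not_lt.1 hu)]
    _ = L.restrict {u | 0 < w u} A := by
        rw [lintegral_indicator_one hS, Measure.restrict_apply hA, Measure.restrict_apply hS,
          inter_comm]

lemma core (L T : Measure ℝ) [IsFiniteMeasure L] [IsFiniteMeasure T]
    (X Y U V : ℝ → ℝ) (hX : Measurable X) (hY : Measurable Y) (hU : Measurable U)
    (hV : Measurable V) (iX : Integrable X L) (iY : Integrable Y L)
    (h1 : Measure.map U T = L.withDensity (fun u => ENNReal.ofReal (X u - Y u)))
    (h2 : Measure.map V T = L.withDensity (fun u => ENNReal.ofReal (Y u - X u)))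
    (hae : ∀ᵐ s ∂T, Y (U s) < X (U s) ∧ X (U s) ≤ X (V s) ∧ X (V s) < Y (V s)) :
    ∃ π, IsMartingaleCoupling (Measure.map X L) (Measure.map Y L) π := by
  let a : ℝ → ENNReal := fun s => ENNReal.ofReal (Y (V s) - Y (U s))⁻¹
  have ham : Measurable a := by fun_prop
  set S := T.withDensity a with hS
  have hα : Measure.map U S ≤ L.restrict {u | 0 < X u - Y u} := by
    refine sub_le_aux L T (fun u => X u - Y u) (by fun_prop) U hU h1 a ?_
    filter_upwards [hae] with s hs
    rw [← ENNReal.ofReal_inv_of_pos (by linarith)]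
    exact ENNReal.ofReal_le_ofReal (inv_anti₀ (by linarith) (by linarith))
  have hβ : Measure.map V S ≤ L.restrict {u | 0 < Y u - X u} := by
    refine sub_le_aux L T (fun u => Y u - X u) (by fun_prop) V hV h2 a ?_
    filter_upwards [hae] with s hs
    rw [← ENNReal.ofReal_inv_of_pos (by linarith)]
    exact ENNReal.ofReal_le_ofReal (inv_anti₀ (by linarith) (by linarith))
  have hαL := hα.trans Measure.restrict_le_self
  have hβL := hβ.trans Measure.restrict_le_self
  have hsum : Measure.map U S + Measure.map V S ≤ L := by
    calc _ ≤ L.restrict {u | 0 < X u - Y u} + L.restrict {u | 0 < Y u - X u} :=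
          add_le_add hα hβ
      _ = L.restrict ({u | 0 < X u - Y u} ∪ {u | 0 < Y u - X u}) := by
          rw [Measure.restrict_union]
          · rw [Set.disjoint_left]; intro u hu hv
            simp only [mem_ofPred_eq] at hu hv; linarith
          · exact measurableSet_lt measurable_const (by fun_prop)
      _ ≤ L := Measure.restrict_le_self
  have fS : IsFiniteMeasure S := by
    refine ⟨?_⟩
    have := hαL univ
    rw [Measure.map_apply hU MeasurableSet.univ, preimage_univ] at this
    exact this.trans_lt (measure_lt_top L _)
  obtain ⟨L', hL', fL'⟩ : ∃ L', L' + (Measure.map U S + Measure.map V S) = L ∧ IsFiniteMeasure L' :=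
    ⟨L - (Measure.map U S + Measure.map V S), Measure.sub_add_cancel_of_le hsum, inferInstance⟩
  have hL'L : L' ≤ L := by rw [← hL']; exact Measure.le_add_right le_rfl
  have mXY : Measurable fun u => (X u, Y u) := by fun_prop
  have mUV : Measurable fun s => (X (U s), Y (V s)) := by fun_prop
  have mVU : Measurable fun s => (X (V s), Y (U s)) := by fun_prop
  refine ⟨Measure.map (fun u => (X u, Y u)) L' + (Measure.map (fun s => (X (U s), Y (V s))) S
    + Measure.map (fun s => (X (V s), Y (U s))) S), ⟨?_, ?_⟩, ?_⟩
  · rw [Measure.map_add _ _ measurable_fst, Measure.map_add _ _ measurable_fst,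
      Measure.map_map measurable_fst mXY, Measure.map_map measurable_fst mUV,
      Measure.map_map measurable_fst mVU]
    conv_rhs => rw [← hL', Measure.map_add _ _ hX, Measure.map_add _ _ hX, Measure.map_map hX hU,
      Measure.map_map hX hV]
    rfl
  · rw [Measure.map_add _ _ measurable_snd, Measure.map_add _ _ measurable_snd,
      Measure.map_map measurable_snd mXY, Measure.map_map measurable_snd mUV,
      Measure.map_map measurable_snd mVU]
    conv_rhs => rw [← hL', Measure.map_add _ _ hY, Measure.map_add _ _ hY, Measure.map_map hY hU,
      Measure.map_map hY hV, add_comm (Measure.map (Y ∘ U) S)]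
    rfl
  · rintro ρ hρ ⟨B, hB⟩
    have mρ : Measurable ρ := hρ.measurable
    have bddm : ∀ (P : Measure ℝ) (Z W : ℝ → ℝ), Measurable Z → Integrable W P →
        Integrable (fun s => ρ (Z s) * W s) P := by
      intro P Z W hZ hW
      exact hW.bdd_mul (c := B) (mρ.comp hZ).aestronglyMeasurable (ae_of_all _ fun s => hB _)
    have iXU : Integrable (fun s => X (U s)) S := (iX.mono_measure hαL).comp_measurable hU
    have iYU : Integrable (fun s => Y (U s)) S := (iY.mono_measure hαL).comp_measurable hU
    have iXV : Integrable (fun s => X (V s)) S := (iX.mono_measure hβL).comp_measurable hV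
    have iYV : Integrable (fun s => Y (V s)) S := (iY.mono_measure hβL).comp_measurable hV
    have iL : Integrable (fun u => ρ (X u) * (Y u - X u)) L := bddm L X _ hX (iY.sub iX)
    have mG : Measurable fun p : ℝ × ℝ => ρ p.1 * (p.2 - p.1) := by fun_prop
    have mg : Measurable fun u => ρ (X u) * (Y u - X u) := by fun_prop
    have k1 := bddm S (fun s => X (U s)) _ (by fun_prop) (iYV.sub iXU)
    have k2 := bddm S (fun s => X (V s)) _ (by fun_prop) (iYU.sub iXV)
    have k3 := bddm S (fun s => X (U s)) _ (by fun_prop) (iYU.sub iXU)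
    have k4 := bddm S (fun s => X (V s)) _ (by fun_prop) (iYV.sub iXV)
    simp only [Pi.sub_apply] at k1 k2 k3 k4
    have j0 : Integrable (fun p : ℝ × ℝ => ρ p.1 * (p.2 - p.1))
        (Measure.map (fun u => (X u, Y u)) L') :=
      (integrable_map_measure mG.aestronglyMeasurable mXY.aemeasurable).2 (iL.mono_measure hL'L)
    have j1 : Integrable (fun p : ℝ × ℝ => ρ p.1 * (p.2 - p.1))
        (Measure.map (fun s => (X (U s), Y (V s))) S) :=
      (integrable_map_measure mG.aestronglyMeasurable mUV.aemeasurable).2 k1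
    have j2 : Integrable (fun p : ℝ × ℝ => ρ p.1 * (p.2 - p.1))
        (Measure.map (fun s => (X (V s), Y (U s))) S) :=
      (integrable_map_measure mG.aestronglyMeasurable mVU.aemeasurable).2 k2
    rw [integral_add_measure j0 (j1.add_measure j2), integral_add_measure j1 j2,
      integral_map mXY.aemeasurable mG.aestronglyMeasurable,
      integral_map mUV.aemeasurable mG.aestronglyMeasurable,
      integral_map mVU.aemeasurable mG.aestronglyMeasurable]
    have eL : ∫ u, ρ (X u) * (Y u - X u) ∂L = ∫ u, ρ (X u) * (Y u - X u) ∂L' +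
        (∫ s, ρ (X (U s)) * (Y (U s) - X (U s)) ∂S + ∫ s, ρ (X (V s)) * (Y (V s) - X (V s)) ∂S) := by
      conv_lhs => rw [← hL']
      rw [integral_add_measure (iL.mono_measure hL'L)
        ((iL.mono_measure hαL).add_measure (iL.mono_measure hβL)),
        integral_add_measure (iL.mono_measure hαL) (iL.mono_measure hβL),
        integral_map hU.aemeasurable mg.aestronglyMeasurable,
        integral_map hV.aemeasurable mg.aestronglyMeasurable]
    have d1 : ∫ s, ρ (X (U s)) * (Y (V s) - X (U s)) ∂S - ∫ s, ρ (X (U s)) * (Y (U s) - X (U s)) ∂S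
        = ∫ s, ρ (X (U s)) ∂T := by
      rw [← integral_sub k1 k3, hS, integral_withDensity_eq_integral_toReal_smul ham
        (ae_of_all _ fun s => ENNReal.ofReal_lt_top)]
      refine integral_congr_ae ?_
      filter_upwards [hae] with s hs
      have hp : 0 < Y (V s) - Y (U s) := by linarith
      simp only [a, smul_eq_mul]
      rw [ENNReal.toReal_ofReal (inv_pos.2 hp).le]
      field_simp
      ring
    have d2 : ∫ s, ρ (X (V s)) * (Y (V s) - X (V s)) ∂S - ∫ s, ρ (X (V s)) * (Y (U s) - X (V s)) ∂S
        = ∫ s, ρ (X (V s)) ∂T := by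
      rw [← integral_sub k4 k2, hS, integral_withDensity_eq_integral_toReal_smul ham
        (ae_of_all _ fun s => ENNReal.ofReal_lt_top)]
      refine integral_congr_ae ?_
      filter_upwards [hae] with s hs
      have hp : 0 < Y (V s) - Y (U s) := by linarith
      simp only [a, smul_eq_mul]
      rw [ENNReal.toReal_ofReal (inv_pos.2 hp).le]
      field_simp
      ring
    have t1 : ∫ s, ρ (X (U s)) ∂T = ∫ u, ρ (X u) * max (X u - Y u) 0 ∂L := by
      rw [← integral_map (f := fun u => ρ (X u)) hU.aemeasurable
        (mρ.comp hX).aestronglyMeasurable, h1,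
        integral_withDensity_eq_integral_toReal_smul (by fun_prop)
        (ae_of_all _ fun s => ENNReal.ofReal_lt_top)]
      refine integral_congr_ae (ae_of_all _ fun u => ?_)
      simp only [ENNReal.toReal_ofReal', smul_eq_mul]
      ring
    have t2 : ∫ s, ρ (X (V s)) ∂T = ∫ u, ρ (X u) * max (Y u - X u) 0 ∂L := by
      rw [← integral_map (f := fun u => ρ (X u)) hV.aemeasurable
        (mρ.comp hX).aestronglyMeasurable, h2,
        integral_withDensity_eq_integral_toReal_smul (by fun_prop)
        (ae_of_all _ fun s => ENNReal.ofReal_lt_top)]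
      refine integral_congr_ae (ae_of_all _ fun u => ?_)
      simp only [ENNReal.toReal_ofReal', smul_eq_mul]
      ring
    have t3 : ∫ u, ρ (X u) * (Y u - X u) ∂L =
        ∫ u, ρ (X u) * max (Y u - X u) 0 ∂L - ∫ u, ρ (X u) * max (X u - Y u) 0 ∂L := by
      have q1 := bddm L X _ hX (iY.sub iX).pos_part
      have q2 := bddm L X _ hX (iX.sub iY).pos_part
      simp only [Pi.sub_apply] at q1 q2
      rw [← integral_sub q1 q2]
      refine integral_congr_ae (ae_of_all _ fun u => ?_)
      dsimp only
      rcases le_total (X u) (Y u) with h | h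
      · rw [max_eq_left (by linarith : 0 ≤ Y u - X u), max_eq_right (by linarith)]; ring
      · rw [max_eq_right (by linarith : Y u - X u ≤ 0), max_eq_left (by linarith)]; ring
    linarith

lemma hard_dir (μ ν : Measure ℝ) [IsFiniteMeasure μ] [IsFiniteMeasure ν]
    (hμ : Integrable (fun x : ℝ => x) μ) (hν : Integrable (fun x : ℝ => x) ν)
    (h : ConvexOrder μ ν) : ∃ π, IsMartingaleCoupling μ ν π := by
  obtain ⟨hmass, hmean, hcall⟩ := h
  obtain ⟨X, hX, gX, eX⟩ := quantile_exists μ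
  obtain ⟨Y, hY, gY, eY⟩ := quantile_exists ν
  have hMM : ν.real univ = μ.real univ := by simp only [Measure.real, hmass]
  rw [hMM] at gY eY
  set M := μ.real univ with hM
  set L := (volume : Measure ℝ).restrict (Ioo 0 M) with hL
  have iX : Integrable X L := by
    rw [← eX] at hμ; exact hμ.comp_measurable hX
  have iY : Integrable Y L := by
    rw [← eY] at hν; exact hν.comp_measurable hY
  have monoX : ∀ s ∈ Ioo 0 M, ∀ t ∈ Ioo 0 M, s ≤ t → X s ≤ X t := fun s hs t ht hst =>
    (gX s hs _).2 (hst.trans ((gX t ht _).1 le_rfl))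
  have monoY : ∀ s ∈ Ioo 0 M, ∀ t ∈ Ioo 0 M, s ≤ t → Y s ≤ Y t := fun s hs t ht hst =>
    (gY s hs _).2 (hst.trans ((gY t ht _).1 le_rfl))
  have mean0 : ∫ u, X u ∂L = ∫ u, Y u ∂L := by
    have e1 : ∫ x, x ∂μ = ∫ u, X u ∂L := by
      conv_lhs => rw [← eX]
      exact integral_map hX.aemeasurable measurable_id.aestronglyMeasurable
    have e2 : ∫ x, x ∂ν = ∫ u, Y u ∂L := by
      conv_lhs => rw [← eY]
      exact integral_map hY.aemeasurable measurable_id.aestronglyMeasurable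
    rw [← e1, ← e2, hmean]
  have call : ∀ k, ∫ u, max (X u - k) 0 ∂L ≤ ∫ u, max (Y u - k) 0 ∂L := by
    intro k
    have mk : Measurable fun x : ℝ => max (x - k) 0 := by fun_prop
    have e1 : ∫ x, max (x - k) 0 ∂μ = ∫ u, max (X u - k) 0 ∂L := by
      conv_lhs => rw [← eX]
      exact integral_map hX.aemeasurable mk.aestronglyMeasurable
    have e2 : ∫ x, max (x - k) 0 ∂ν = ∫ u, max (Y u - k) 0 ∂L := by
      conv_lhs => rw [← eY]
      exact integral_map hY.aemeasurable mk.aestronglyMeasurable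
    rw [← e1, ← e2]; exact hcall k
  -- integrated quantile comparison
  have hint : ∀ u, 0 ≤ ∫ s in Iic u, (X s - Y s) ∂L := by
    intro u
    rcases le_or_gt u 0 with hu | hu
    · have : L.restrict (Iic u) = 0 := by
        rw [Measure.restrict_eq_zero, hL, Measure.restrict_apply measurableSet_Iic]
        have : Iic u ∩ Ioo 0 M = ∅ := by
          ext s; simp only [mem_inter_iff, mem_Iic, mem_Ioo, mem_empty_iff_false, iff_false]
          rintro ⟨h1, h2, h3⟩; linarith
        rw [this, measure_empty]
      rw [this, integral_zero_measure]
    rcases le_or_gt M u with hu2 | hu2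
    · have : L.restrict (Iic u) = L := by
        rw [hL, Measure.restrict_restrict measurableSet_Iic]
        congr 1
        ext s; simp only [mem_inter_iff, mem_Iic, mem_Ioo, and_iff_right_iff_imp]
        rintro ⟨h2, h3⟩; linarith
      rw [this, integral_sub iX iY, mean0, sub_self]
    · set k := Y u
      have huM : u ∈ Ioo 0 M := ⟨hu, hu2⟩
      have aeL : ∀ᵐ s ∂L, s ∈ Ioo 0 M := ae_restrict_mem measurableSet_Ioo
      have iXk : Integrable (fun s => max (X s - k) 0) L := (iX.sub (integrable_const k)).pos_part
      have iYk : Integrable (fun s => max (Y s - k) 0) L := (iY.sub (integrable_const k)).pos_part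
      have iD : Integrable (fun s => X s - Y s) L := iX.sub iY
      rw [← integral_indicator measurableSet_Iic]
      have hle : ∀ᵐ s ∂L, (max (Y s - k) 0 - max (X s - k) 0) + (X s - Y s) ≤
          (Iic u).indicator (fun s => X s - Y s) s := by
        filter_upwards [aeL] with s hs
        by_cases hsu : s ≤ u
        · rw [indicator_of_mem (by exact hsu)]
          have := monoY s hs u huM hsu
          rw [max_eq_right (by linarith : Y s - k ≤ 0)]
          have := le_max_right (X s - k) 0
          linarith
        · rw [indicator_of_notMem (by exact hsu)]
          have := monoY u huM s hs (not_le.1 hsu).le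
          rw [max_eq_left (by linarith : 0 ≤ Y s - k)]
          have := le_max_left (X s - k) 0
          linarith
      have iE : Integrable (fun s => max (Y s - k) 0 - max (X s - k) 0) L := iYk.sub iXk
      have := integral_mono_ae ((iYk.sub iXk).add iD) (iD.indicator measurableSet_Iic) hle
      simp only [Pi.add_apply, Pi.sub_apply] at this
      rw [integral_add iE iD, integral_sub iYk iXk, integral_sub iX iY] at this
      have := call k
      linarith
  set m1 := L.withDensity (fun u => ENNReal.ofReal (X u - Y u)) with hm1
  set m2 := L.withDensity (fun u => ENNReal.ofReal (Y u - X u)) with hm2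
  have : IsFiniteMeasure m1 := isFiniteMeasure_withDensity_ofReal (iX.sub iY).2
  have : IsFiniteMeasure m2 := isFiniteMeasure_withDensity_ofReal (iY.sub iX).2
  have r1 : ∀ A, MeasurableSet A → m1.real A = ∫ u in A, max (X u - Y u) 0 ∂L := by
    intro A hA
    have h0 : ∀ u, 0 ≤ max (X u - Y u) 0 := fun u => le_max_right _ _
    rw [Measure.real, hm1, withDensity_apply _ hA,
      integral_eq_lintegral_of_nonneg_ae (ae_of_all _ h0)
      (by fun_prop)]
    simp [ENNReal.ofReal_max]
  have r2 : ∀ A, MeasurableSet A → m2.real A = ∫ u in A, max (Y u - X u) 0 ∂L := by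
    intro A hA
    have h0 : ∀ u, 0 ≤ max (Y u - X u) 0 := fun u => le_max_right _ _
    rw [Measure.real, hm2, withDensity_apply _ hA,
      integral_eq_lintegral_of_nonneg_ae (ae_of_all _ h0)
      (by fun_prop)]
    simp [ENNReal.ofReal_max]
  have rd : ∀ A, MeasurableSet A → m1.real A - m2.real A = ∫ u in A, (X u - Y u) ∂L := by
    intro A hA
    have q1 : Integrable (fun u => max (X u - Y u) 0) (L.restrict A) :=
      (iX.sub iY).pos_part.integrableOn
    have q2 : Integrable (fun u => max (Y u - X u) 0) (L.restrict A) :=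
      (iY.sub iX).pos_part.integrableOn
    rw [r1 A hA, r2 A hA, ← integral_sub q1 q2]
    refine integral_congr_ae (ae_of_all _ fun u => ?_)
    dsimp only
    rcases le_total (X u) (Y u) with h | h
    · rw [max_eq_left (by linarith : 0 ≤ Y u - X u), max_eq_right (by linarith)]; ring
    · rw [max_eq_right (by linarith : Y u - X u ≤ 0), max_eq_left (by linarith)]; ring
  have hcc : m2.real univ = m1.real univ := by
    have := rd univ MeasurableSet.univ
    rw [Measure.restrict_univ, integral_sub iX iY, mean0] at this
    linarith
  obtain ⟨U, hU, gU, eU⟩ := quantile_exists m1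
  obtain ⟨V, hV, gV, eV⟩ := quantile_exists m2
  rw [hcc] at gV eV
  set c := m1.real univ
  have aU : ∀ᵐ s ∂(volume.restrict (Ioo 0 c)), U s ∈ Ioo 0 M ∧ Y (U s) < X (U s) := by
    refine ae_of_ae_map (p := fun u => u ∈ Ioo 0 M ∧ Y u < X u) hU.aemeasurable ?_
    rw [eU, hm1, ae_withDensity_iff (by fun_prop)]
    filter_upwards [ae_restrict_mem measurableSet_Ioo] with u hu hne
    refine ⟨hu, ?_⟩
    have := ENNReal.ofReal_pos.1 (pos_iff_ne_zero.2 hne)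
    linarith
  have aV : ∀ᵐ s ∂(volume.restrict (Ioo 0 c)), V s ∈ Ioo 0 M ∧ X (V s) < Y (V s) := by
    refine ae_of_ae_map (p := fun u => u ∈ Ioo 0 M ∧ X u < Y u) hV.aemeasurable ?_
    rw [eV, hm2, ae_withDensity_iff (by fun_prop)]
    filter_upwards [ae_restrict_mem measurableSet_Ioo] with u hu hne
    refine ⟨hu, ?_⟩
    have := ENNReal.ofReal_pos.1 (pos_iff_ne_zero.2 hne)
    linarith
  have main := core L (volume.restrict (Ioo 0 c)) X Y U V hX hY hU hV iX iY eU eV (by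
    filter_upwards [aU, aV, ae_restrict_mem measurableSet_Ioo] with s h1 h2 hs
    refine ⟨h1.2, monoX _ h1.1 _ h2.1 ?_, h2.2⟩
    rw [gU s hs]
    have := (gV s hs (V s)).1 le_rfl
    have h3 := rd (Iic (V s)) measurableSet_Iic
    have h4 := hint (V s)
    linarith)
  rwa [eX, eY] at main

lemma main_aux (μ ν : Measure ℝ) [IsFiniteMeasure μ] [IsFiniteMeasure ν]
    (hμ : Integrable (fun x : ℝ => x) μ) (hν : Integrable (fun x : ℝ => x) ν) :
    (∃ π : Measure (ℝ × ℝ), IsMartingaleCoupling μ ν π) ↔ ConvexOrder μ ν :=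
  ⟨fun ⟨π, hπ⟩ => easy_dir μ ν hμ hν π hπ, hard_dir μ ν hμ hν⟩

/-- `Π_M(μ,ν)` is nonempty iff `μ ≤C ν`. -/
theorem martingale_coupling_exists_iff_convexOrder
    (μ ν : MeasureTheory.Measure ℝ)
    [MeasureTheory.IsFiniteMeasure μ] [MeasureTheory.IsFiniteMeasure ν]
    (hμ : MeasureTheory.Integrable (fun x : ℝ => x) μ)
    (hν : MeasureTheory.Integrable (fun x : ℝ => x) ν) :
    (∃ π : MeasureTheory.Measure (ℝ × ℝ), IsMartingaleCoupling μ ν π) ↔ ConvexOrder μ ν := by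
  exact main_aux μ ν hμ hν
end
end

section
/- Let μ ≤C ν be probability measures on ℝ with finite first moments and let c : ℝ×ℝ → ℝ be a Borel cost function satisfying the sufficient integrability condition with respect to μ and ν. Let π ∈ Π_M(μ,ν) be optimal for c with ∫ c dπ finite. Then there exists a Borel set Γ ⊆ ℝ×ℝ with π(Γ) = 1 such that: for every finitely supported measure α on ℝ×ℝ whose support is contained in Γ and every competitor α' of α, one has ∫ c dα ≤ ∫ c dα'. -/
open MeasureTheory Set Filter Topology

noncomputable section

/-- `α'` is a competitor of `α`. -/
def IsCompetitor (α α' : MeasureTheory.Measure (ℝ × ℝ)) : Prop :=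
  α'.map Prod.fst = α.map Prod.fst ∧ α'.map Prod.snd = α.map Prod.snd ∧
  ∀ x : ℝ, (∫ p in Prod.fst ⁻¹' ({x} : Set ℝ), p.2 ∂α) =
    ∫ p in Prod.fst ⁻¹' ({x} : Set ℝ), p.2 ∂α'

section Kellerer

variable {E X ι : Type*} [MeasurableSpace E] [Fintype ι]

/-- Fractional covers of a set. -/
def KFeas (p : ι → X → E) (A : Set X) (f : E → ℝ) : Prop :=
  Measurable f ∧ (∀ z, 0 ≤ f z) ∧ (∀ z, f z ≤ 1) ∧ ∀ x ∈ A, 1 ≤ ∑ i, f (p i x)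

/-- The capacity. -/
def KCap (P : Measure E) (p : ι → X → E) (A : Set X) : ℝ :=
  sInf {r | ∃ f, KFeas p A f ∧ r = ∫ z, (f z) ^ 2 ∂P}

lemma KCap_le (P : Measure E) (p : ι → X → E) (A : Set X) {f : E → ℝ} (hf : KFeas p A f) :
    KCap P p A ≤ ∫ z, (f z) ^ 2 ∂P := by
  refine csInf_le ⟨0, ?_⟩ ⟨f, hf, rfl⟩
  rintro r ⟨g, -, rfl⟩
  exact integral_nonneg fun z => sq_nonneg _

lemma KFeas_one [Nonempty ι] (p : ι → X → E) (A : Set X) : KFeas p A (fun _ => 1) := by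
  refine ⟨measurable_const, by simp, by simp, fun x _ => ?_⟩
  simp only [Finset.sum_const, nsmul_eq_mul, mul_one]
  exact_mod_cast Fintype.card_pos (α := ι)

lemma KCap_exists [Nonempty ι] (P : Measure E) (p : ι → X → E) (A : Set X) {t : ℝ}
    (ht : KCap P p A < t) : ∃ f, KFeas p A f ∧ ∫ z, (f z) ^ 2 ∂P < t := by
  obtain ⟨r, ⟨f, hf, rfl⟩, h⟩ := exists_lt_of_csInf_lt
    (s := {r | ∃ f, KFeas p A f ∧ r = ∫ z, (f z) ^ 2 ∂P}) ⟨_, _, KFeas_one p A, rfl⟩ ht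
  exact ⟨f, hf, h⟩

lemma KFeas.mono {p : ι → X → E} {A B : Set X} (h : A ⊆ B) {f : E → ℝ} (hf : KFeas p B f) :
    KFeas p A f := ⟨hf.1, hf.2.1, hf.2.2.1, fun x hx => hf.2.2.2 x (h hx)⟩

lemma KCap_nonneg (P : Measure E) (p : ι → X → E) (A : Set X) : 0 ≤ KCap P p A := by
  apply Real.sInf_nonneg
  rintro r ⟨g, -, rfl⟩
  exact integral_nonneg fun z => sq_nonneg _

lemma KCap_mono [Nonempty ι] (P : Measure E) (p : ι → X → E) {A B : Set X} (h : A ⊆ B) :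
    KCap P p A ≤ KCap P p B := by
  refine le_csInf ⟨_, _, KFeas_one p B, rfl⟩ ?_
  rintro r ⟨g, hg, rfl⟩
  exact KCap_le P p A (hg.mono h)

lemma KFeas.integrable {p : ι → X → E} {A : Set X} {f : E → ℝ} (hf : KFeas p A f)
    (P : Measure E) [IsFiniteMeasure P] : MemLp f 2 P := by
  refine MemLp.of_bound hf.1.aestronglyMeasurable 1 (ae_of_all _ fun z => ?_)
  rw [Real.norm_eq_abs, abs_le]
  exact ⟨by linarith [hf.2.1 z], hf.2.2.1 z⟩

lemma norm_toLp_sq (P : Measure E) (f : E → ℝ) (hf : MemLp f 2 P) :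
    ‖hf.toLp f‖ ^ 2 = ∫ z, (f z) ^ 2 ∂P := by
  rw [← real_inner_self_eq_norm_sq, L2.inner_def]
  apply integral_congr_ae
  filter_upwards [hf.coeFn_toLp] with z hz
  rw [hz]
  simp [sq]

lemma KCap_iUnion [Nonempty ι] (P : Measure E) [IsFiniteMeasure P] (p : ι → X → E)
    (A : ℕ → Set X) (hA : Monotone A) {t : ℝ} (ht : ∀ n, KCap P p (A n) ≤ t) :
    ∃ f, KFeas p (⋃ n, A n) f ∧ ∫ z, (f z) ^ 2 ∂P ≤ t := by
  set d : ℕ → ℝ := fun n => KCap P p (A n) with hd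
  have hdm : Monotone d := fun m n h => KCap_mono P p (hA h)
  have hbdd : BddAbove (range d) := ⟨t, by rintro _ ⟨n, rfl⟩; exact ht n⟩
  have hlim := tendsto_atTop_ciSup hdm hbdd
  set D := ⨆ n, d n
  have hdD : ∀ n, d n ≤ D := fun n => le_ciSup hbdd n
  have hDt : D ≤ t := ciSup_le ht
  have hex : ∀ n : ℕ, ∃ f, KFeas p (A n) f ∧ ∫ z, (f z) ^ 2 ∂P < d n + 1 / ((n : ℝ) + 1) :=
    fun n => KCap_exists P p (A n) (by
      have : (0 : ℝ) < 1 / ((n : ℝ) + 1) := by positivity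
      simp only [hd]; linarith)
  choose f hf hfi using hex
  have hmem : ∀ n, MemLp (f n) 2 P := fun n => (hf n).integrable P
  let F : ℕ → Lp ℝ 2 P := fun n => (hmem n).toLp (f n)
  have hb : Tendsto (fun N : ℕ => Real.sqrt (4 * (D - d N) + 4 * (1 / ((N : ℝ) + 1)))) atTop (𝓝 0) := by
    have h1 : Tendsto (fun N : ℕ => 4 * (D - d N) + 4 * (1 / ((N : ℝ) + 1))) atTop
        (𝓝 (4 * (D - D) + 4 * 0)) :=
      ((tendsto_const_nhds.sub hlim).const_mul 4).add
        (tendsto_one_div_add_atTop_nhds_zero_nat.const_mul 4)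
    have h2 := (Real.continuous_sqrt.tendsto _).comp h1
    simpa [Function.comp_def] using h2
  have hcau : CauchySeq F := by
    refine cauchySeq_of_le_tendsto_0 _ (fun n m N hn hm => ?_) hb
    apply Real.le_sqrt_of_sq_le
    rw [dist_eq_norm, ← MemLp.toLp_sub, norm_toLp_sq]
    have hmid : d N ≤ ∫ z, ((f n z + f m z) / 2) ^ 2 ∂P := by
      apply KCap_le
      refine ⟨((hf n).1.add (hf m).1).div_const 2, fun z => ?_, fun z => ?_, fun x hx => ?_⟩
      · linarith [(hf n).2.1 z, (hf m).2.1 z]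
      · linarith [(hf n).2.2.1 z, (hf m).2.2.1 z]
      · have h1 := (hf n).2.2.2 x (hA hn hx)
        have h2 := (hf m).2.2.2 x (hA hm hx)
        rw [← Finset.sum_div, Finset.sum_add_distrib]
        linarith
    have hpar : ∫ z, (f n - f m) z ^ 2 ∂P =
        2 * ∫ z, (f n z) ^ 2 ∂P + 2 * ∫ z, (f m z) ^ 2 ∂P
          - 4 * ∫ z, ((f n z + f m z) / 2) ^ 2 ∂P := by
      have i1 := (hmem n).integrable_sq
      have i2 := (hmem m).integrable_sq
      have i3 : Integrable (fun z => ((f n z + f m z) / 2) ^ 2) P := by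
        have := (((hmem n).add (hmem m)).const_mul (1 / 2)).integrable_sq
        refine this.congr (ae_of_all _ fun z => ?_)
        simp only [Pi.add_apply]; ring
      rw [← integral_const_mul, ← integral_const_mul, ← integral_const_mul,
        ← integral_add (i1.const_mul 2) (i2.const_mul 2)]
      have i4 : Integrable (fun z => 2 * f n z ^ 2 + 2 * f m z ^ 2) P :=
        (i1.const_mul 2).add (i2.const_mul 2)
      rw [← integral_sub i4 (i3.const_mul 4)]
      refine integral_congr_ae (ae_of_all _ fun z => ?_)
      simp only [Pi.sub_apply]; ring
    have e1 : 1 / ((n : ℝ) + 1) ≤ 1 / ((N : ℝ) + 1) := by gcongr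
    have e2 : 1 / ((m : ℝ) + 1) ≤ 1 / ((N : ℝ) + 1) := by gcongr
    rw [hpar]
    linarith [hfi n, hfi m, hdD n, hdD m]
  obtain ⟨G, hG⟩ := cauchySeq_tendsto_of_complete hcau
  obtain ⟨ns, hns, hae⟩ := (tendstoInMeasure_of_tendsto_Lp hG).exists_seq_tendsto_ae
  have hae2 : ∀ᵐ z ∂P, ∀ n, F n z = f n z := ae_all_iff.2 fun n => (hmem n).coeFn_toLp
  have hbd : ∀ z, IsBoundedUnder (· ≤ ·) atTop (fun k => f (ns k) z) := fun z =>
    isBoundedUnder_of ⟨1, fun k => (hf _).2.2.1 z⟩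
  have hbd' : ∀ z, IsBoundedUnder (· ≥ ·) atTop (fun k => f (ns k) z) := fun z =>
    isBoundedUnder_of ⟨0, fun k => (hf _).2.1 z⟩
  refine ⟨fun z => limsup (fun k => f (ns k) z) atTop, ⟨?_, ?_, ?_, ?_⟩, ?_⟩
  · exact Measurable.limsup fun k => (hf _).1
  · intro z
    exact le_limsup_of_frequently_le (Frequently.of_forall fun k => (hf _).2.1 z) (hbd z)
  · intro z
    exact limsup_le_of_le (hbd' z).isCoboundedUnder_le (Eventually.of_forall fun k => (hf _).2.2.1 z)
  · intro x hx
    obtain ⟨n, hn⟩ := mem_iUnion.1 hx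
    refine le_of_forall_pos_le_add fun ε hε => ?_
    have hev : ∀ᶠ k in atTop, ∀ i, f (ns k) (p i x) <
        limsup (fun k => f (ns k) (p i x)) atTop + ε / Fintype.card ι := by
      rw [eventually_all]
      intro i
      refine eventually_lt_of_limsup_lt ?_ (hbd _)
      have : (0 : ℝ) < ε / Fintype.card ι := div_pos hε (by exact_mod_cast Fintype.card_pos)
      linarith
    obtain ⟨k, hk, hkn⟩ := (hev.and (eventually_ge_atTop n)).exists
    have h1 := (hf (ns k)).2.2.2 x (hA (hkn.trans (hns.id_le k)) hn)
    have h2 : ∑ i, f (ns k) (p i x) ≤ ∑ i, (limsup (fun k => f (ns k) (p i x)) atTop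
        + ε / Fintype.card ι) := Finset.sum_le_sum fun i _ => (hk i).le
    rw [Finset.sum_add_distrib] at h2
    have h3 : ∑ _i : ι, ε / (Fintype.card ι : ℝ) = ε := by
      have : (Fintype.card ι : ℝ) ≠ 0 := by exact_mod_cast Fintype.card_ne_zero
      simp; field_simp
    linarith
  · have hconv : Tendsto (fun k => ∫ z, (f (ns k) z) ^ 2 ∂P) atTop
        (𝓝 (∫ z, (limsup (fun k => f (ns k) z) atTop) ^ 2 ∂P)) := by
      refine tendsto_integral_of_dominated_convergence (fun _ => 1)
        (fun k => ((hf _).1.pow_const 2).aestronglyMeasurable) (integrable_const _) ?_ ?_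
      · intro k
        refine ae_of_all _ fun z => ?_
        rw [Real.norm_eq_abs, abs_of_nonneg (sq_nonneg _)]
        exact pow_le_one₀ ((hf _).2.1 z) ((hf _).2.2.1 z)
      · filter_upwards [hae, hae2] with z h1 h2
        have h3 : Tendsto (fun k => f (ns k) z) atTop (𝓝 (G z)) := by
          simpa [h2] using h1
        rw [h3.limsup_eq]
        exact h3.pow 2
    have hup : Tendsto (fun k : ℕ => D + 1 / ((k : ℝ) + 1)) atTop (𝓝 (D + 0)) :=
      tendsto_const_nhds.add tendsto_one_div_add_atTop_nhds_zero_nat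
    have := le_of_tendsto_of_tendsto' hconv hup (fun k => by
      have e1 : 1 / ((ns k : ℝ) + 1) ≤ 1 / ((k : ℝ) + 1) := by
        have : (k : ℝ) ≤ ns k := by exact_mod_cast hns.id_le k
        gcongr
      linarith [hfi (ns k), hdD (ns k)])
    linarith

lemma KCap_zero [Nonempty ι] (P : Measure E) [IsFiniteMeasure P] (p : ι → X → E)
    (A : Set X) (hA : KCap P p A ≤ 0) :
    ∃ N : Set E, MeasurableSet N ∧ P N = 0 ∧ ∀ x ∈ A, ∃ i, p i x ∈ N := by
  obtain ⟨f, hf, hi⟩ := KCap_iUnion P p (fun _ => A) monotone_const (fun _ => hA)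
  rw [iUnion_const] at hf
  refine ⟨{z | f z ≠ 0}, (hf.1 (measurableSet_singleton 0)).compl, ?_, fun x hx => ?_⟩
  · have h0 : ∫ z, (f z) ^ 2 ∂P = 0 := le_antisymm hi (integral_nonneg fun z => sq_nonneg _)
    rw [integral_eq_zero_iff_of_nonneg (fun z => sq_nonneg _) (hf.integrable P).integrable_sq] at h0
    have : ∀ᵐ z ∂P, f z = 0 := by
      filter_upwards [h0] with z hz
      simpa using hz
    exact this
  · by_contra hcon
    push Not at hcon
    have h1 := hf.2.2.2 x hx
    rw [Finset.sum_eq_zero fun i _ => by simpa using hcon i] at h1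
    linarith

end Kellerer

section Kellerer2

variable {E X ι : Type*} [MeasurableSpace E] [Fintype ι]

lemma K_seq [Nonempty ι] (P : Measure E) [IsFiniteMeasure P] (p : ι → X → E)
    (g : (ℕ → ℕ) → X) {t : ℝ} (ht : t < KCap P p (range g)) :
    ∃ n : ℕ → ℕ, ∀ k, t < KCap P p (g '' {σ | ∀ i < k, σ i ≤ n i}) := by
  have step : ∀ (k : ℕ) (n : ℕ → ℕ), t < KCap P p (g '' {σ | ∀ i < k, σ i ≤ n i}) →
      ∃ j, t < KCap P p (g '' {σ | ∀ i < k + 1, σ i ≤ Function.update n k j i}) := by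
    intro k n h
    by_contra! hcon
    obtain ⟨f, hf, hfi⟩ := KCap_iUnion P p
      (fun j => g '' {σ | ∀ i < k + 1, σ i ≤ Function.update n k j i}) (by
        intro j j' hj
        apply image_mono
        intro σ hσ i hi
        refine (hσ i hi).trans ?_
        by_cases hik : i = k
        · subst hik; simpa using hj
        · simp [hik]) hcon
    have hsub : g '' {σ | ∀ i < k, σ i ≤ n i} ⊆
        ⋃ j, g '' {σ | ∀ i < k + 1, σ i ≤ Function.update n k j i} := by
      rintro _ ⟨σ, hσ, rfl⟩
      refine mem_iUnion.2 ⟨σ k, σ, fun i hi => ?_, rfl⟩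
      by_cases hik : i = k
      · subst hik; simp
      · simpa [hik] using hσ i (by omega)
    linarith [KCap_le P p _ (hf.mono hsub)]
  have h0 : t < KCap P p (g '' {σ | ∀ i < 0, σ i ≤ (fun _ => 0 : ℕ → ℕ) i}) := by
    simpa using ht
  let u : (k : ℕ) → {n : ℕ → ℕ // t < KCap P p (g '' {σ | ∀ i < k, σ i ≤ n i})} :=
    fun k => Nat.rec ⟨fun _ => 0, h0⟩
      (fun k v => ⟨Function.update v.1 k (step k v.1 v.2).choose, (step k v.1 v.2).choose_spec⟩) k
  have hu : ∀ k i, i ≠ k → (u (k + 1)).1 i = (u k).1 i := by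
    intro k i hi
    change Function.update (u k).1 k _ i = _
    simp [hi]
  have hu2 : ∀ k i, i < k → (u k).1 i = (u (i + 1)).1 i := by
    intro k i hi
    induction k with
    | zero => omega
    | succ k ih =>
      rcases Nat.lt_succ_iff_lt_or_eq.1 hi with h | h
      · rw [hu k i h.ne, ih h]
      · subst h; rfl
  refine ⟨fun k => (u (k + 1)).1 k, fun k => ?_⟩
  have h := (u k).2
  have e : {σ : ℕ → ℕ | ∀ i < k, σ i ≤ (u k).1 i} = {σ | ∀ i < k, σ i ≤ (u (i + 1)).1 i} := by
    ext σ
    simp only [mem_ofPred_eq]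
    refine forall₂_congr fun i hi => ?_
    rw [hu2 k i hi]
  rwa [e] at h

lemma K_compact (n : ℕ → ℕ) : IsCompact {σ : ℕ → ℕ | ∀ i, σ i ≤ n i} := by
  have : {σ : ℕ → ℕ | ∀ i, σ i ≤ n i} = Set.pi univ (fun i => Iic (n i)) := by
    ext σ; simp [Pi.le_def]
  rw [this]
  exact isCompact_univ_pi fun i => (finite_Iic (n i)).isCompact

lemma K_open (n : ℕ → ℕ) (V : Set (ℕ → ℕ)) (hV : IsOpen V)
    (h : {σ : ℕ → ℕ | ∀ i, σ i ≤ n i} ⊆ V) : ∃ k, {σ : ℕ → ℕ | ∀ i < k, σ i ≤ n i} ⊆ V := by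
  let _ : MetricSpace (ℕ → ℕ) := PiNat.metricSpaceNatNat
  obtain ⟨δ, hδ, hsub⟩ := (K_compact n).exists_thickening_subset_open hV h
  obtain ⟨k, hk⟩ := exists_pow_lt_of_lt_one hδ (by norm_num : (1 / 2 : ℝ) < 1)
  refine ⟨k, fun σ hσ => hsub ?_⟩
  rw [Metric.mem_thickening_iff]
  refine ⟨fun i => min (σ i) (n i), fun i => min_le_right _ _, lt_of_le_of_lt ?_ hk⟩
  apply PiNat.mem_cylinder_iff_dist_le.1
  intro i hi
  exact (min_eq_left (hσ i hi)).symm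

lemma K_cont [Nonempty ι] [TopologicalSpace X] [TopologicalSpace E] [BorelSpace E]
    (P : Measure E) [IsFiniteMeasure P] (p : ι → X → E) (hp : ∀ i, Continuous (p i))
    (g : (ℕ → ℕ) → X) (hg : Continuous g) {t : ℝ} (n : ℕ → ℕ)
    (hn : ∀ k, t < KCap P p (g '' {σ | ∀ i < k, σ i ≤ n i}))
    (f : BoundedContinuousFunction E ℝ) (hf : ∀ z, 0 ≤ f z)
    (h1 : ∀ σ : ℕ → ℕ, (∀ i, σ i ≤ n i) → 1 < ∑ i, f (p i (g σ))) : t < ∫ z, f z ∂P := by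
  obtain ⟨k, hk⟩ := K_open n {σ | 1 < ∑ i, f (p i (g σ))}
    (isOpen_lt continuous_const
      (continuous_finsetSum _ fun i _ => f.continuous.comp ((hp i).comp hg))) h1
  have hfe : KFeas p (g '' {σ | ∀ i < k, σ i ≤ n i}) (fun z => min (f z) 1) := by
    refine ⟨f.continuous.measurable.min measurable_const, fun z => le_min (hf z) zero_le_one,
      fun z => min_le_right _ _, ?_⟩
    rintro _ ⟨σ, hσ, rfl⟩
    by_cases hc : ∃ i, 1 ≤ f (p i (g σ))
    · obtain ⟨i, hi⟩ := hc
      calc (1 : ℝ) = min (f (p i (g σ))) 1 := (min_eq_right hi).symm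
        _ ≤ _ := Finset.single_le_sum (f := fun i => min (f (p i (g σ))) 1)
          (fun j _ => le_min (hf _) zero_le_one) (Finset.mem_univ i)
    · push Not at hc
      have := hk hσ
      simp only [mem_ofPred_eq] at this
      rw [Finset.sum_congr rfl fun i _ => min_eq_left (hc i).le]
      exact this.le
  have h2 := KCap_le P p _ hfe
  have h3 : ∫ z, (min (f z) 1) ^ 2 ∂P ≤ ∫ z, f z ∂P := by
    refine integral_mono (hfe.integrable P).integrable_sq (f.integrable P) fun z => ?_
    have a1 : 0 ≤ min (f z) 1 := hfe.2.1 z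
    have a2 : min (f z) 1 ≤ 1 := min_le_right _ _
    have a3 : min (f z) 1 ≤ f z := min_le_left _ _
    simp only
    nlinarith
  linarith [hn k]

end Kellerer2

section Kellerer3

open CompactlySupported

variable {E K ι : Type*} [MeasurableSpace E] [Fintype ι]

lemma K_riesz [Nonempty ι] [TopologicalSpace E] [BorelSpace E]
    (P : Measure E) [IsFiniteMeasure P]
    [TopologicalSpace K] [CompactSpace K] [T2Space K] [MeasurableSpace K] [BorelSpace K]
    (q : ι → K → E) {t : ℝ} (ht : 0 < t)
    (h : ∀ f : BoundedContinuousFunction E ℝ, (∀ z, 0 ≤ f z) → (∀ x, 1 ≤ ∑ i, f (q i x)) →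
      t ≤ ∫ z, f z ∂P) (hq : ∀ i, Continuous (q i)) :
    ∃ γ : Measure K, IsFiniteMeasure γ ∧ γ ≠ 0 ∧ ∀ f : BoundedContinuousFunction E ℝ,
      (∀ z, 0 ≤ f z) → ∫ x, ∑ i, f (q i x) ∂γ ≤ ∫ z, f z ∂P := by
  let Fe : C_c(K, ℝ) → BoundedContinuousFunction E ℝ → Prop := fun g f =>
    (∀ z, 0 ≤ f z) ∧ ∀ x, g x ≤ ∑ i, f (q i x)
  let N : C_c(K, ℝ) → ℝ := fun g => sInf {r | ∃ f, Fe g f ∧ r = ∫ z, f z ∂P}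
  have hne : ∀ g, ∃ f, Fe g f := by
    intro g
    obtain ⟨C, hC⟩ := (isCompact_range g.continuous).bddAbove
    refine ⟨BoundedContinuousFunction.const E (max C 0), fun z => le_max_right _ _, fun x => ?_⟩
    simp only [BoundedContinuousFunction.const_apply, Finset.sum_const, nsmul_eq_mul]
    have h1 : g x ≤ max C 0 := (hC ⟨x, rfl⟩).trans (le_max_left _ _)
    have h2 : (1 : ℝ) ≤ (Finset.univ : Finset ι).card := by
      exact_mod_cast Fintype.card_pos (α := ι)
    nlinarith [le_max_right C 0]
  have N_le : ∀ g f, Fe g f → N g ≤ ∫ z, f z ∂P := by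
    intro g f hf
    refine csInf_le ⟨0, ?_⟩ ⟨f, hf, rfl⟩
    rintro r ⟨f, hf, rfl⟩
    exact integral_nonneg hf.1
  have le_N : ∀ g a, (∀ f, Fe g f → a ≤ ∫ z, f z ∂P) → a ≤ N g := by
    intro g a H
    obtain ⟨f, hf⟩ := hne g
    refine le_csInf ⟨_, f, hf, rfl⟩ ?_
    rintro r ⟨f, hf, rfl⟩
    exact H f hf
  have hscale : ∀ c : ℝ, 0 < c → ∀ g, c * N g ≤ N (c • g) := by
    intro c hc g
    refine le_N _ _ fun f hf => ?_
    have : N g ≤ ∫ z, (c⁻¹ • f) z ∂P := by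
      refine N_le _ _ ⟨fun z => ?_, fun x => ?_⟩
      · simpa using mul_nonneg (inv_nonneg.2 hc.le) (hf.1 z)
      · have := hf.2 x
        simp only [BoundedContinuousFunction.coe_smul, smul_eq_mul, ← Finset.mul_sum,
          CompactlySupportedContinuousMap.coe_smul, Pi.smul_apply] at this ⊢
        rw [inv_mul_eq_div, le_div_iff₀ hc]
        linarith
    simp only [BoundedContinuousFunction.coe_smul, smul_eq_mul, integral_const_mul] at this
    rw [inv_mul_eq_div, le_div_iff₀ hc] at this
    linarith
  have N_hom : ∀ c : ℝ, 0 < c → ∀ g, N (c • g) = c * N g := by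
    intro c hc g
    refine le_antisymm ?_ (hscale c hc g)
    have := hscale c⁻¹ (inv_pos.2 hc) (c • g)
    rw [smul_smul, inv_mul_cancel₀ hc.ne', one_smul, inv_mul_eq_div, div_le_iff₀ hc] at this
    linarith
  have N_add : ∀ g g', N (g + g') ≤ N g + N g' := by
    intro g g'
    rw [← sub_le_iff_le_add]
    refine le_N _ _ fun f hf => ?_
    rw [sub_le_comm]
    refine le_N _ _ fun f' hf' => ?_
    rw [sub_le_iff_le_add, ← integral_add (f'.integrable P) (f.integrable P)]
    refine N_le _ (f' + f) ⟨fun z => add_nonneg (hf'.1 z) (hf.1 z), fun x => ?_⟩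
    simp only [BoundedContinuousFunction.coe_add, Pi.add_apply, Finset.sum_add_distrib,
      CompactlySupportedContinuousMap.coe_add]
    linarith [hf.2 x, hf'.2 x]
  let e : C_c(K, ℝ) := ⟨⟨fun _ => 1, continuous_const⟩, HasCompactSupport.of_compactSpace _⟩
  have hKne : Nonempty K := by
    by_contra hK
    rw [not_nonempty_iff] at hK
    have := h 0 (fun _ => le_rfl) (fun x => (hK.false x).elim)
    simp at this
    linarith
  have he : e ≠ 0 := by
    intro h0
    obtain ⟨x⟩ := hKne
    have : e x = 0 := by rw [h0]; rfl
    exact one_ne_zero this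
  obtain ⟨Λ, hΛe, hΛ⟩ := exists_extension_of_le_sublinear
    (LinearPMap.mkSpanSingleton (σ := RingHom.id ℝ) e t he) N N_hom N_add (by
      rintro ⟨x, hx⟩
      obtain ⟨s, rfl⟩ := Submodule.mem_span_singleton.1 hx
      rw [LinearPMap.mkSpanSingleton'_apply]
      simp only [RingHom.id_apply, smul_eq_mul]
      refine le_N _ _ fun f hf => ?_
      rcases le_or_gt s 0 with hs | hs
      · exact (mul_nonpos_of_nonpos_of_nonneg hs ht.le).trans (integral_nonneg hf.1)
      · have := h (s⁻¹ • f) (fun z => by simpa using mul_nonneg (inv_nonneg.2 hs.le) (hf.1 z))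
          (fun x => by
            have h1 : s * 1 ≤ _ := hf.2 x
            simp only [BoundedContinuousFunction.coe_smul, smul_eq_mul, ← Finset.mul_sum]
            rw [inv_mul_eq_div, le_div_iff₀ hs]
            linarith)
        simp only [BoundedContinuousFunction.coe_smul, smul_eq_mul, integral_const_mul] at this
        rw [inv_mul_eq_div, le_div_iff₀ hs] at this
        linarith)
  have hΛ1 : Λ e = t := by
    have := hΛe ⟨e, Submodule.mem_span_singleton_self e⟩
    rw [LinearPMap.mkSpanSingleton_apply] at this
    exact this
  have hpos : ∀ g : C_c(K, ℝ), 0 ≤ g → 0 ≤ Λ g := by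
    intro g hg
    have h1 := hΛ (-g)
    have h2 : N (-g) ≤ ∫ z, (0 : BoundedContinuousFunction E ℝ) z ∂P :=
      N_le _ _ ⟨fun _ => le_rfl, fun x => by simpa using hg x⟩
    simp at h1 h2
    linarith
  let L : C_c(K, ℝ) →ₚ[ℝ] ℝ := PositiveLinearMap.mk₀ Λ hpos
  refine ⟨RealRMK.rieszMeasure L, inferInstance, ?_, fun f hf => ?_⟩
  · intro h0
    have h1 := RealRMK.integral_rieszMeasure L e
    rw [h0, integral_zero_measure] at h1
    have h2 : L e = Λ e := rfl
    linarith
  · let g : C_c(K, ℝ) := ⟨⟨fun x => ∑ i, f (q i x),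
      continuous_finsetSum _ fun i _ => f.continuous.comp (hq i)⟩,
      HasCompactSupport.of_compactSpace _⟩
    have h1 := RealRMK.integral_rieszMeasure L g
    have h2 : L g = Λ g := rfl
    have h3 : N g ≤ ∫ z, f z ∂P := N_le g f ⟨hf, fun x => le_rfl⟩
    calc ∫ x, ∑ i, f (q i x) ∂(RealRMK.rieszMeasure L) = Λ g := by rw [← h2, ← h1]; rfl
      _ ≤ _ := (hΛ g).trans h3

lemma K_measure_le [TopologicalSpace E] [TopologicalSpace.PseudoMetrizableSpace E] [BorelSpace E]
    (P Q : Measure E) [IsFiniteMeasure P] [IsFiniteMeasure Q]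
    (h : ∀ f : BoundedContinuousFunction E ℝ, (∀ z, 0 ≤ f z) → ∫ z, f z ∂Q ≤ ∫ z, f z ∂P) :
    Q ≤ P := by
  have hcl : ∀ F : Set E, IsClosed F → Q F ≤ P F := by
    intro F hF
    refine le_of_tendsto_of_tendsto' (HasOuterApproxClosed.tendsto_lintegral_apprSeq hF Q)
      (HasOuterApproxClosed.tendsto_lintegral_apprSeq hF P) fun n => ?_
    let f : BoundedContinuousFunction E ℝ :=
      BoundedContinuousFunction.ofNormedAddCommGroup (fun z => (hF.apprSeq n z : ℝ))
        (by fun_prop) 1 (fun z => by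
          have := HasOuterApproxClosed.apprSeq_apply_le_one hF n z
          simpa using this)
    have h1 := h f (fun z => NNReal.coe_nonneg _)
    have key : ∀ T : Measure E, [IsFiniteMeasure T] →
        ∫⁻ z, (hF.apprSeq n z : ENNReal) ∂T = ENNReal.ofReal (∫ z, f z ∂T) := by
      intro T _
      rw [ofReal_integral_eq_lintegral_ofReal (f.integrable T) (ae_of_all _ fun z => NNReal.coe_nonneg _)]
      refine lintegral_congr fun z => ?_
      exact (ENNReal.ofReal_coe_nnreal).symm
    rw [key, key]
    exact ENNReal.ofReal_le_ofReal h1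
  refine Measure.le_iff.2 fun A hA => ?_
  rw [hA.measure_eq_iSup_isClosed_of_ne_top (measure_ne_top Q A)]
  refine iSup_le fun F => iSup_le fun hFA => iSup_le fun hF => ?_
  exact (hcl F hF).trans (measure_mono hFA)

/-- Kellerer's dichotomy. -/
lemma K_main {X : Type*} [Nonempty ι] [TopologicalSpace E]
    [TopologicalSpace.PseudoMetrizableSpace E] [BorelSpace E]
    (P : Measure E) [IsFiniteMeasure P]
    [TopologicalSpace X] [PolishSpace X] [MeasurableSpace X] [BorelSpace X]
    (p : ι → X → E) (hp : ∀ i, Continuous (p i)) (M : Set X) (hM : MeasurableSet M)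
    (hno : ∀ γ : Measure X, IsFiniteMeasure γ → γ Mᶜ = 0 →
      Measure.sum (fun i => γ.map (p i)) ≤ P → γ = 0) :
    ∃ N : Set E, MeasurableSet N ∧ P N = 0 ∧ ∀ x ∈ M, ∃ i, p i x ∈ N := by
  have hana := hM.analyticSet
  rw [AnalyticSet] at hana
  rcases hana with hana | ⟨g, hg, hgM⟩
  · exact ⟨∅, MeasurableSet.empty, by simp, by simp [hana]⟩
  apply KCap_zero
  by_contra! hcon
  obtain ⟨t, ht0, ht⟩ := exists_between hcon
  rw [← hgM] at ht
  obtain ⟨n, hn⟩ := K_seq P p g ht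
  let S : Set (ℕ → ℕ) := {σ | ∀ i, σ i ≤ n i}
  have : CompactSpace S := isCompact_iff_compactSpace.1 (K_compact n)
  have hq : ∀ i, Continuous (fun x : S => p i (g x)) := fun i =>
    (hp i).comp (hg.comp continuous_subtype_val)
  obtain ⟨γ, hγf, hγ0, hγ⟩ := K_riesz P (fun i (x : S) => p i (g x)) (t := t / 2) (by linarith)
    (by
      intro f hf h1
      have := K_cont P p hp g hg n hn ((2 : ℝ) • f) (fun z => by simpa using hf z) (by
        intro σ hσ
        have := h1 ⟨σ, hσ⟩
        simp only [BoundedContinuousFunction.coe_smul, smul_eq_mul, ← Finset.mul_sum]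
        linarith)
      simp only [BoundedContinuousFunction.coe_smul, smul_eq_mul, integral_const_mul] at this
      linarith) hq
  have hgm : Measurable (fun x : S => g x) := (hg.comp continuous_subtype_val).measurable
  have h0 := hno (γ.map (fun x : S => g x)) inferInstance ?_ ?_
  · rw [Measure.map_eq_zero_iff hgm.aemeasurable] at h0
    exact hγ0 h0
  · rw [Measure.map_apply hgm hM.compl]
    convert measure_empty (μ := γ)
    ext x
    simp [← hgM]
  · rw [Measure.sum_fintype]
    apply K_measure_le
    intro f hf
    refine le_trans (le_of_eq ?_) (hγ f hf)
    rw [integral_finsetSum_measure (fun i _ => f.integrable _), integral_finsetSum]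
    · refine Finset.sum_congr rfl fun i _ => ?_
      rw [Measure.map_map (hp i).measurable hgm, integral_map]
      · rfl
      · exact (hq i).measurable.aemeasurable
      · exact f.continuous.measurable.aestronglyMeasurable
    · intro i _
      refine Integrable.of_bound ((f.continuous.comp (hq i)).measurable.aestronglyMeasurable) ‖f‖
        (ae_of_all _ fun x => f.norm_coe_le_norm _)

end Kellerer3

section Variation

set_option linter.unusedSectionVars false

variable {ι κ : Type*} [Fintype ι] [Fintype κ]

/-- Signed weights. -/
def vsW (a : ι ⊕ κ → ℝ) : ι ⊕ κ → ℝ :=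
  Sum.elim (fun i => ((a (Sum.inl i)).toNNReal : ℝ)) (fun k => -((a (Sum.inr k)).toNNReal : ℝ))

/-- Signed sum of a test function over a configuration. -/
def vsD (ω : (ι ⊕ κ → ℝ × ℝ) × (ι ⊕ κ → ℝ)) (φ : ℝ × ℝ → ℝ) : ℝ :=
  ∑ j, vsW ω.2 j * φ (ω.1 j)

/-- Bad configurations. -/
def vsM (ι κ : Type*) [Fintype ι] [Fintype κ] (c : ℝ → ℝ → ℝ) (R : ℝ) :
    Set ((ι ⊕ κ → ℝ × ℝ) × (ι ⊕ κ → ℝ)) :=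
  {ω | (∀ j, ω.2 j ≤ 1) ∧
    (∀ j, |(ω.1 j).1| ≤ R ∧ |(ω.1 j).2| ≤ R ∧ |c (ω.1 j).1 (ω.1 j).2| ≤ R) ∧
    (∀ j, vsD ω (fun e => if e.1 = (ω.1 j).1 then 1 else 0) = 0) ∧
    (∀ j, vsD ω (fun e => if e.2 = (ω.1 j).2 then 1 else 0) = 0) ∧
    (∀ j, vsD ω (fun e => if e.1 = (ω.1 j).1 then e.2 else 0) = 0) ∧
    0 < vsD ω (fun e => c e.1 e.2)}

lemma vsW_meas (j : ι ⊕ κ) :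
    Measurable (fun ω : (ι ⊕ κ → ℝ × ℝ) × (ι ⊕ κ → ℝ) => vsW ω.2 j) := by
  rcases j with i | k
  · simp only [vsW, Sum.elim_inl]; fun_prop
  · simp only [vsW, Sum.elim_inr]; fun_prop

lemma vsM_meas (c : ℝ → ℝ → ℝ) (hc : Measurable fun p : ℝ × ℝ => c p.1 p.2) (R : ℝ) :
    MeasurableSet (vsM ι κ c R) := by
  have hcj : ∀ j : ι ⊕ κ, Measurable
      (fun ω : (ι ⊕ κ → ℝ × ℝ) × (ι ⊕ κ → ℝ) => c (ω.1 j).1 (ω.1 j).2) := fun j =>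
    hc.comp (by fun_prop : Measurable
      (fun ω : (ι ⊕ κ → ℝ × ℝ) × (ι ⊕ κ → ℝ) => ω.1 j))
  have hW := vsW_meas (ι := ι) (κ := κ)
  have hD : ∀ F : ι ⊕ κ → (ι ⊕ κ → ℝ × ℝ) × (ι ⊕ κ → ℝ) → ℝ, (∀ j, Measurable (F j)) →
      Measurable (fun ω => ∑ j, vsW ω.2 j * F j ω) := fun F hF =>
    Finset.measurable_fun_sum _ fun j _ => (hW j).mul (hF j)
  have habs : ∀ f : (ι ⊕ κ → ℝ × ℝ) × (ι ⊕ κ → ℝ) → ℝ, Measurable f →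
      MeasurableSet {ω | |f ω| ≤ R} := fun f hf =>
    measurableSet_le (continuous_abs.measurable.comp hf) measurable_const
  have e : vsM ι κ c R = (⋂ j, {ω | ω.2 j ≤ 1}) ∩
      ((⋂ j, ({ω | |(ω.1 j).1| ≤ R} ∩ ({ω | |(ω.1 j).2| ≤ R} ∩
        {ω | |c (ω.1 j).1 (ω.1 j).2| ≤ R}))) ∩
      ((⋂ j, {ω | vsD ω (fun e => if e.1 = (ω.1 j).1 then 1 else 0) = 0}) ∩
      ((⋂ j, {ω | vsD ω (fun e => if e.2 = (ω.1 j).2 then 1 else 0) = 0}) ∩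
      ((⋂ j, {ω | vsD ω (fun e => if e.1 = (ω.1 j).1 then e.2 else 0) = 0}) ∩
      {ω | 0 < vsD ω (fun e => c e.1 e.2)})))) := by
    ext ω
    simp only [vsM, mem_inter_iff, mem_iInter, mem_ofPred_eq]
  rw [e]
  refine (MeasurableSet.iInter fun j => ?_).inter ((MeasurableSet.iInter fun j => ?_).inter
    ((MeasurableSet.iInter fun j => ?_).inter ((MeasurableSet.iInter fun j => ?_).inter
    ((MeasurableSet.iInter fun j => ?_).inter ?_))))
  · exact measurableSet_le (by fun_prop) measurable_const
  · exact (habs _ (by fun_prop)).inter ((habs _ (by fun_prop)).inter (habs _ (hcj j)))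
  · refine measurableSet_eq_fun (hD _ fun i => ?_) measurable_const
    exact Measurable.ite (measurableSet_eq_fun (by fun_prop) (by fun_prop)) measurable_const
      measurable_const
  · refine measurableSet_eq_fun (hD _ fun i => ?_) measurable_const
    exact Measurable.ite (measurableSet_eq_fun (by fun_prop) (by fun_prop)) measurable_const
      measurable_const
  · refine measurableSet_eq_fun (hD _ fun i => ?_) measurable_const
    exact Measurable.ite (measurableSet_eq_fun (by fun_prop) (by fun_prop)) (by fun_prop)
      measurable_const
  · exact measurableSet_lt measurable_const (hD _ fun i => hcj i)

lemma vsD_test (ω : (ι ⊕ κ → ℝ × ℝ) × (ι ⊕ κ → ℝ)) (q : ℝ × ℝ → ℝ) (ψ : ℝ × ℝ → ℝ)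
    (h : ∀ j, vsD ω (fun e => if q e = q (ω.1 j) then ψ e else 0) = 0) (f : ℝ → ℝ) :
    vsD ω (fun e => f (q e) * ψ e) = 0 := by
  classical
  have h1 : ∀ j, f (q (ω.1 j)) * ψ (ω.1 j) =
      ∑ x ∈ Finset.univ.image (fun j => q (ω.1 j)),
        f x * (if q (ω.1 j) = x then ψ (ω.1 j) else 0) := by
    intro j
    simp
  unfold vsD at h ⊢
  simp only [h1, Finset.mul_sum]
  rw [Finset.sum_comm]
  refine Finset.sum_eq_zero fun x hx => ?_
  obtain ⟨j, -, rfl⟩ := Finset.mem_image.1 hx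
  have := h j
  calc _ = f (q (ω.1 j)) * ∑ i, vsW ω.2 i * (if q (ω.1 i) = q (ω.1 j) then ψ (ω.1 i) else 0) := by
        rw [Finset.mul_sum]
        exact Finset.sum_congr rfl fun i _ => by ring
    _ = 0 := by rw [this, mul_zero]

/-- The averaged weighted Dirac mass. -/
def vsB (γ : Measure ((ι ⊕ κ → ℝ × ℝ) × (ι ⊕ κ → ℝ))) (j : ι ⊕ κ) : Measure (ℝ × ℝ) :=
  (γ.withDensity fun ω => ((ω.2 j).toNNReal : ENNReal)).map (fun ω => ω.1 j)

lemma vsB_le (γ : Measure ((ι ⊕ κ → ℝ × ℝ) × (ι ⊕ κ → ℝ))) (j : ι ⊕ κ)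
    (h : ∀ᵐ ω ∂γ, ω.2 j ≤ 1) : vsB γ j ≤ γ.map (fun ω => ω.1 j) := by
  refine Measure.map_mono ?_ (by fun_prop)
  calc _ ≤ γ.withDensity (fun _ => 1) := by
        refine withDensity_mono ?_
        filter_upwards [h] with ω hω
        simpa using hω
    _ = γ := withDensity_one

lemma vsB_int (γ : Measure ((ι ⊕ κ → ℝ × ℝ) × (ι ⊕ κ → ℝ))) [IsFiniteMeasure γ] (j : ι ⊕ κ)
    (h : ∀ᵐ ω ∂γ, ω.2 j ≤ 1) (φ : ℝ × ℝ → ℝ) (hφ : Measurable φ) (B : ℝ)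
    (hB : ∀ᵐ ω ∂γ, |φ (ω.1 j)| ≤ B) :
    Integrable φ (vsB γ j) ∧
    Integrable (fun ω => ((ω.2 j).toNNReal : ℝ) * φ (ω.1 j)) γ ∧
    ∫ e, φ e ∂(vsB γ j) = ∫ ω, ((ω.2 j).toNNReal : ℝ) * φ (ω.1 j) ∂γ := by
  have hm : Measurable (fun ω : (ι ⊕ κ → ℝ × ℝ) × (ι ⊕ κ → ℝ) => ω.1 j) := by fun_prop
  have i1 : Integrable φ (γ.map (fun ω => ω.1 j)) := by
    rw [integrable_map_measure hφ.aestronglyMeasurable hm.aemeasurable]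
    exact Integrable.of_bound (hφ.comp hm).aestronglyMeasurable B hB
  refine ⟨i1.mono_measure (vsB_le γ j h), ?_, ?_⟩
  · refine Integrable.of_bound (Measurable.aestronglyMeasurable ?_) B ?_
    · exact (by fun_prop : Measurable (fun ω : (ι ⊕ κ → ℝ × ℝ) × (ι ⊕ κ → ℝ) =>
        ((ω.2 j).toNNReal : ℝ))).mul (hφ.comp hm)
    · filter_upwards [h, hB] with ω h1 h2
      rw [norm_mul]
      have h3 : ‖((ω.2 j).toNNReal : ℝ)‖ ≤ 1 := by
        rw [Real.norm_eq_abs, abs_of_nonneg (NNReal.coe_nonneg _), Real.coe_toNNReal']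
        exact max_le h1 zero_le_one
      calc _ ≤ 1 * |φ (ω.1 j)| := mul_le_mul_of_nonneg_right h3 (abs_nonneg _)
        _ ≤ B := by linarith
  · rw [vsB, integral_map hm.aemeasurable hφ.aestronglyMeasurable,
      integral_withDensity_eq_integral_smul (by fun_prop)]
    rfl

lemma vsB_diff (γ : Measure ((ι ⊕ κ → ℝ × ℝ) × (ι ⊕ κ → ℝ))) [IsFiniteMeasure γ]
    (h : ∀ᵐ ω ∂γ, ∀ j, ω.2 j ≤ 1) (φ : ℝ × ℝ → ℝ) (hφ : Measurable φ) (B : ℝ)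
    (hB : ∀ᵐ ω ∂γ, ∀ j, |φ (ω.1 j)| ≤ B) :
    Integrable φ (∑ i : ι, vsB γ (Sum.inl i)) ∧ Integrable φ (∑ k : κ, vsB γ (Sum.inr k)) ∧
    Integrable (fun ω => vsD ω φ) γ ∧
    ∫ e, φ e ∂(∑ i : ι, vsB γ (Sum.inl i)) - ∫ e, φ e ∂(∑ k : κ, vsB γ (Sum.inr k)) =
      ∫ ω, vsD ω φ ∂γ := by
  have hj := fun j => vsB_int γ j (h.mono fun ω hω => hω j) φ hφ B (hB.mono fun ω hω => hω j)
  have e1 : ∀ ω : (ι ⊕ κ → ℝ × ℝ) × (ι ⊕ κ → ℝ), vsD ω φ =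
      (∑ i, ((ω.2 (Sum.inl i)).toNNReal : ℝ) * φ (ω.1 (Sum.inl i))) -
      ∑ k, ((ω.2 (Sum.inr k)).toNNReal : ℝ) * φ (ω.1 (Sum.inr k)) := by
    intro ω
    simp only [vsD, vsW, Fintype.sum_sum_type, Sum.elim_inl, Sum.elim_inr, neg_mul,
      Finset.sum_neg_distrib]
    ring
  have I1 : Integrable (fun ω : (ι ⊕ κ → ℝ × ℝ) × (ι ⊕ κ → ℝ) =>
      (∑ i, ((ω.2 (Sum.inl i)).toNNReal : ℝ) * φ (ω.1 (Sum.inl i)))) γ :=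
    integrable_finsetSum _ fun i _ => (hj (Sum.inl i)).2.1
  have I2 : Integrable (fun ω : (ι ⊕ κ → ℝ × ℝ) × (ι ⊕ κ → ℝ) =>
      (∑ k, ((ω.2 (Sum.inr k)).toNNReal : ℝ) * φ (ω.1 (Sum.inr k)))) γ :=
    integrable_finsetSum _ fun i _ => (hj (Sum.inr i)).2.1
  simp only [e1]
  refine ⟨integrable_finsetSum_measure.2 fun i _ => (hj _).1,
    integrable_finsetSum_measure.2 fun i _ => (hj _).1, I1.sub I2, ?_⟩
  rw [integral_sub I1 I2, integral_finsetSum_measure (fun i _ => (hj _).1),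
    integral_finsetSum_measure (fun i _ => (hj _).1),
    integral_finsetSum _ fun i _ => (hj (Sum.inl i)).2.1,
    integral_finsetSum _ fun i _ => (hj (Sum.inr i)).2.1]
  simp only [(hj _).2.2]

lemma vs_zero (μ ν : Measure ℝ) [IsProbabilityMeasure μ] [IsProbabilityMeasure ν]
    (hμ : Integrable (fun x : ℝ => x) μ) (hν : Integrable (fun x : ℝ => x) ν)
    (c : ℝ → ℝ → ℝ) (hc : Measurable fun p : ℝ × ℝ => c p.1 p.2)
    (π : Measure (ℝ × ℝ)) (hopt : IsOptimalMart c μ ν π) (R : ℝ)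
    (γ : Measure ((ι ⊕ κ → ℝ × ℝ) × (ι ⊕ κ → ℝ))) [IsFiniteMeasure γ]
    (hγ : γ (vsM ι κ c R)ᶜ = 0)
    (hle : Measure.sum (fun i => γ.map (fun ω => ω.1 (Sum.inl i))) ≤ π) : γ = 0 := by
  obtain ⟨⟨⟨hπ1, hπ2⟩, hmart⟩, hint, hmin⟩ := hopt
  have hae : ∀ᵐ ω ∂γ, ω ∈ vsM ι κ c R := hγ
  have hw : ∀ᵐ ω ∂γ, ∀ j, ω.2 j ≤ 1 := hae.mono fun ω h => h.1
  set β := ∑ i : ι, vsB γ (Sum.inl i) with hβ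
  set β' := ∑ k : κ, vsB γ (Sum.inr k) with hβ'
  have hfin : ∀ j, IsFiniteMeasure (vsB γ j) := fun j =>
    isFiniteMeasure_of_le _ (vsB_le γ j (hw.mono fun ω h => h j))
  have : IsFiniteMeasure β := by rw [hβ]; infer_instance
  have : IsFiniteMeasure β' := by rw [hβ']; infer_instance
  have hβπ : β ≤ π := by
    refine le_trans ?_ hle
    rw [Measure.sum_fintype]
    exact Finset.sum_le_sum fun i _ => vsB_le γ _ (hw.mono fun ω h => h _)
  have hdiff := vsB_diff γ hw
  -- integrals of functions killed by all configurations
  have hkill : ∀ φ : ℝ × ℝ → ℝ, Measurable φ → ∀ B, (∀ᵐ ω ∂γ, ∀ j, |φ (ω.1 j)| ≤ B) →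
      (∀ᵐ ω ∂γ, vsD ω φ = 0) → ∫ e, φ e ∂β = ∫ e, φ e ∂β' := by
    intro φ hφ B hB h0
    have := (hdiff φ hφ B hB).2.2.2
    rw [integral_congr_ae h0, integral_zero] at this
    linarith
  have hmarg : ∀ q : ℝ × ℝ → ℝ, Measurable q → (∀ᵐ ω ∂γ, ∀ j,
      vsD ω (fun e => if q e = q (ω.1 j) then 1 else 0) = 0) → β.map q = β'.map q := by
    intro q hq h
    ext A hA
    rw [Measure.map_apply hq hA, Measure.map_apply hq hA,
      ← measureReal_eq_measureReal_iff, ← integral_indicator_one (hq hA),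
      ← integral_indicator_one (hq hA)]
    refine hkill _ (measurable_one.indicator (hq hA)) 1 (ae_of_all _ fun ω j => ?_) ?_
    · by_cases hx : ω.1 j ∈ q ⁻¹' A <;> simp [hx]
    · filter_upwards [h] with ω hω
      have := vsD_test ω q (fun _ => 1) hω (A.indicator 1)
      simp only [mul_one] at this
      exact this
  have hm1 : β.map Prod.fst = β'.map Prod.fst :=
    hmarg _ measurable_fst (hae.mono fun ω h => h.2.2.1)
  have hm2 : β.map Prod.snd = β'.map Prod.snd :=
    hmarg _ measurable_snd (hae.mono fun ω h => h.2.2.2.1)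
  have hπ0 : π - β + β = π := Measure.sub_add_cancel_of_le hβπ
  set π0 := π - β with hπ0def
  have hπ0le : π0 ≤ π := Measure.sub_le
  have hcoup : IsCoupling μ ν (π0 + β') := by
    constructor
    · rw [Measure.map_add _ _ measurable_fst, ← hm1, ← Measure.map_add _ _ measurable_fst, hπ0, hπ1]
    · rw [Measure.map_add _ _ measurable_snd, ← hm2, ← Measure.map_add _ _ measurable_snd, hπ0, hπ2]
  have ifst : Integrable (fun p : ℝ × ℝ => p.1) π := by
    rw [← hπ1] at hμ
    exact hμ.comp_measurable measurable_fst
  have isnd : Integrable (fun p : ℝ × ℝ => p.2) π := by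
    rw [← hπ2] at hν
    exact hν.comp_measurable measurable_snd
  have hmartc : IsMartingaleCoupling μ ν (π0 + β') := by
    refine ⟨hcoup, fun ρ hρ ⟨B, hB⟩ => ?_⟩
    have hφm : Measurable (fun p : ℝ × ℝ => ρ p.1 * (p.2 - p.1)) := by
      have := hρ.measurable
      fun_prop
    have iπ : Integrable (fun p : ℝ × ℝ => ρ p.1 * (p.2 - p.1)) π :=
      (isnd.sub ifst).bdd_mul (c := B) (hρ.measurable.comp measurable_fst).aestronglyMeasurable
        (ae_of_all _ fun p => hB p.1)
    have hbd : ∀ᵐ ω ∂γ, ∀ j, |ρ (ω.1 j).1 * ((ω.1 j).2 - (ω.1 j).1)| ≤ B * (R + R) := by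
      filter_upwards [hae] with ω h j
      obtain ⟨h1, h2, -⟩ := h.2.1 j
      rw [abs_mul]
      refine mul_le_mul (hB _) ?_ (abs_nonneg _) ((abs_nonneg _).trans (hB 0))
      exact (abs_sub _ _).trans (by linarith)
    have hd := hdiff _ hφm _ hbd
    have hz := hkill _ hφm _ hbd (by
      filter_upwards [hae] with ω h
      have a1 := vsD_test ω Prod.fst Prod.snd h.2.2.2.2.1 ρ
      have a2 := vsD_test ω Prod.fst (fun _ => 1) h.2.2.1 (fun x => ρ x * x)
      unfold vsD at a1 a2 ⊢
      have : ∀ j, vsW ω.2 j * (ρ (ω.1 j).1 * ((ω.1 j).2 - (ω.1 j).1)) =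
          vsW ω.2 j * (ρ (ω.1 j).1 * (ω.1 j).2) - vsW ω.2 j * (ρ (ω.1 j).1 * (ω.1 j).1 * 1) :=
        fun j => by ring
      simp only [this, Finset.sum_sub_distrib, a1, a2, sub_zero])
    have hz2 := hmart ρ hρ ⟨B, hB⟩
    rw [← hπ0, integral_add_measure (iπ.mono_measure hπ0le) hd.1] at hz2
    rw [integral_add_measure (iπ.mono_measure hπ0le) hd.2.1, ← hz, hz2]
  have hbc : ∀ᵐ ω ∂γ, ∀ j, |c (ω.1 j).1 (ω.1 j).2| ≤ R :=
    hae.mono fun ω h j => (h.2.1 j).2.2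
  have hd := hdiff _ hc R hbc
  have i0 := hint.mono_measure hπ0le
  have hopt2 := hmin _ hmartc (i0.add_measure hd.2.1)
  rw [← hπ0, integral_add_measure i0 hd.1, integral_add_measure i0 hd.2.1] at hopt2
  have hpos : ∀ᵐ ω ∂γ, 0 < vsD ω (fun e => c e.1 e.2) := hae.mono fun ω h => h.2.2.2.2.2
  have h0 : ∫ ω, vsD ω (fun e => c e.1 e.2) ∂γ = 0 := by
    refine le_antisymm ?_ (integral_nonneg_of_ae (hpos.mono fun ω h => h.le))
    linarith [hd.2.2.2]
  rw [integral_eq_zero_iff_of_nonneg_ae (hpos.mono fun ω h => h.le) hd.2.2.1] at h0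
  have hF : ∀ᵐ ω ∂γ, False := by
    filter_upwards [hpos, h0] with ω h1 h2
    simp only [Pi.zero_apply] at h2
    linarith
  simpa using hF

lemma vs_discrete (α : Measure (ℝ × ℝ)) [IsFiniteMeasure α] (s : Finset (ℝ × ℝ))
    (hs : α ((↑s : Set (ℝ × ℝ))ᶜ) = 0) (φ : ℝ × ℝ → ℝ) :
    ∫ e, φ e ∂α = ∑ z ∈ s, α.real {z} * φ z := by
  have h1 : α.restrict (↑s : Set (ℝ × ℝ)) = α := Measure.restrict_eq_self_of_ae_mem hs
  calc ∫ e, φ e ∂α = ∫ e in (↑s : Set (ℝ × ℝ)), φ e ∂α := by rw [h1]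
    _ = ∑ z ∈ s, α.real {z} • φ z := setIntegral_finset s (IntegrableOn.finset)
    _ = ∑ z ∈ s, α.real {z} * φ z := rfl

lemma vs_pt (α α' : Measure (ℝ × ℝ)) [IsFiniteMeasure α] [IsFiniteMeasure α']
    (s t : Finset (ℝ × ℝ)) (hs : α ((↑s : Set (ℝ × ℝ))ᶜ) = 0)
    (ht : α' ((↑t : Set (ℝ × ℝ))ᶜ) = 0) {l m : ℕ} (es : Fin l ≃ s) (et : Fin m ≃ t)
    (r : ℝ) (hr : 0 ≤ r) (φ : ℝ × ℝ → ℝ) :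
    vsD (Sum.elim (fun i => (es i : ℝ × ℝ)) (fun k => (et k : ℝ × ℝ)),
      Sum.elim (fun i => r * α.real {(es i : ℝ × ℝ)}) (fun k => r * α'.real {(et k : ℝ × ℝ)})) φ
      = r * (∫ e, φ e ∂α - ∫ e, φ e ∂α') := by
  rw [vs_discrete α s hs, vs_discrete α' t ht, ← Finset.sum_coe_sort s, ← Finset.sum_coe_sort t,
    ← Equiv.sum_comp es, ← Equiv.sum_comp et]
  simp only [vsD, vsW, Fintype.sum_sum_type, Sum.elim_inl, Sum.elim_inr]
  rw [mul_sub, Finset.mul_sum, Finset.mul_sum, sub_eq_add_neg, ← Finset.sum_neg_distrib]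
  congr 1
  · refine Finset.sum_congr rfl fun i _ => ?_
    rw [Real.coe_toNNReal _ (mul_nonneg hr measureReal_nonneg)]
    ring
  · refine Finset.sum_congr rfl fun i _ => ?_
    rw [Real.coe_toNNReal _ (mul_nonneg hr measureReal_nonneg)]
    ring

end Variation

/-- the variational lemma. -/
theorem variational_lemma
    (μ ν : MeasureTheory.Measure ℝ)
    [MeasureTheory.IsProbabilityMeasure μ] [MeasureTheory.IsProbabilityMeasure ν]
    (hμ : MeasureTheory.Integrable (fun x : ℝ => x) μ)
    (hν : MeasureTheory.Integrable (fun x : ℝ => x) ν)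
    (hord : ConvexOrder μ ν)
    (c : ℝ → ℝ → ℝ) (hc : Measurable fun p : ℝ × ℝ => c p.1 p.2)
    (hsi : SuffInt c μ ν)
    (π : MeasureTheory.Measure (ℝ × ℝ))
    (hopt : IsOptimalMart c μ ν π) :
    ∃ Γ : Set (ℝ × ℝ), MeasurableSet Γ ∧ π Γ = 1 ∧
      ∀ α : MeasureTheory.Measure (ℝ × ℝ), MeasureTheory.IsFiniteMeasure α →
        (∃ s : Finset (ℝ × ℝ), (↑s : Set (ℝ × ℝ)) ⊆ Γ ∧ α ((↑s : Set (ℝ × ℝ))ᶜ) = 0) →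
        ∀ α' : MeasureTheory.Measure (ℝ × ℝ), IsCompetitor α α' →
          (∫ p : ℝ × ℝ, c p.1 p.2 ∂α) ≤ ∫ p : ℝ × ℝ, c p.1 p.2 ∂α' := by
  classical
  have hπ1 : π.map Prod.fst = μ := hopt.1.1.1
  have hprob : IsProbabilityMeasure π := by
    constructor
    have h1 : (π.map Prod.fst) univ = 1 := by rw [hπ1]; exact measure_univ
    rwa [Measure.map_apply measurable_fst MeasurableSet.univ, preimage_univ] at h1
  have hN : ∀ a : ℕ × ℕ × ℕ, ∃ N : Set (ℝ × ℝ), MeasurableSet N ∧ π N = 0 ∧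
      ∀ ω ∈ vsM (Fin (a.1 + 1)) (Fin a.2.1) c (a.2.2 : ℝ), ∃ i, ω.1 (Sum.inl i) ∈ N := by
    intro a
    have hpr : ∀ i : Fin (a.1 + 1), Continuous
        (fun ω : (Fin (a.1 + 1) ⊕ Fin a.2.1 → ℝ × ℝ) × (Fin (a.1 + 1) ⊕ Fin a.2.1 → ℝ) =>
          ω.1 (Sum.inl i)) := fun i => by fun_prop
    refine K_main π
      (fun (i : Fin (a.1 + 1))
        (ω : (Fin (a.1 + 1) ⊕ Fin a.2.1 → ℝ × ℝ) × (Fin (a.1 + 1) ⊕ Fin a.2.1 → ℝ)) =>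
          ω.1 (Sum.inl i)) hpr
      (vsM (Fin (a.1 + 1)) (Fin a.2.1) c (a.2.2 : ℝ)) (vsM_meas c hc _) ?_
    intro γ hγf hγ hle
    exact vs_zero μ ν hμ hν c hc π hopt _ γ hγ hle
  choose N hNm hN0 hNM using hN
  refine ⟨(⋃ a, N a)ᶜ, (MeasurableSet.iUnion hNm).compl, ?_, ?_⟩
  · rw [prob_compl_eq_one_iff (MeasurableSet.iUnion hNm)]
    exact measure_iUnion_null hN0
  rintro α hα ⟨s, hsΓ, hs⟩ α' ⟨hf, hg, hbar⟩
  have huniv : α' univ = α univ := by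
    have h1 : (α'.map Prod.fst) univ = (α.map Prod.fst) univ := by rw [hf]
    rwa [Measure.map_apply measurable_fst MeasurableSet.univ,
      Measure.map_apply measurable_fst MeasurableSet.univ, preimage_univ] at h1
  have hα' : IsFiniteMeasure α' := ⟨by rw [huniv]; exact measure_lt_top α univ⟩
  let t : Finset (ℝ × ℝ) := s.image Prod.fst ×ˢ s.image Prod.snd
  have hproj : ∀ q : ℝ × ℝ → ℝ, Measurable q → α'.map q = α.map q →
      α' (q ⁻¹' (↑(s.image q) : Set ℝ)ᶜ) = 0 := by
    intro q hq he
    have hm : MeasurableSet (↑(s.image q) : Set ℝ)ᶜ := (Finset.measurableSet _).compl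
    rw [← Measure.map_apply hq hm, he, Measure.map_apply hq hm]
    refine measure_mono_null ?_ hs
    intro z hz hzs
    exact hz (Finset.mem_coe.2 (Finset.mem_image_of_mem q hzs))
  have ht : α' ((↑t : Set (ℝ × ℝ))ᶜ) = 0 := by
    refine measure_mono_null ?_ (measure_union_null (hproj _ measurable_fst hf)
      (hproj _ measurable_snd hg))
    intro z hz
    by_contra hcon
    simp only [mem_union, mem_preimage, mem_compl_iff, not_or, not_not, Finset.mem_coe] at hcon
    exact hz (Finset.mem_coe.2 (Finset.mem_product.2 hcon))
  by_contra! hlt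
  rcases s.eq_empty_or_nonempty with hse | hsne
  · rw [vs_discrete α s hs, vs_discrete α' t ht] at hlt
    simp [t, hse] at hlt
  obtain ⟨l, hl⟩ : ∃ l, s.card = l + 1 := ⟨s.card - 1, by have := hsne.card_pos; omega⟩
  let es : Fin (l + 1) ≃ s := (finCongr hl.symm).trans s.equivFin.symm
  let et : Fin t.card ≃ t := t.equivFin.symm
  let r : ℝ := 1 / (1 + α.real univ)
  have hα0 : 0 ≤ α.real univ := measureReal_nonneg
  have hr : 0 < r := by positivity
  have hreq : α'.real univ = α.real univ := by simp only [measureReal_def, huniv]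
  have hr1 : ∀ x, x ≤ α.real univ → r * x ≤ 1 := by
    intro x hx
    have : r * x = x / (1 + α.real univ) := by simp only [r]; ring
    rw [this, div_le_one (by positivity)]
    linarith
  let e : Fin (l + 1) ⊕ Fin t.card → ℝ × ℝ :=
    Sum.elim (fun i => (es i : ℝ × ℝ)) (fun k => (et k : ℝ × ℝ))
  let w : Fin (l + 1) ⊕ Fin t.card → ℝ :=
    Sum.elim (fun i => r * α.real {(es i : ℝ × ℝ)}) (fun k => r * α'.real {(et k : ℝ × ℝ)})
  have hD : ∀ φ, vsD (e, w) φ = r * (∫ e, φ e ∂α - ∫ e, φ e ∂α') :=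
    vs_pt α α' s t hs ht es et r hr.le
  obtain ⟨R, hR⟩ := exists_nat_ge (∑ j, (|(e j).1| + |(e j).2| + |c (e j).1 (e j).2|))
  have hRj : ∀ j, |(e j).1| + |(e j).2| + |c (e j).1 (e j).2| ≤ R := fun j =>
    (Finset.single_le_sum (f := fun j => |(e j).1| + |(e j).2| + |c (e j).1 (e j).2|)
      (fun j _ => by positivity) (Finset.mem_univ j)).trans hR
  have hmarg : ∀ q : ℝ × ℝ → ℝ, Measurable q → α'.map q = α.map q → ∀ x,
      vsD (e, w) (fun z => if q z = x then 1 else 0) = 0 := by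
    intro q hq he x
    have hm : Measurable (fun u : ℝ => if u = x then (1 : ℝ) else 0) :=
      Measurable.ite (measurableSet_singleton x) measurable_const measurable_const
    have key : ∀ β : Measure (ℝ × ℝ), ∫ z, (if q z = x then (1 : ℝ) else 0) ∂β =
        ∫ u, (if u = x then (1 : ℝ) else 0) ∂(β.map q) := fun β =>
      (integral_map hq.aemeasurable hm.aestronglyMeasurable).symm
    rw [hD, key, key, he, sub_self, mul_zero]
  have hmem : (e, w) ∈ vsM (Fin (l + 1)) (Fin t.card) c (R : ℝ) := by
    refine ⟨?_, fun j => ?_, fun j => hmarg _ measurable_fst hf _,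
      fun j => hmarg _ measurable_snd hg _, fun j => ?_, ?_⟩
    · rintro (i | k)
      · exact hr1 _ (measureReal_mono (subset_univ _))
      · exact hr1 _ (hreq ▸ measureReal_mono (subset_univ _))
    · have h1 := abs_nonneg (e j).1
      have h2 := abs_nonneg (e j).2
      have h3 := abs_nonneg (c (e j).1 (e j).2)
      have h4 := hRj j
      exact ⟨by simp only; linarith, by simp only; linarith, by simp only; linarith⟩
    · have key : ∀ β : Measure (ℝ × ℝ),
          ∫ z, (if z.1 = (e j).1 then z.2 else 0) ∂β =
          ∫ z in Prod.fst ⁻¹' ({(e j).1} : Set ℝ), z.2 ∂β := by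
        intro β
        rw [← integral_indicator (measurable_fst (measurableSet_singleton _))]
        rfl
      rw [hD, key, key, hbar, sub_self, mul_zero]
    · rw [hD]
      exact mul_pos hr (sub_pos.2 hlt)
  obtain ⟨i, hi⟩ := hNM (l, t.card, R) (e, w) hmem
  exact hsΓ (es i).2 (mem_iUnion.2 ⟨_, hi⟩)
end
end

section
/- Let μ, ν ∈ 𝓜 with μ ≤E ν. Then there exists a unique measure S ∈ 𝓜 (the shadow S^ν(μ) of μ in ν) such that: (i) S ≤ ν setwise; (ii) μ ≤C S; and (iii) for every measure η with η ≤ ν and μ ≤C η one has S ≤C η. -/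
open MeasureTheory Set Filter Topology

noncomputable section

lemma three_pt {p : ℝ → ℝ} (hp : ConvexOn ℝ univ p) {x y z : ℝ} (hxy : x < y) (hyz : y < z) :
    (z - x) * p y ≤ (z - y) * p x + (y - x) * p z := by
  have h := hp.slope_mono_adjacent (mem_univ x) (mem_univ z) hxy hyz
  rw [div_le_div_iff₀ (by linarith) (by linarith)] at h
  nlinarith

lemma convex_cont {p : ℝ → ℝ} (hp : ConvexOn ℝ univ p) : Continuous p := by
  have := hp.continuousOn isOpen_univ
  exact continuousOn_univ.mp this

lemma hull_exists (g h : ℝ → ℝ) (hg : ConvexOn ℝ univ g) (hh : ConvexOn ℝ univ h)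
    (hgh : ∀ x, h x ≤ g x) :
    ∃ c : ℝ → ℝ, ConvexOn ℝ univ c ∧ (∀ x, c x ≤ g x - h x) ∧
      (∀ φ : ℝ → ℝ, ConvexOn ℝ univ φ → (∀ x, φ x ≤ g x - h x) → ∀ x, φ x ≤ c x) ∧
      ConvexOn ℝ univ (fun x => g x - c x) := by
  let A : Set (ℝ → ℝ) := {φ | ConvexOn ℝ univ φ ∧ ∀ x, φ x ≤ g x - h x}
  let c : ℝ → ℝ := fun x => sSup ((fun φ : ℝ → ℝ => φ x) '' A)
  have hne : ∀ x, ((fun φ : ℝ → ℝ => φ x) '' A).Nonempty := fun x =>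
    ⟨0, fun _ => 0, ⟨convexOn_const 0 convex_univ, fun x => by linarith [hgh x]⟩, rfl⟩
  have hbd : ∀ x, BddAbove ((fun φ : ℝ → ℝ => φ x) '' A) := fun x =>
    ⟨g x - h x, by rintro _ ⟨φ, hφ, rfl⟩; exact hφ.2 x⟩
  have hcf : ∀ x, c x ≤ g x - h x := fun x =>
    csSup_le (hne x) (by rintro _ ⟨φ, hφ, rfl⟩; exact hφ.2 x)
  have hmax : ∀ φ : ℝ → ℝ, ConvexOn ℝ univ φ → (∀ x, φ x ≤ g x - h x) → ∀ x, φ x ≤ c x :=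
    fun φ h1 h2 x => le_csSup (hbd x) ⟨φ, ⟨h1, h2⟩, rfl⟩
  have hc : ConvexOn ℝ univ c := by
    refine ⟨convex_univ, fun x _ y _ a b ha hb hab => ?_⟩
    refine csSup_le (hne _) ?_
    rintro _ ⟨φ, hφ, rfl⟩
    have h1 := hφ.1.2 (mem_univ x) (mem_univ y) ha hb hab
    have h2 := hmax φ hφ.1 hφ.2 x
    have h3 := hmax φ hφ.1 hφ.2 y
    simp only [smul_eq_mul] at *
    nlinarith [mul_le_mul_of_nonneg_left h2 ha, mul_le_mul_of_nonneg_left h3 hb]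
  refine ⟨c, hc, hcf, hmax, ?_⟩
  have cg := convex_cont hg
  have ch := convex_cont hh
  have cc := convex_cont hc
  refine convexOn_of_slope_mono_adjacent convex_univ ?_
  intro x z0 y _ _ hxz hzy
  rw [div_le_div_iff₀ (by linarith) (by linarith)]
  by_contra hcon
  push Not at hcon
  have hyx : 0 < y - x := by linarith
  set u : ℝ → ℝ := fun x => g x - c x with hu
  have cu : Continuous u := cg.sub cc
  set W : ℝ → ℝ := fun z => (y - x) * u z - ((y - z) * u x + (z - x) * u y) with hW
  have cW : Continuous W := by fun_prop
  have hWz : 0 < W z0 := by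
    simp only [hW]
    have : (u y - u z0) * (z0 - x) < (u z0 - u x) * (y - z0) := hcon
    nlinarith
  obtain ⟨m, hm, hmm⟩ := isCompact_Icc.exists_isMaxOn (⟨z0, hxz.le, hzy.le⟩ : (Icc x y).Nonempty)
    cW.continuousOn
  have hTc : IsCompact (Icc x y ∩ W ⁻¹' {W m}) :=
    isCompact_Icc.inter_right (isClosed_singleton.preimage cW)
  obtain ⟨t, ⟨htI, htM⟩, htl⟩ := hTc.exists_isLeast ⟨m, hm, rfl⟩
  have htM : W t = W m := htM
  have hMpos : 0 < W t := by
    rw [htM]; exact hWz.trans_le (hmm ⟨hxz.le, hzy.le⟩)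
  have hle : ∀ z ∈ Icc x y, W z ≤ W t := fun z hz => by rw [htM]; exact hmm hz
  have hlt : ∀ z ∈ Icc x y, z < t → W z < W t := by
    intro z hz hzt
    refine lt_of_le_of_ne (hle z hz) fun he => ?_
    exact absurd (htl ⟨hz, he.trans htM⟩) (not_le.mpr hzt)
  have hxt : x < t := by
    refine lt_of_le_of_ne htI.1 fun he => ?_
    rw [← he] at hMpos
    simp only [hW] at hMpos
    nlinarith
  have hty : t < y := by
    refine lt_of_le_of_ne htI.2 fun he => ?_
    rw [he] at hMpos
    simp only [hW] at hMpos
    nlinarith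
  have hhu : ∀ z, h z ≤ u z := fun z => by simp only [hu]; linarith [hcf z]
  rcases (hcf t).eq_or_lt with he | hl
  · have h1 := three_pt hh hxt hty
    have h2 : u t = h t := by simp only [hu]; linarith
    have h3 := mul_le_mul_of_nonneg_left (hhu x) (by linarith : 0 ≤ y - t)
    have h4 := mul_le_mul_of_nonneg_left (hhu y) (by linarith : 0 ≤ t - x)
    simp only [hW] at hMpos
    rw [h2] at hMpos
    linarith
  · set ε := g t - h t - c t with hε
    have hεp : 0 < ε := by linarith
    have e1 : ∀ᶠ z in 𝓝 t, g t - h t - ε / 2 < g z - h z :=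
      (cg.sub ch).continuousAt.eventually_const_lt (by simp only [Pi.sub_apply]; linarith)
    have e2 : ∀ᶠ z in 𝓝 t, c z < c t + ε / 2 :=
      cc.continuousAt.eventually_lt_const (by linarith)
    have e3 : ∀ᶠ z in 𝓝 t, z ∈ Icc x y := Icc_mem_nhds hxt hty
    obtain ⟨d, hd, hball⟩ := Metric.eventually_nhds_iff.mp (e1.and (e2.and e3))
    have hb : ∀ z, t - d / 2 ≤ z → z ≤ t + d / 2 →
        (g t - h t - ε / 2 < g z - h z ∧ c z < c t + ε / 2 ∧ z ∈ Icc x y) := by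
      intro z h1 h2
      apply hball
      rw [Real.dist_eq, abs_lt]
      constructor <;> linarith
    set s := t - d / 2 with hs
    set r := t + d / 2 with hr
    have hst : s < t := by linarith
    have htr : t < r := by linarith
    have hsr : s < r := hst.trans htr
    obtain ⟨-, s2, s3⟩ := hb s le_rfl hsr.le
    obtain ⟨-, r2, r3⟩ := hb r hsr.le le_rfl
    have hrs : r - s = d := by simp only [hs, hr]; ring
    let l : ℝ → ℝ := fun z => ((r - z) * c s + (z - s) * c r) / d
    have hlc : ConvexOn ℝ univ l := by
      refine ⟨convex_univ, fun a _ b _ α β _ _ hab => le_of_eq ?_⟩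
      simp only [l, smul_eq_mul]
      have : β = 1 - α := by linarith
      subst this
      field_simp
      ring
    have hlf : ∀ z, l z ≤ max (c z) (g z - h z) := by
      intro z
      rcases lt_or_ge z s with h1 | h1
      · refine le_trans ?_ (le_max_left _ _)
        have := three_pt hc h1 hsr
        simp only [l]
        rw [div_le_iff₀ hd, ← hrs]
        nlinarith
      · rcases lt_or_ge r z with h2 | h2
        · refine le_trans ?_ (le_max_left _ _)
          have := three_pt hc hsr h2
          simp only [l]
          rw [div_le_iff₀ hd, ← hrs]
          nlinarith
        · refine le_trans ?_ (le_max_right _ _)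
          obtain ⟨z1, -, -⟩ := hb z h1 h2
          simp only [l]
          rw [div_le_iff₀ hd, ← hrs]
          nlinarith [mul_le_mul_of_nonneg_left s2.le (by linarith : 0 ≤ r - z),
            mul_le_mul_of_nonneg_left r2.le (by linarith : 0 ≤ z - s)]
    have key := hmax (c ⊔ l) (hc.sup hlc) (fun z => by
      refine sup_le (hcf z) ((hlf z).trans (max_le (hcf z) le_rfl))) t
    have key2 : l t ≤ c t := le_trans le_sup_right key
    simp only [l] at key2
    rw [div_le_iff₀ hd, ← hrs] at key2
    have g1 := three_pt hg hst htr
    have w1 := hlt s s3 hst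
    have w2 := hle r r3
    have e1 : r - t = d / 2 := by simp only [hr]; ring
    have e2 : t - s = d / 2 := by simp only [hs]; ring
    rw [hrs, e1, e2] at g1 key2
    have g2 : g t - c t ≤ ((g s - c s) + (g r - c r)) / 2 := by
      have : d * (g t - c t) ≤ d * (((g s - c s) + (g r - c r)) / 2) := by linarith
      exact le_of_mul_le_mul_left this hd
    have g3 := mul_le_mul_of_nonneg_left g2 hyx.le
    simp only [hW, hu] at w1 w2
    have : s = 2 * t - r := by simp only [hs, hr]; ring
    rw [show y - s = 2 * (y - t) - (y - r) by rw [this]; ring,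
      show s - x = 2 * (t - x) - (r - x) by rw [this]; ring] at w1
    linarith


def Upot (ρ : Measure ℝ) (k : ℝ) : ENNReal := ∫⁻ x, ENNReal.ofReal (k - x) ∂ρ

lemma Upot_eq (ρ : Measure ℝ) [IsFiniteMeasure ρ] (k : ℝ) :
    Upot ρ k = ∫⁻ t in Iio k, ρ (Iic t) := by
  have hm : MeasurableSet {q : ℝ × ℝ | q.1 ≤ q.2} := measurableSet_le measurable_fst measurable_snd
  have h1 : ∀ x, ENNReal.ofReal (k - x) =
      ∫⁻ t in Iio k, ({q : ℝ × ℝ | q.1 ≤ q.2}.indicator (fun _ => (1 : ENNReal)) (x, t)) := by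
    intro x
    have : ∀ t, ({q : ℝ × ℝ | q.1 ≤ q.2}.indicator (fun _ => (1 : ENNReal)) (x, t)) =
      (Ici x).indicator (fun _ => (1 : ENNReal)) t := fun t => by
        simp [indicator]
    simp_rw [this]
    rw [lintegral_indicator measurableSet_Ici, setLIntegral_one, Measure.restrict_apply measurableSet_Ici,
      Ici_inter_Iio, Real.volume_Ico]
  unfold Upot
  simp_rw [h1]
  rw [lintegral_lintegral_swap]
  · refine lintegral_congr fun t => ?_
    have : ∀ x, ({q : ℝ × ℝ | q.1 ≤ q.2}.indicator (fun _ => (1 : ENNReal)) (x, t)) =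
      (Iic t).indicator (fun _ => (1 : ENNReal)) x := fun x => by
        simp [indicator]
    simp_rw [this]
    rw [lintegral_indicator measurableSet_Iic, setLIntegral_one]
  · exact (measurable_const.indicator hm).aemeasurable

lemma Upot_add (ρ σ : Measure ℝ) (k : ℝ) : Upot (ρ + σ) k = Upot ρ k + Upot σ k :=
  lintegral_add_measure _ _ _

lemma Upot_step (ρ : Measure ℝ) [IsFiniteMeasure ρ] {k r : ℝ} (hkr : k < r) :
    Upot ρ k + ENNReal.ofReal (r - k) * ρ (Iic k) ≤ Upot ρ r ∧
    Upot ρ r ≤ Upot ρ k + ENNReal.ofReal (r - k) * ρ (Iic r) := by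
  have hsplit : Upot ρ r = Upot ρ k + ∫⁻ t in Ico k r, ρ (Iic t) := by
    rw [Upot_eq, Upot_eq, ← Iio_union_Ico_eq_Iio hkr.le,
      lintegral_union measurableSet_Ico]
    exact disjoint_left.mpr fun a h1 h2 => absurd h2.1 (not_le.mpr h1)
  have hv : ∀ c : ENNReal, ∫⁻ _ in Ico k r, c = ENNReal.ofReal (r - k) * c := fun c => by
    rw [setLIntegral_const, Real.volume_Ico, mul_comm]
  rw [hsplit, ← hv, ← hv]
  constructor
  · gcongr 1
    exact setLIntegral_mono' measurableSet_Ico fun t ht => measure_mono (Iic_subset_Iic.mpr ht.1)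
  · gcongr 1
    exact setLIntegral_mono' measurableSet_Ico fun t ht => measure_mono (Iic_subset_Iic.mpr ht.2.le)

lemma Upot_le (ρ σ : Measure ℝ) [IsFiniteMeasure ρ] [IsFiniteMeasure σ]
    (hfin : ∀ k, Upot ρ k ≠ ⊤) (h : ∀ k, Upot ρ k = Upot σ k) (k : ℝ) :
    ρ (Iic k) ≤ σ (Iic k) := by
  have h1 : ∀ r, k < r → ρ (Iic k) ≤ σ (Iic r) := by
    intro r hr
    have a := (Upot_step ρ hr).1.trans_eq (h r)
    have b := a.trans (Upot_step σ hr).2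
    rw [← h k] at b
    have c := (ENNReal.add_le_add_iff_left (hfin k)).mp b
    exact (ENNReal.mul_le_mul_iff_right (by simpa using hr) ENNReal.ofReal_ne_top).mp c
  have ht : Tendsto (fun n : ℕ => σ (Iic (k + 1 / ((n : ℝ) + 1)))) atTop (𝓝 (σ (Iic k))) := by
    have he : Iic k = ⋂ n : ℕ, Iic (k + 1 / ((n : ℝ) + 1)) := by
      ext x
      simp only [mem_Iic, mem_iInter]
      constructor
      · intro hx n
        have : (0 : ℝ) < 1 / ((n : ℝ) + 1) := by positivity
        linarith
      · intro hx
        have := tendsto_one_div_add_atTop_nhds_zero_nat (𝕜 := ℝ)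
        have h2 := this.const_add k
        rw [add_zero] at h2
        exact ge_of_tendsto' h2 hx
    rw [he]
    refine tendsto_measure_iInter_atTop (fun n => measurableSet_Iic.nullMeasurableSet) ?_
      ⟨0, measure_ne_top _ _⟩
    intro m n hmn
    refine Iic_subset_Iic.mpr ?_
    have : (m : ℝ) ≤ n := by exact_mod_cast hmn
    have := one_div_le_one_div_of_le (by positivity : (0 : ℝ) < (m : ℝ) + 1) (by linarith : (m : ℝ) + 1 ≤ n + 1)
    linarith
  refine ge_of_tendsto' ht fun n => h1 _ ?_
  have : (0 : ℝ) < 1 / ((n : ℝ) + 1) := by positivity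
  linarith

lemma Upot_ext (ρ σ : Measure ℝ) [IsFiniteMeasure ρ] [IsFiniteMeasure σ]
    (hfin : ∀ k, Upot ρ k ≠ ⊤) (h : ∀ k, Upot ρ k = Upot σ k) : ρ = σ :=
  Measure.ext_of_Iic _ _ fun k => le_antisymm (Upot_le ρ σ hfin h k)
    (Upot_le σ ρ (fun k => h k ▸ hfin k) (fun k => (h k).symm) k)

lemma Upot_exists (p : ℝ → ℝ) (hp : ConvexOn ℝ univ p) (h0 : ∀ x, 0 ≤ p x)
    (hbot : Tendsto p atBot (𝓝 0)) (A B : ℝ) (hB : ∀ x, 0 ≤ x → p x ≤ A + B * x) :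
    ∃ ρ : Measure ℝ, IsFiniteMeasure ρ ∧ ∀ k, Upot ρ k = ENNReal.ofReal (p k) := by
  have cp : Continuous p := continuousOn_univ.mp (hp.continuousOn isOpen_univ)
  set d : ℝ → ℝ := fun x => derivWithin p (Ioi x) x with hd
  have hder : ∀ x, HasDerivWithinAt p (d x) (Ioi x) x := fun x =>
    hp.hasDerivWithinAt_rightDeriv_of_mem_interior (by simp)
  have hmono : Monotone d := by
    have := hp.monotoneOn_rightDeriv
    rw [interior_univ] at this
    exact monotoneOn_univ.mp this
  have hint : ∀ a b, IntervalIntegrable d volume a b := fun a b => hmono.intervalIntegrable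
  have hftc : ∀ a b, a ≤ b → ∫ y in a..b, d y = p b - p a := fun a b hab =>
    intervalIntegral.integral_eq_sub_of_hasDeriv_right_of_le hab cp.continuousOn
      (fun x _ => hder x) (hint a b)
  -- slope bounds
  have hup : ∀ x y, x < y → d x * (y - x) ≤ p y - p x := by
    intro x y hxy
    have := hp.rightDeriv_le_slope_of_mem_interior (by simp : x ∈ interior univ) (mem_univ y) hxy
    rw [slope_def_field, le_div_iff₀ (by linarith)] at this
    exact this
  have hdn : ∀ x y, x < y → p y - p x ≤ d y * (y - x) := by
    intro x y hxy
    rw [← hftc x y hxy.le]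
    have : ∫ t in x..y, d t ≤ ∫ t in x..y, d y :=
      intervalIntegral.integral_mono_on hxy.le (hint x y) (by simp) fun t ht => hmono ht.2
    simpa [mul_comm] using this
  have hd0 : ∀ t, 0 ≤ d t := by
    intro t
    by_contra hneg
    push Not at hneg
    have e : ∀ᶠ s in atBot, p s < p t + 1 := hbot.eventually_lt_const (by linarith [h0 t])
    have e2 : ∀ᶠ s in atBot, s < t + 1 / d t := eventually_lt_atBot _
    obtain ⟨s, hs1, hs2⟩ := (e.and e2).exists
    have hn : 1 / d t < 0 := by simpa using hneg
    have := hdn s t (by linarith)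
    have h3 : d t * (s - t) > 1 := by
      have h4 : d t * (1 / d t) = 1 := mul_one_div_cancel hneg.ne
      have := mul_lt_mul_of_neg_left (by linarith : s - t < 1 / d t) hneg
      linarith
    linarith
  have hdB : ∀ t, d t ≤ B := by
    intro t
    by_contra hneg
    push Not at hneg
    have e := (tendsto_id (α := ℝ) (x := atTop)).const_mul_atTop (by linarith : 0 < d t - B)
    obtain ⟨y, hy1, hy2, hy3⟩ := ((e.eventually_gt_atTop (A + d t * t)).and
      ((eventually_gt_atTop t).and (eventually_ge_atTop 0))).exists
    have h1 := hup t y hy2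
    have h2 := hB y hy3
    have h3 := h0 t
    simp only [id] at hy1
    nlinarith
  have hdbot : Tendsto d atBot (𝓝 0) := by
    refine squeeze_zero hd0 (g := fun t => p (t + 1)) ?_ ?_
    · intro t
      have := hup t (t + 1) (by linarith)
      have := h0 t
      nlinarith
    · exact hbot.comp (tendsto_atBot_add_const_right _ _ tendsto_id)
  set F := hmono.stieltjesFunction with hF
  have hFle : ∀ t, d t ≤ F t := fun t => by
    rw [hF, hmono.stieltjesFunction_eq]; exact hmono.le_rightLim le_rfl
  have hFge : ∀ t, F t ≤ d (t + 1) := fun t => by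
    rw [hF, hmono.stieltjesFunction_eq]; exact hmono.rightLim_le (by linarith)
  have hFbot : Tendsto F atBot (𝓝 0) :=
    tendsto_of_tendsto_of_tendsto_of_le_of_le hdbot
      (hdbot.comp (tendsto_atBot_add_const_right _ 1 tendsto_id)) hFle hFge
  have hFae : ∀ᵐ t, F t = d t := by
    have hc := hmono.countable_not_continuousAt
    refine (hc.ae_notMem volume).mono fun t ht => ?_
    simp only [mem_ofPred_eq, not_not] at ht
    rw [hF, hmono.stieltjesFunction_eq]
    exact ht.continuousWithinAt.rightLim_eq
  have hfin : IsFiniteMeasure F.measure := by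
    refine F.isFiniteMeasure_of_forall_abs_le (C := B) fun x => ?_
    rw [abs_of_nonneg ((hd0 x).trans (hFle x))]
    exact (hFge x).trans (hdB _)
  refine ⟨F.measure, hfin, fun k => ?_⟩
  rw [Upot_eq]
  have hI : ∫⁻ t in Iio k, F.measure (Iic t) = ∫⁻ t in Iic k, ENNReal.ofReal (d t) := by
    rw [restrict_Iio_eq_restrict_Iic]
    refine lintegral_congr_ae (ae_restrict_of_ae (hFae.mono fun t ht => ?_))
    simp only [F.measure_Iic hFbot, sub_zero, ht]
  rw [hI]
  have hcov := aecover_Ioi (μ := volume.restrict (Iic k)) (l := atTop) (a := fun n : ℕ => k - (n : ℝ))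
    (tendsto_atBot_add_const_left _ k (tendsto_neg_atTop_atBot.comp tendsto_natCast_atTop_atTop))
  refine hcov.lintegral_eq_of_tendsto _ (hmono.measurable.ennreal_ofReal.aemeasurable) ?_
  have : ∀ n : ℕ, ∫⁻ t in Ioi (k - (n : ℝ)), ENNReal.ofReal (d t) ∂(volume.restrict (Iic k)) =
      ENNReal.ofReal (p k - p (k - n)) := by
    intro n
    have hn : k - (n : ℝ) ≤ k := by linarith [(Nat.cast_nonneg n : (0 : ℝ) ≤ n)]
    rw [Measure.restrict_restrict measurableSet_Ioi, Ioi_inter_Iic, ← hftc _ _ hn,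
      intervalIntegral.integral_of_le hn,
      ofReal_integral_eq_lintegral_ofReal (hint _ _).1 (Eventually.of_forall hd0)]
  simp_rw [this]
  refine ENNReal.tendsto_ofReal ?_
  have h5 : Tendsto (fun n : ℕ => p (k - n)) atTop (𝓝 0) := hbot.comp
    (tendsto_atBot_add_const_left _ k (tendsto_neg_atTop_atBot.comp tendsto_natCast_atTop_atTop))
  simpa using h5.const_sub (p k)

def Ppot (ρ : Measure ℝ) (k : ℝ) : ℝ := ∫ x, max (k - x) 0 ∂ρ
def Cpot (ρ : Measure ℝ) (k : ℝ) : ℝ := ∫ x, max (x - k) 0 ∂ρ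

lemma int_P (ρ : Measure ℝ) [IsFiniteMeasure ρ] (hρ : Integrable (fun x : ℝ => x) ρ) (k : ℝ) :
    Integrable (fun x : ℝ => max (k - x) 0) ρ :=
  ((integrable_const k).sub hρ).pos_part

lemma int_C (ρ : Measure ℝ) [IsFiniteMeasure ρ] (hρ : Integrable (fun x : ℝ => x) ρ) (k : ℝ) :
    Integrable (fun x : ℝ => max (x - k) 0) ρ :=
  (hρ.sub (integrable_const k)).pos_part

lemma P_nonneg (ρ : Measure ℝ) (k : ℝ) : 0 ≤ Ppot ρ k :=
  integral_nonneg fun _ => le_max_right _ _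

lemma C_nonneg (ρ : Measure ℝ) (k : ℝ) : 0 ≤ Cpot ρ k :=
  integral_nonneg fun _ => le_max_right _ _

lemma Upot_eq_P (ρ : Measure ℝ) [IsFiniteMeasure ρ] (hρ : Integrable (fun x : ℝ => x) ρ) (k : ℝ) :
    Upot ρ k = ENNReal.ofReal (Ppot ρ k) := by
  unfold Upot Ppot
  rw [ofReal_integral_eq_lintegral_ofReal (int_P ρ hρ k)
    (Eventually.of_forall fun _ => le_max_right _ _)]
  simp [ENNReal.ofReal_max]

lemma C_eq (ρ : Measure ℝ) [IsFiniteMeasure ρ] (hρ : Integrable (fun x : ℝ => x) ρ) (k : ℝ) :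
    Cpot ρ k = Ppot ρ k + (∫ x, x ∂ρ) - k * ρ.real univ := by
  have h1 : Cpot ρ k - Ppot ρ k = ∫ x, (x - k) ∂ρ := by
    unfold Cpot Ppot
    rw [← integral_sub (int_C ρ hρ k) (int_P ρ hρ k)]
    refine integral_congr_ae (Eventually.of_forall fun x => ?_)
    simp only
    rcases le_total x k with h | h
    · rw [max_eq_right (by linarith), max_eq_left (by linarith)]; ring
    · rw [max_eq_left (by linarith), max_eq_right (by linarith)]; ring
  rw [integral_sub hρ (integrable_const k), integral_const, smul_eq_mul] at h1
  linarith

lemma P_convex (ρ : Measure ℝ) [IsFiniteMeasure ρ] (hρ : Integrable (fun x : ℝ => x) ρ) :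
    ConvexOn ℝ univ (Ppot ρ) := by
  refine ⟨convex_univ, fun x _ y _ a b ha hb hab => ?_⟩
  simp only [Ppot, smul_eq_mul]
  rw [← integral_const_mul, ← integral_const_mul,
    ← integral_add ((int_P ρ hρ x).const_mul a) ((int_P ρ hρ y).const_mul b)]
  refine integral_mono (int_P ρ hρ _)
    (((int_P ρ hρ x).const_mul a).add ((int_P ρ hρ y).const_mul b)) fun z => ?_
  simp only [Pi.add_apply]
  refine max_le ?_ ?_
  · have h1 := mul_le_mul_of_nonneg_left (le_max_left (x - z) 0) ha
    have h2 := mul_le_mul_of_nonneg_left (le_max_left (y - z) 0) hb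
    have : z = a * z + b * z := by rw [← add_mul, hab, one_mul]
    linarith
  · have h1 := mul_nonneg ha (le_max_right (x - z) 0)
    have h2 := mul_nonneg hb (le_max_right (y - z) 0)
    linarith

lemma P_bot (ρ : Measure ℝ) (hρ : Integrable (fun x : ℝ => x) ρ) :
    Tendsto (Ppot ρ) atBot (𝓝 0) := by
  have : Tendsto (fun k : ℝ => ∫ x, max (k - x) 0 ∂ρ) atBot (𝓝 (∫ x, (0 : ℝ) ∂ρ)) := by
    refine tendsto_integral_filter_of_dominated_convergence (fun x => |x|) ?_ ?_ hρ.abs ?_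
    · exact Eventually.of_forall fun k => by fun_prop
    · filter_upwards [eventually_le_atBot 0] with k hk
      refine Eventually.of_forall fun x => ?_
      rw [Real.norm_eq_abs, abs_of_nonneg (le_max_right _ _)]
      exact max_le (by linarith [neg_abs_le x]) (abs_nonneg x)
    · refine Eventually.of_forall fun x => ?_
      refine tendsto_const_nhds.congr' ?_
      filter_upwards [eventually_le_atBot x] with k hk
      rw [max_eq_right (by linarith)]
  rw [integral_zero] at this
  exact this

lemma C_top (ρ : Measure ℝ) (hρ : Integrable (fun x : ℝ => x) ρ) :
    Tendsto (Cpot ρ) atTop (𝓝 0) := by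
  have : Tendsto (fun k : ℝ => ∫ x, max (x - k) 0 ∂ρ) atTop (𝓝 (∫ x, (0 : ℝ) ∂ρ)) := by
    refine tendsto_integral_filter_of_dominated_convergence (fun x => |x|) ?_ ?_ hρ.abs ?_
    · exact Eventually.of_forall fun k => by fun_prop
    · filter_upwards [eventually_ge_atTop 0] with k hk
      refine Eventually.of_forall fun x => ?_
      rw [Real.norm_eq_abs, abs_of_nonneg (le_max_right _ _)]
      exact max_le (by linarith [le_abs_self x]) (abs_nonneg x)
    · refine Eventually.of_forall fun x => ?_
      refine tendsto_const_nhds.congr' ?_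
      filter_upwards [eventually_ge_atTop x] with k hk
      rw [max_eq_right (by linarith)]
  rw [integral_zero] at this
  exact this

lemma P_lin (ρ : Measure ℝ) [IsFiniteMeasure ρ] (hρ : Integrable (fun x : ℝ => x) ρ) (k : ℝ)
    (hk : 0 ≤ k) : Ppot ρ k ≤ (∫ x, |x| ∂ρ) + ρ.real univ * k := by
  have : (∫ x, |x| ∂ρ) + ρ.real univ * k = ∫ x, (|x| + k) ∂ρ := by
    rw [integral_add hρ.abs (integrable_const k), integral_const, smul_eq_mul]
  rw [this]
  refine integral_mono (int_P ρ hρ k) (hρ.abs.add (integrable_const k)) fun x => ?_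
  exact max_le (by simp only [Pi.add_apply]; linarith [neg_abs_le x])
    (by simp only [Pi.add_apply]; positivity)

lemma affine_zero {a b : ℝ} (h : Tendsto (fun k : ℝ => a - k * b) atTop (𝓝 0)) :
    a = 0 ∧ b = 0 := by
  have h2 := h.comp (tendsto_atTop_add_const_right atTop (1 : ℝ) tendsto_id)
  have h3 := h.sub h2
  have h4 : Tendsto (fun _ : ℝ => b) atTop (𝓝 0) := by
    convert h3 using 2 <;> simp <;> ring
  have hb : b = 0 := tendsto_nhds_unique tendsto_const_nhds h4
  subst hb
  simp only [mul_zero, sub_zero] at h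
  exact ⟨tendsto_nhds_unique tendsto_const_nhds h, rfl⟩

lemma fin_of_le {η ν : Measure ℝ} [IsFiniteMeasure ν] (h : η ≤ ν) : IsFiniteMeasure η :=
  isFiniteMeasure_of_le ν h

/-- Convex order through put potentials. -/
lemma co_of_P (μ ν : Measure ℝ) [IsFiniteMeasure μ] [IsFiniteMeasure ν]
    (hμ : Integrable (fun x : ℝ => x) μ) (hν : Integrable (fun x : ℝ => x) ν)
    (h1 : μ.real univ = ν.real univ) (h2 : (∫ x, x ∂μ) = ∫ x, x ∂ν)
    (h3 : ∀ k, Ppot μ k ≤ Ppot ν k) : ConvexOrder μ ν := by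
  refine ⟨?_, h2, fun k => ?_⟩
  · rwa [Measure.real, Measure.real,
      ENNReal.toReal_eq_toReal_iff' (measure_ne_top _ _) (measure_ne_top _ _)] at h1
  · change Cpot μ k ≤ Cpot ν k
    rw [C_eq μ hμ, C_eq ν hν, h1, h2]
    linarith [h3 k]

lemma P_of_co (μ ν : Measure ℝ) [IsFiniteMeasure μ] [IsFiniteMeasure ν]
    (hμ : Integrable (fun x : ℝ => x) μ) (hν : Integrable (fun x : ℝ => x) ν)
    (h : ConvexOrder μ ν) : μ.real univ = ν.real univ ∧ ∀ k, Ppot μ k ≤ Ppot ν k := by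
  have h1 : μ.real univ = ν.real univ := by rw [Measure.real, Measure.real, h.1]
  refine ⟨h1, fun k => ?_⟩
  have := h.2.2 k
  change Cpot μ k ≤ Cpot ν k at this
  rw [C_eq μ hμ, C_eq ν hν, h1, h.2.1] at this
  linarith

/-- existence and uniqueness of the shadow `S^ν(μ)`. -/
theorem shadow_exists_unique
    (μ ν : MeasureTheory.Measure ℝ)
    [MeasureTheory.IsFiniteMeasure μ] [MeasureTheory.IsFiniteMeasure ν]
    (hμ : MeasureTheory.Integrable (fun x : ℝ => x) μ)
    (hν : MeasureTheory.Integrable (fun x : ℝ => x) ν)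
    (h : ExtConvexOrder μ ν) :
    ∃! S : MeasureTheory.Measure ℝ, IsShadow μ ν S := by
  have hP : ∀ k, Ppot μ k ≤ Ppot ν k := by
    intro k
    have := h (fun x => max (k - x) 0)
      (((convexOn_const k convex_univ).sub (concaveOn_id convex_univ)).sup
        (convexOn_const 0 convex_univ)) (fun x => le_max_right _ _)
    rw [← ofReal_integral_eq_lintegral_ofReal (int_P μ hμ k)
      (Eventually.of_forall fun _ => le_max_right _ _),
      ← ofReal_integral_eq_lintegral_ofReal (int_P ν hν k)
      (Eventually.of_forall fun _ => le_max_right _ _)] at this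
    exact (ENNReal.ofReal_le_ofReal_iff (P_nonneg ν k)).mp this
  have hC : ∀ k, Cpot μ k ≤ Cpot ν k := by
    intro k
    have := h (fun x => max (x - k) 0)
      (((convexOn_id convex_univ).sub (concaveOn_const k convex_univ)).sup
        (convexOn_const 0 convex_univ)) (fun x => le_max_right _ _)
    rw [← ofReal_integral_eq_lintegral_ofReal (int_C μ hμ k)
      (Eventually.of_forall fun _ => le_max_right _ _),
      ← ofReal_integral_eq_lintegral_ofReal (int_C ν hν k)
      (Eventually.of_forall fun _ => le_max_right _ _)] at this
    exact (ENNReal.ofReal_le_ofReal_iff (C_nonneg ν k)).mp this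
  obtain ⟨c, hc, hcf, hmax, hu⟩ := hull_exists (Ppot ν) (Ppot μ) (P_convex ν hν)
    (P_convex μ hμ) hP
  have hc0 : ∀ k, 0 ≤ c k := hmax (fun _ => 0) (convexOn_const 0 convex_univ)
    fun k => by linarith [hP k]
  have hcg : ∀ k, c k ≤ Ppot ν k := fun k => (hcf k).trans (by linarith [P_nonneg μ k])
  have hline : ∀ k, k * (ν.real univ - μ.real univ) - ((∫ x, x ∂ν) - ∫ x, x ∂μ) ≤ c k := by
    refine hmax _ ?_ ?_
    · refine ⟨convex_univ, fun x _ y _ a b _ _ hab => le_of_eq ?_⟩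
      have : b = 1 - a := by linarith
      subst this
      simp only [smul_eq_mul]
      ring
    · intro k
      have := hC k
      rw [C_eq μ hμ, C_eq ν hν] at this
      linarith
  obtain ⟨ρ, hρf, hρ⟩ := Upot_exists c hc hc0
    (squeeze_zero hc0 hcg (P_bot ν hν)) (∫ x, |x| ∂ν) (ν.real univ)
    (fun k hk => (hcg k).trans (P_lin ν hν k hk))
  have hu0 : ∀ k, 0 ≤ Ppot ν k - c k := fun k => by linarith [hcg k]
  have hug : ∀ k, Ppot ν k - c k ≤ Ppot ν k := fun k => by linarith [hc0 k]
  obtain ⟨S, hSf, hS⟩ := Upot_exists _ hu hu0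
    (squeeze_zero hu0 hug (P_bot ν hν)) (∫ x, |x| ∂ν) (ν.real univ)
    (fun k hk => (hug k).trans (P_lin ν hν k hk))
  have hsum : ρ + S = ν := by
    have hk : ∀ k, Upot (ρ + S) k = Upot ν k := fun k => by
      rw [Upot_add, hρ, hS, ← ENNReal.ofReal_add (hc0 k) (hu0 k), Upot_eq_P ν hν]
      congr 1; ring
    exact Upot_ext _ _ (fun k => by rw [hk, Upot_eq_P ν hν]; exact ENNReal.ofReal_ne_top) hk
  have hSν : S ≤ ν := by rw [← hsum]; exact Measure.le_add_left le_rfl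
  have hSi : Integrable (fun x : ℝ => x) S := hν.mono_measure hSν
  have hPS : ∀ k, Ppot S k = Ppot ν k - c k := fun k => by
    have := hS k
    rw [Upot_eq_P S hSi] at this
    exact (ENNReal.ofReal_eq_ofReal_iff (P_nonneg S k) (hu0 k)).mp this
  have hmm : (∫ x, x ∂S) - (∫ x, x ∂μ) = 0 ∧ S.real univ - μ.real univ = 0 := by
    apply affine_zero
    have h1 : Tendsto (fun k => Ppot S k - Ppot μ k) atTop (𝓝 0) := by
      refine squeeze_zero (fun k => ?_) (fun k => ?_) (C_top ν hν)
      · rw [hPS]; linarith [hcf k]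
      · have a := hline k
        have b := C_nonneg μ k
        rw [C_eq μ hμ] at b
        rw [hPS, C_eq ν hν]
        linarith
    have h2 := ((C_top S hSi).sub (C_top μ hμ)).sub h1
    simp only [sub_zero] at h2
    refine h2.congr fun k => ?_
    rw [C_eq S hSi, C_eq μ hμ]
    ring
  have hmean : (∫ x, x ∂μ) = ∫ x, x ∂S := by linarith [hmm.1]
  have hmass : μ.real univ = S.real univ := by linarith [hmm.2]
  have hShadow : IsShadow μ ν S := by
    refine ⟨hSν, co_of_P μ S hμ hSi hmass hmean fun k => by rw [hPS]; linarith [hcf k], ?_⟩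
    intro η hη hμη
    haveI := fin_of_le hη
    have hηi : Integrable (fun x : ℝ => x) η := hν.mono_measure hη
    obtain ⟨m1, m2⟩ := P_of_co μ η hμ hηi hμη
    have hdi : Integrable (fun x : ℝ => x) (ν - η) := hν.mono_measure Measure.sub_le
    have hd : ∀ k, Ppot ν k = Ppot (ν - η) k + Ppot η k := by
      intro k
      have := Measure.sub_add_cancel_of_le hη
      conv_lhs => rw [← this]
      exact integral_add_measure (int_P _ hdi k) (int_P _ hηi k)
    have := hmax (Ppot (ν - η)) (P_convex _ hdi) fun k => by linarith [hd k, m2 k]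
    refine co_of_P S η hSi hηi (hmass.symm.trans m1) (hmean.symm.trans hμη.2.1) fun k => ?_
    rw [hPS]
    linarith [this k, hd k]
  refine ⟨S, hShadow, fun T hT => ?_⟩
  haveI := fin_of_le hT.1
  have hTi : Integrable (fun x : ℝ => x) T := hν.mono_measure hT.1
  have h1 := (P_of_co T S hTi hSi (hT.2.2 S hShadow.1 hShadow.2.1)).2
  have h2 := (P_of_co S T hSi hTi (hShadow.2.2 T hT.1 hT.2.1)).2
  refine Upot_ext _ _ (fun k => by rw [Upot_eq_P T hTi]; exact ENNReal.ofReal_ne_top) fun k => ?_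
  rw [Upot_eq_P T hTi, Upot_eq_P S hSi, le_antisymm (h1 k) (h2 k)]
end
end

section
/- Let γ₁, γ₂, ν ∈ 𝓜 with γ₁ + γ₂ ≤E ν, and let S₁ = S^ν(γ₁) be the shadow of γ₁ in ν. Then γ₂ ≤E ν − S₁, and the shadow of γ₁ + γ₂ in ν satisfies the associativity identity S^ν(γ₁ + γ₂) = S₁ + S^{ν − S₁}(γ₂); that is, if S₂ is the shadow of γ₂ in ν − S₁, then S₁ + S₂ is the shadow of γ₁ + γ₂ in ν. -/
open MeasureTheory Set Filter Topology

noncomputable section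

def ShCall (μ : Measure ℝ) (k : ℝ) : ℝ := ∫ x, max (x - k) 0 ∂μ

lemma sh_support {f : ℝ → ℝ} (hf : ConvexOn ℝ univ f) (x : ℝ) :
    ∃ m, ∀ y, f x + m * (y - x) ≤ f y := by
  refine ⟨derivWithin f (Ioi x) x, fun y => ?_⟩
  rcases lt_trichotomy x y with h | h | h
  · have := hf.rightDeriv_le_slope_of_mem_interior (by simp) (mem_univ y) h
    rw [slope_def_field, le_div_iff₀ (by linarith)] at this
    linarith
  · simp [h]
  · have := hf.slope_le_leftDeriv_of_mem_interior (mem_univ y) (x := y) (y := x) (by simp) h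
    have h2 := hf.leftDeriv_le_rightDeriv_of_mem_interior (x := x) (by simp)
    have := this.trans h2
    rw [slope_def_field, div_le_iff₀ (by linarith)] at this
    linarith

lemma sh_cont {f : ℝ → ℝ} (hf : ConvexOn ℝ univ f) : Continuous f :=
  continuousOn_univ.1 (hf.continuousOn isOpen_univ)

lemma sh_rd {f : ℝ → ℝ} (hf : ConvexOn ℝ univ f) (x : ℝ) :
    HasDerivWithinAt f (derivWithin f (Ioi x) x) (Ioi x) x :=
  hf.hasDerivWithinAt_rightDeriv_of_mem_interior (by simp)

lemma sh_mono {f : ℝ → ℝ} (hf : ConvexOn ℝ univ f) :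
    Monotone (fun x ↦ derivWithin f (Ioi x) x) := by
  have := hf.monotoneOn_rightDeriv
  simpa [monotoneOn_univ] using this

lemma sh_rcont {f : ℝ → ℝ} (hf : ConvexOn ℝ univ f) (x : ℝ) :
    ContinuousWithinAt (fun x ↦ derivWithin f (Ioi x) x) (Ici x) x := by
  rw [← continuousWithinAt_Ioi_iff_Ici, (sh_mono hf).continuousWithinAt_Ioi_iff_rightLim_eq]
  refine le_antisymm ?_ ((sh_mono hf).le_rightLim le_rfl)
  have h1 := (sh_mono hf).tendsto_rightLim x
  have key : ∀ b, x < b →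
      Function.rightLim (fun x ↦ derivWithin f (Ioi x) x) x ≤ slope f x b := by
    intro b hb
    have h2 : Tendsto (fun y => slope f y b) (𝓝[>] x) (𝓝 (slope f x b)) := by
      simp only [slope_def_field]
      have hc := (sh_cont hf).tendsto x
      have : Tendsto (fun y => (f b - f y) / (b - y)) (𝓝 x) (𝓝 ((f b - f x) / (b - x))) :=
        (tendsto_const_nhds.sub hc).div (tendsto_const_nhds.sub tendsto_id)
          (by simp; linarith)
      exact this.mono_left nhdsWithin_le_nhds
    refine le_of_tendsto_of_tendsto h1 h2 ?_
    have : ∀ᶠ y in 𝓝[>] x, y < b := nhdsWithin_le_nhds (Iio_mem_nhds hb)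
    filter_upwards [this] with y hy
    exact hf.rightDeriv_le_slope_of_mem_interior (by simp) (mem_univ b) hy
  have h3 := (hasDerivWithinAt_iff_tendsto_slope' (by simp)).1 (sh_rd hf x)
  refine ge_of_tendsto h3 ?_
  filter_upwards [self_mem_nhdsWithin] with b hb using key b hb

def shStieltjes {f : ℝ → ℝ} (hf : ConvexOn ℝ univ f) : StieltjesFunction ℝ where
  toFun := fun x ↦ derivWithin f (Ioi x) x
  mono' := sh_mono hf
  right_continuous' := sh_rcont hf

lemma sh_int {μ : Measure ℝ} [IsFiniteMeasure μ] (h : Integrable (fun x : ℝ => x) μ) (k : ℝ) :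
    Integrable (fun x : ℝ => max (x - k) 0) μ :=
  (h.sub (integrable_const k)).sup (integrable_zero _ _ _)

lemma shCall_convex {μ : Measure ℝ} [IsFiniteMeasure μ] (h : Integrable (fun x : ℝ => x) μ) :
    ConvexOn ℝ univ (ShCall μ) := by
  refine ⟨convex_univ, fun a _ b _ s t hs ht hst => ?_⟩
  simp only [ShCall, smul_eq_mul]
  rw [← integral_const_mul, ← integral_const_mul, ← integral_add ((sh_int h a).const_mul s)
    ((sh_int h b).const_mul t)]
  refine integral_mono (sh_int h _) (((sh_int h a).const_mul s).add ((sh_int h b).const_mul t)) ?_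
  intro x
  have e : x = s * x + t * x := by rw [← add_mul, hst, one_mul]
  have h1 := mul_le_mul_of_nonneg_left (le_max_left (x - a) 0) hs
  have h2 := mul_le_mul_of_nonneg_left (le_max_left (x - b) 0) ht
  have h3 := mul_nonneg hs (le_max_right (x - a) 0)
  have h4 := mul_nonneg ht (le_max_right (x - b) 0)
  refine max_le ?_ ?_
  · dsimp only; nlinarith
  · dsimp only; linarith

lemma sh_tail (μ : Measure ℝ) [IsFiniteMeasure μ] (k : ℝ) :
    Tendsto (fun y => μ.real (Ioi y)) (𝓝[>] k) (𝓝 (μ.real (Ioi k))) := by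
  have e : ∀ y, μ.real (Ioi y) = ∫ x, (Ioi y).indicator (fun _ => (1:ℝ)) x ∂μ := by
    intro y; rw [integral_indicator_const _ measurableSet_Ioi]; simp
  simp only [e]
  refine tendsto_integral_filter_of_dominated_convergence (fun _ => (1:ℝ)) ?_ ?_
    (integrable_const _) ?_
  · exact Eventually.of_forall fun y =>
      (measurable_const.indicator measurableSet_Ioi).aestronglyMeasurable
  · refine Eventually.of_forall fun y => Eventually.of_forall fun x => ?_
    by_cases hx : x ∈ Ioi y <;> simp [indicator, hx]
  · refine Eventually.of_forall fun x => ?_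
    refine tendsto_const_nhds.congr' ?_
    by_cases hx : k < x
    · have : ∀ᶠ y in 𝓝[>] k, y < x := nhdsWithin_le_nhds (Iio_mem_nhds hx)
      filter_upwards [this] with y hy
      simp [indicator, hx, hy]
    · filter_upwards [self_mem_nhdsWithin] with y hy
      have : ¬ y < x := by have := mem_Ioi.1 hy; linarith
      simp [indicator, hx, this]

lemma shCall_rd {μ : Measure ℝ} [IsFiniteMeasure μ] (h : Integrable (fun x : ℝ => x) μ) (k : ℝ) :
    HasDerivWithinAt (ShCall μ) (-(μ.real (Ioi k))) (Ioi k) k := by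
  rw [hasDerivWithinAt_iff_tendsto_slope' (by simp)]
  have up : ∀ y ∈ Ioi k, slope (ShCall μ) k y ≤ - μ.real (Ioi y) := by
    intro y hy
    have hy' : 0 < y - k := sub_pos.2 hy
    rw [slope_def_field, div_le_iff₀ hy']
    have : ∫ x, (max (x - y) 0 + (Ioi y).indicator (fun _ => (y - k)) x) ∂μ ≤ ShCall μ k := by
      refine integral_mono ((sh_int h _).add
        ((integrable_const _).indicator measurableSet_Ioi)) (sh_int h _) ?_
      intro x
      dsimp only
      by_cases hx : x ∈ Ioi y
      · rw [indicator_of_mem hx, max_eq_left (by have := mem_Ioi.1 hx; linarith)]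
        refine le_max_of_le_left (by linarith)
      · rw [indicator_of_notMem hx, max_eq_right (by have := notMem_Ioi.1 hx; linarith)]
        simp
    rw [integral_add (sh_int h _) ((integrable_const _).indicator measurableSet_Ioi),
      integral_indicator_const _ measurableSet_Ioi, smul_eq_mul] at this
    unfold ShCall at *; linarith
  have lo : ∀ y ∈ Ioi k, - μ.real (Ioi k) ≤ slope (ShCall μ) k y := by
    intro y hy
    have hy' : 0 < y - k := sub_pos.2 hy
    rw [slope_def_field, le_div_iff₀ hy']
    have : ShCall μ k ≤ ∫ x, (max (x - y) 0 + (Ioi k).indicator (fun _ => (y - k)) x) ∂μ := by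
      refine integral_mono (sh_int h _) ((sh_int h _).add
        ((integrable_const _).indicator measurableSet_Ioi))  ?_
      intro x
      dsimp only
      by_cases hx : x ∈ Ioi k
      · rw [indicator_of_mem hx]
        have := le_max_left (x - y) 0
        have := le_max_right (x - y) 0
        refine max_le ?_ ?_ <;> linarith
      · rw [indicator_of_notMem hx, max_eq_right (by have := notMem_Ioi.1 hx; linarith)]
        simp
    rw [integral_add (sh_int h _) ((integrable_const _).indicator measurableSet_Ioi),
      integral_indicator_const _ measurableSet_Ioi, smul_eq_mul] at this
    unfold ShCall at *; linarith
  have lim : Tendsto (fun y => - μ.real (Ioi y)) (𝓝[>] k) (𝓝 (- μ.real (Ioi k))) := by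
    exact (sh_tail μ k).neg
  refine tendsto_of_tendsto_of_tendsto_of_le_of_le' tendsto_const_nhds lim ?_ ?_
  · filter_upwards [self_mem_nhdsWithin] with y hy using lo y hy
  · filter_upwards [self_mem_nhdsWithin] with y hy using up y hy

def shAff (f : ℝ → ℝ) (x : ℝ) : Set ℝ := {y | ∃ m c : ℝ, (∀ z, m * z + c ≤ f z) ∧ y = m * x + c}

def shHull (f : ℝ → ℝ) (x : ℝ) : ℝ := sSup (shAff f x)

lemma shAff_bdd (f : ℝ → ℝ) (x : ℝ) : BddAbove (shAff f x) := by
  refine ⟨f x, ?_⟩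
  rintro y ⟨m, c, h, rfl⟩
  exact h x

lemma shHull_ge {f : ℝ → ℝ} {m c : ℝ} (h : ∀ z, m * z + c ≤ f z) (x : ℝ) :
    m * x + c ≤ shHull f x := le_csSup (shAff_bdd f x) ⟨m, c, h, rfl⟩

lemma shHull_ge_convex {f g : ℝ → ℝ} (hg : ConvexOn ℝ univ g) (h : ∀ z, g z ≤ f z) (x : ℝ) :
    g x ≤ shHull f x := by
  obtain ⟨m, hm⟩ := sh_support hg x
  have := shHull_ge (f := f) (m := m) (c := g x - m * x)
    (fun z => by have := hm z; have := h z; linarith) x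
  linarith

lemma shAff_nonempty {f g : ℝ → ℝ} (hg : ConvexOn ℝ univ g) (h : ∀ z, g z ≤ f z) (x : ℝ) :
    (shAff f x).Nonempty := by
  obtain ⟨m, hm⟩ := sh_support hg x
  exact ⟨_, m, g x - m * x, (fun z => by have := hm z; have := h z; linarith), rfl⟩

lemma shHull_le {f : ℝ → ℝ} (hne : ∀ x, (shAff f x).Nonempty) (x : ℝ) : shHull f x ≤ f x := by
  refine csSup_le (hne x) ?_
  rintro y ⟨m, c, h, rfl⟩
  exact h x

lemma shHull_convex {f : ℝ → ℝ} (hne : ∀ x, (shAff f x).Nonempty) :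
    ConvexOn ℝ univ (shHull f) := by
  refine ⟨convex_univ, fun a _ b _ s t hs ht hst => ?_⟩
  refine csSup_le (hne _) ?_
  rintro y ⟨m, c, h, rfl⟩
  simp only [smul_eq_mul]
  have h1 := mul_le_mul_of_nonneg_left (shHull_ge h a) hs
  have h2 := mul_le_mul_of_nonneg_left (shHull_ge h b) ht
  have e : c = s * c + t * c := by rw [← add_mul, hst, one_mul]
  linarith

/-- The convex function `F` minus the hull of `F - G` is convex. -/
lemma sh_sub_hull_convex {F G : ℝ → ℝ} (hF : ConvexOn ℝ univ F) (hG : ConvexOn ℝ univ G)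
    (hne : ∀ x, (shAff (fun z => F z - G z) x).Nonempty) :
    ConvexOn ℝ univ (fun x => F x - shHull (fun z => F z - G z) x) := by
  set f : ℝ → ℝ := fun z => F z - G z with hf
  set h := shHull f with hh
  have hconv : ConvexOn ℝ univ h := shHull_convex hne
  have hle : ∀ x, h x ≤ f x := shHull_le hne
  have cF := sh_cont hF
  have cG := sh_cont hG
  have ch := sh_cont hconv
  -- no interior touching by strictly concave parabola
  have key : ∀ (a b x₀ p q ε : ℝ), 0 < ε → a < x₀ → x₀ < b →
      (∀ x ∈ Icc a b, F x - h x ≤ p * x + q - ε * x ^ 2) →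
      F x₀ - h x₀ = p * x₀ + q - ε * x₀ ^ 2 → False := by
    intro a b x₀ p q ε hε hax hxb hub heq
    rcases eq_or_lt_of_le (hle x₀) with hc | hc
    · obtain ⟨m, hm⟩ := sh_support hG x₀
      obtain ⟨δ, hδ, hδa, hδb⟩ : ∃ δ > 0, δ ≤ x₀ - a ∧ δ ≤ b - x₀ :=
        ⟨min (x₀ - a) (b - x₀), lt_min (by linarith) (by linarith), min_le_left _ _,
          min_le_right _ _⟩
      have u1 := hub (x₀ - δ) ⟨by linarith, by linarith⟩
      have u2 := hub (x₀ + δ) ⟨by linarith, by linarith⟩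
      have l1 := hle (x₀ - δ)
      have l2 := hle (x₀ + δ)
      have m1 := hm (x₀ - δ)
      have m2 := hm (x₀ + δ)
      simp only [hf] at l1 l2 hc
      nlinarith [mul_pos hε (mul_pos hδ hδ)]
    · obtain ⟨m, hm⟩ := sh_support hF x₀
      -- h x ≥ ℓ x + ε (x - x₀)^2 on [a,b]
      set M := m - p + 2 * ε * x₀ with hM
      have hq : ∀ x ∈ Icc a b, h x₀ + M * (x - x₀) + ε * (x - x₀) ^ 2 ≤ h x := by
        intro x hx
        have := hub x hx
        have := hm x
        rw [hM]; nlinarith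
      have cont : ContinuousAt (fun x => f x - (h x₀ + M * (x - x₀))) x₀ := by
        apply Continuous.continuousAt
        simp only [hf]; fun_prop
      set c₀ := (f x₀ - h x₀) / 2 with hc₀
      have hc₀p : 0 < c₀ := by rw [hc₀]; linarith
      have ev : ∀ᶠ x in 𝓝 x₀, c₀ < f x - (h x₀ + M * (x - x₀)) :=
        cont.eventually (lt_mem_nhds (by simp; rw [hc₀]; linarith))
      obtain ⟨δ₀, hδ₀, hball⟩ := Metric.eventually_nhds_iff.1 ev
      obtain ⟨δ, hδ, hδ1, hδa, hδb⟩ : ∃ δ > 0, δ < δ₀ ∧ δ ≤ x₀ - a ∧ δ ≤ b - x₀ :=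
        ⟨min (δ₀ / 2) (min (x₀ - a) (b - x₀)),
          lt_min (by linarith) (lt_min (by linarith) (by linarith)),
          lt_of_le_of_lt (min_le_left _ _) (by linarith),
          (min_le_right _ _).trans (min_le_left _ _), (min_le_right _ _).trans (min_le_right _ _)⟩
      set e := min c₀ (ε * δ ^ 2) with he
      have hep : 0 < e := lt_min hc₀p (by positivity)
      have aff : ∀ z, M * z + (h x₀ - M * x₀ + e) ≤ f z := by
        intro z
        by_cases hz : |z - x₀| ≤ δ
        · have := hball (y := z) (by rw [Real.dist_eq]; linarith)
          have := min_le_left c₀ (ε * δ ^ 2)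
          linarith
        · push Not at hz
          have he2 := min_le_right c₀ (ε * δ ^ 2)
          suffices h x₀ + M * (z - x₀) + e ≤ h z by have := hle z; linarith
          rcases lt_abs.1 hz with hz | hz
          · have h1 := hq (x₀ + δ) ⟨by linarith, by linarith⟩
            have h2 := hconv.slope_mono_adjacent (mem_univ x₀) (mem_univ z)
              (show x₀ < x₀ + δ by linarith) (by linarith)
            rw [div_le_div_iff₀ (by linarith) (by linarith)] at h2
            have h3 : 0 ≤ z - (x₀ + δ) := by linarith
            have h4 : 0 ≤ (h z - h x₀ - M * (z - x₀) - e) * δ := by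
              nlinarith [mul_le_mul_of_nonneg_right h1 h3, mul_nonneg hep.le h3]
            have := nonneg_of_mul_nonneg_left h4 hδ
            linarith
          · have h1 := hq (x₀ - δ) ⟨by linarith, by linarith⟩
            have h2 := hconv.slope_mono_adjacent (mem_univ z) (mem_univ x₀)
              (show z < x₀ - δ by linarith) (by linarith)
            rw [div_le_div_iff₀ (by linarith) (by linarith)] at h2
            have h3 : 0 ≤ (x₀ - δ) - z := by linarith
            have h4 : 0 ≤ (h z - h x₀ - M * (z - x₀) - e) * δ := by
              nlinarith [mul_le_mul_of_nonneg_right h1 h3, mul_nonneg hep.le h3]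
            have := nonneg_of_mul_nonneg_left h4 hδ
            linarith
      have := shHull_ge aff x₀
      rw [← hh] at this
      linarith
  refine LinearOrder.convexOn_of_lt convex_univ ?_
  intro a _ b _ hab s t hs ht hst
  simp only [smul_eq_mul]
  by_contra hcon
  push Not at hcon
  set D : ℝ → ℝ := fun x => F x - h x with hD
  have cD : Continuous D := cF.sub ch
  set z := s * a + t * b with hz
  have hcon' : s * D a + t * D b < D z := hcon
  have hza : a < z := by
    have : z - a = t * (b - a) := by
      have e : s = 1 - t := by linarith
      rw [hz, e]; ring
    have := mul_pos ht (sub_pos.2 hab)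
    linarith
  have hzb : z < b := by
    have e : t = 1 - s := by linarith
    rw [hz, e]
    have := mul_pos hs (sub_pos.2 hab)
    linarith
  -- chord
  set P := (D b - D a) / (b - a) with hP
  have hPe : P * (b - a) = D b - D a := div_mul_cancel₀ _ (by linarith)
  set v := D z - (D a + P * (z - a)) with hv
  have hvpos : 0 < v := by
    have e : z - a = t * (b - a) := by
      have : s = 1 - t := by linarith
      rw [hz, this]; ring
    have e2 : s = 1 - t := by linarith
    rw [hv, e]
    have : P * (t * (b - a)) = t * (D b - D a) := by rw [← hPe]; ring
    rw [this]; rw [e2] at hcon'; linarith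
  obtain ⟨ε, hε, hεv⟩ : ∃ ε > 0, ε * ((b - z) * (z - a)) < v := by
    have : 0 < (b - z) * (z - a) := mul_pos (by linarith) (by linarith)
    refine ⟨v / (2 * ((b - z) * (z - a))), by positivity, ?_⟩
    have e : v / (2 * ((b - z) * (z - a))) * ((b - z) * (z - a)) = v / 2 := by
      have h1 := this.ne'
      field_simp
      exact div_self h1
    rw [e]; linarith
  -- W x = D x - chord - ε (b-x)(x-a)
  set W : ℝ → ℝ := fun x => D x - (D a + P * (x - a)) - ε * ((b - x) * (x - a)) with hW
  have cW : Continuous W := by simp only [hW]; fun_prop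
  obtain ⟨x₀, hx₀, hmax⟩ := isCompact_Icc.exists_isMaxOn (nonempty_Icc.2 hab.le) cW.continuousOn
  have Wa : W a = 0 := by simp [hW]
  have Wb : W b = 0 := by simp [hW]; linarith
  have Wz : 0 < W z := by simp only [hW]; linarith
  have hWx : W z ≤ W x₀ := hmax ⟨hza.le, hzb.le⟩
  have hxa : a < x₀ := lt_of_le_of_ne hx₀.1 (by rintro rfl; linarith)
  have hxb : x₀ < b := lt_of_le_of_ne hx₀.2 (by rintro rfl; linarith)
  refine key a b x₀ (P + ε * (a + b)) (W x₀ + D a - P * a - ε * a * b) ε hε hxa hxb ?_ ?_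
  · intro x hx
    have : W x ≤ W x₀ := hmax hx
    have e : W x = D x - (D a + P * (x - a)) - ε * ((b - x) * (x - a)) := rfl
    change D x ≤ _
    nlinarith
  · change D x₀ = _
    have e : W x₀ = D x₀ - (D a + P * (x₀ - a)) - ε * ((b - x₀) * (x₀ - a)) := rfl
    rw [e]; ring

lemma shCall_atTop {μ : Measure ℝ} [IsFiniteMeasure μ] (h : Integrable (fun x : ℝ => x) μ) :
    Tendsto (ShCall μ) atTop (𝓝 0) := by
  have : Tendsto (fun k => ∫ x, max (x - k) 0 ∂μ) atTop (𝓝 (∫ _x, (0:ℝ) ∂μ)) := by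
    refine tendsto_integral_filter_of_dominated_convergence (fun x => |x|) ?_ ?_ h.abs ?_
    · exact Eventually.of_forall fun k => (sh_int h k).aestronglyMeasurable
    · filter_upwards [eventually_ge_atTop 0] with k hk
      refine Eventually.of_forall fun x => ?_
      rw [Real.norm_eq_abs, abs_of_nonneg (le_max_right _ _)]
      exact max_le (by have := le_abs_self x; linarith) (abs_nonneg x)
    · refine Eventually.of_forall fun x => tendsto_const_nhds.congr' ?_
      filter_upwards [eventually_ge_atTop x] with k hk
      rw [max_eq_right (by linarith)]
  rw [integral_zero] at this
  exact this

lemma shCall_put {μ : Measure ℝ} [IsFiniteMeasure μ] (h : Integrable (fun x : ℝ => x) μ) (k : ℝ) :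
    ShCall μ k - ((∫ x, x ∂μ) - k * μ.real univ) = ∫ x, max (k - x) 0 ∂μ := by
  have e : (∫ x, x ∂μ) - k * μ.real univ = ∫ x, (x - k) ∂μ := by
    rw [integral_sub h (integrable_const k)]; simp [mul_comm]
  have hi : Integrable (fun x : ℝ => x - k) μ := h.sub (integrable_const k)
  rw [e, ShCall, ← integral_sub (sh_int h k) hi]
  congr 1; ext x
  rcases le_total x k with hx | hx
  · rw [max_eq_right (by linarith), max_eq_left (by linarith)]; ring
  · rw [max_eq_left (by linarith), max_eq_right (by linarith)]; ring

lemma shCall_atBot {μ : Measure ℝ} [IsFiniteMeasure μ] (h : Integrable (fun x : ℝ => x) μ) :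
    Tendsto (fun k => ShCall μ k - ((∫ x, x ∂μ) - k * μ.real univ)) atBot (𝓝 0) := by
  simp only [shCall_put h]
  have : Tendsto (fun k => ∫ x, max (k - x) 0 ∂μ) atBot (𝓝 (∫ _x, (0:ℝ) ∂μ)) := by
    refine tendsto_integral_filter_of_dominated_convergence (fun x => |x|) ?_ ?_ h.abs ?_
    · exact Eventually.of_forall fun k =>
        (((integrable_const k).sub h).sup (integrable_zero _ _ _)).aestronglyMeasurable
    · filter_upwards [eventually_le_atBot 0] with k hk
      refine Eventually.of_forall fun x => ?_
      rw [Real.norm_eq_abs, abs_of_nonneg (le_max_right _ _)]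
      exact max_le (by have := neg_abs_le x; linarith) (abs_nonneg x)
    · refine Eventually.of_forall fun x => tendsto_const_nhds.congr' ?_
      filter_upwards [eventually_le_atBot x] with k hk
      rw [max_eq_right (by linarith)]
  rw [integral_zero] at this
  exact this

lemma sh_affine_top {a b : ℝ} (h : Tendsto (fun k : ℝ => a + b * k) atTop (𝓝 0)) :
    a = 0 ∧ b = 0 := by
  have h1 : Tendsto (fun k : ℝ => (a + b * (k + 1)) - (a + b * k)) atTop (𝓝 (0 - 0)) :=
    (h.comp (tendsto_atTop_add_const_right _ 1 tendsto_id)).sub h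
  have hb : b = 0 := by
    have e : (fun k : ℝ => (a + b * (k + 1)) - (a + b * k)) = fun _ => b := by ext; ring
    rw [e, sub_zero] at h1
    exact tendsto_nhds_unique tendsto_const_nhds h1
  subst hb
  simp only [zero_mul, add_zero] at h
  exact ⟨tendsto_nhds_unique tendsto_const_nhds h, rfl⟩

lemma sh_affine_bot {a b : ℝ} (h : Tendsto (fun k : ℝ => a + b * k) atBot (𝓝 0)) :
    a = 0 ∧ b = 0 := by
  have := sh_affine_top (a := a) (b := -b) (by
    have := h.comp tendsto_neg_atTop_atBot
    refine this.congr fun k => ?_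
    simp)
  exact ⟨this.1, by linarith [this.2]⟩

lemma sh_construct {ν : Measure ℝ} [IsFiniteMeasure ν] (hν : Integrable (fun x : ℝ => x) ν)
    {D h : ℝ → ℝ} (hD : ConvexOn ℝ univ D) (hh : ConvexOn ℝ univ h)
    (hsum : ∀ x, D x + h x = ShCall ν x) (hlim : Tendsto D atTop (𝓝 0)) :
    ∃ η : Measure ℝ, η ≤ ν ∧ ∀ k, ShCall η k = D k := by
  have hadd : (shStieltjes hD).measure + (shStieltjes hh).measure = ν := by
    rw [← StieltjesFunction.measure_add]
    refine Measure.ext_of_Ioc _ _ fun a b hab => ?_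
    rw [StieltjesFunction.measure_Ioc]
    have r : ∀ x, (shStieltjes hD + shStieltjes hh) x = - ν.real (Ioi x) := by
      intro x
      have h1 := (sh_rd hD x).add (sh_rd hh x)
      have h2 := shCall_rd hν x
      have e : D + h = ShCall ν := by ext y; exact hsum y
      rw [e] at h1
      exact (uniqueDiffWithinAt_Ioi x).eq_deriv _ h1 h2
    rw [r, r]
    have : ν.real (Ioc a b) = ν.real (Ioi a) - ν.real (Ioi b) := by
      rw [← Ioi_sdiff_Ioi, measureReal_sdiff (Ioi_subset_Ioi hab.le) measurableSet_Ioi]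
    rw [show - ν.real (Ioi b) - - ν.real (Ioi a) = ν.real (Ioc a b) by rw [this]; ring]
    simp
  set η := (shStieltjes hD).measure with hη
  have hle : η ≤ ν := by rw [← hadd]; exact Measure.le_add_right le_rfl
  have : IsFiniteMeasure η := isFiniteMeasure_of_le ν hle
  have hηi : Integrable (fun x : ℝ => x) η := hν.mono_measure hle
  refine ⟨η, hle, ?_⟩
  set r : ℝ → ℝ := fun x => derivWithin D (Ioi x) x with hr
  have hconst : ∀ a b, a ≤ b → r b + η.real (Ioi b) = r a + η.real (Ioi a) := by
    intro a b hab
    have h1 : η (Ioc a b) = ENNReal.ofReal (r b - r a) := StieltjesFunction.measure_Ioc _ _ _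
    have h2 : η.real (Ioc a b) = r b - r a := by
      rw [measureReal_def, h1, ENNReal.toReal_ofReal (sub_nonneg.2 (sh_mono hD hab))]
    have : η.real (Ioc a b) = η.real (Ioi a) - η.real (Ioi b) := by
      rw [← Ioi_sdiff_Ioi, measureReal_sdiff (Ioi_subset_Ioi hab) measurableSet_Ioi]
    linarith
  set c := r 0 + η.real (Ioi 0) with hc
  have hcc : ∀ x, r x + η.real (Ioi x) = c := by
    intro x
    rcases le_total x 0 with hx | hx
    · exact (hconst x 0 hx).symm
    · exact hconst 0 x hx
  set E : ℝ → ℝ := fun x => D x - ShCall η x - c * x with hE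
  have hEc : Continuous E := by
    have := sh_cont hD
    have := sh_cont (shCall_convex hηi)
    simp only [hE]; fun_prop
  have hEd : ∀ x, HasDerivWithinAt E 0 (Ici x) x := by
    intro x
    rw [← hasDerivWithinAt_Ioi_iff_Ici]
    have h1 := ((sh_rd hD x).sub (shCall_rd hηi x)).sub
      ((hasDerivWithinAt_id x (Ioi x)).const_mul c)
    have e : derivWithin D (Ioi x) x - -η.real (Ioi x) - c * 1 = 0 := by
      have := hcc x; simp only [hr] at this; linarith
    rw [e] at h1
    exact h1
  have hEconst : ∀ a b, a ≤ b → E b = E a := fun a b hab =>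
    constant_of_has_deriv_right_zero hEc.continuousOn (fun x _ => hEd x) b ⟨hab, le_rfl⟩
  have hE0 : ∀ x, E x = E 0 := by
    intro x
    rcases le_total x 0 with hx | hx
    · exact (hEconst x 0 hx).symm
    · exact hEconst 0 x hx
  have hlim2 : Tendsto (fun k : ℝ => E 0 + c * k) atTop (𝓝 0) := by
    have := hlim.sub (shCall_atTop hηi)
    rw [sub_zero] at this
    refine this.congr fun k => ?_
    rw [← hE0 k]; simp only [hE]; ring
  obtain ⟨h1, h2⟩ := sh_affine_top hlim2
  intro k
  have := hE0 k
  rw [h1] at this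
  simp only [hE, h2] at this
  linarith

/-- Maximality of `C_ν - C_S` among convex minorants of `C_ν - C_γ`. -/
lemma sh_key {γ ν S : Measure ℝ} [IsFiniteMeasure γ] [IsFiniteMeasure ν]
    (hγ : Integrable (fun x : ℝ => x) γ) (hν : Integrable (fun x : ℝ => x) ν)
    (hS : IsShadow γ ν S) {g : ℝ → ℝ} (hg : ConvexOn ℝ univ g)
    (hgle : ∀ k, g k ≤ ShCall ν k - ShCall γ k) (k : ℝ) :
    g k ≤ ShCall ν k - ShCall S k := by
  obtain ⟨hSν, ⟨hm, hmean, hcall⟩, hmin⟩ := hS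
  have : IsFiniteMeasure S := isFiniteMeasure_of_le ν hSν
  have hSi : Integrable (fun x : ℝ => x) S := hν.mono_measure hSν
  have hcall' : ∀ k, ShCall γ k ≤ ShCall S k := hcall
  have h0conv : ConvexOn ℝ univ (fun k => ShCall ν k - ShCall S k) := by
    have : (fun k => ShCall ν k - ShCall S k) = ShCall (ν - S) := by
      ext k
      have hd := Measure.sub_add_cancel_of_le hSν
      have : ShCall ν k = ShCall (ν - S) k + ShCall S k := by
        conv_lhs => rw [← hd]
        exact integral_add_measure ((sh_int hν k).mono_measure Measure.sub_le) (sh_int hSi k)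
      linarith
    rw [this]
    exact shCall_convex (hν.mono_measure Measure.sub_le)
  set f : ℝ → ℝ := fun z => ShCall ν z - ShCall γ z with hf
  have h0le : ∀ z, ShCall ν z - ShCall S z ≤ f z := fun z => by
    have := hcall' z; simp only [hf]; linarith
  have hne := shAff_nonempty h0conv h0le
  have hD := sh_sub_hull_convex (shCall_convex hν) (shCall_convex hγ) hne
  have hDlo : ∀ z, ShCall γ z ≤ ShCall ν z - shHull f z := fun z => by
    have := shHull_le hne z; simp only [hf] at this ⊢; linarith
  have hDhi : ∀ z, ShCall ν z - shHull f z ≤ ShCall S z := fun z => by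
    have := shHull_ge_convex h0conv h0le z; linarith
  obtain ⟨η, hην, hη⟩ := sh_construct hν hD (shHull_convex hne) (fun x => by ring)
    (tendsto_of_tendsto_of_tendsto_of_le_of_le (shCall_atTop hγ) (shCall_atTop hSi) hDlo hDhi)
  have : IsFiniteMeasure η := isFiniteMeasure_of_le ν hην
  have hηi : Integrable (fun x : ℝ => x) η := hν.mono_measure hην
  have hmr : γ.real univ = S.real univ := by rw [measureReal_def, hm, measureReal_def]
  have hlimη := tendsto_of_tendsto_of_tendsto_of_le_of_le
    (f := fun k => ShCall η k - ((∫ x, x ∂γ) - k * γ.real univ)) (shCall_atBot hγ)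
    (h := fun k => ShCall S k - ((∫ x, x ∂γ) - k * γ.real univ))
    (by have := shCall_atBot hSi; rw [← hmean, ← hmr] at this; exact this)
    (fun z => by have := hDlo z; have := hη z; dsimp only at *; linarith)
    (fun z => by have := hDhi z; have := hη z; dsimp only at *; linarith)
  have haff : Tendsto (fun k : ℝ => ((∫ x, x ∂η) - ∫ x, x ∂γ) + (γ.real univ - η.real univ) * k)
      atBot (𝓝 0) := by
    have := hlimη.sub (shCall_atBot hηi)
    rw [sub_zero] at this
    refine this.congr fun k => ?_
    ring
  obtain ⟨e1, e2⟩ := sh_affine_bot haff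
  have hord : ConvexOrder γ η := by
    refine ⟨?_, by linarith, fun k => ?_⟩
    · have : γ.real univ = η.real univ := by linarith
      exact (measureReal_eq_measureReal_iff).1 this
    · have := hDlo k; have h2 := hη k
      change ShCall γ k ≤ ShCall η k
      linarith
  have hSη : ShCall S k ≤ ShCall η k := (hmin η hην hord).2.2 k
  have h1 := shHull_ge_convex hg hgle k
  have h2 := hη k
  change g k ≤ shHull f k at h1
  linarith

lemma sh_shift (F : ℝ → ENNReal) (k : ℝ) :
    ∫⁻ t in Ioi 0, F (k + t) = ∫⁻ t in Ioi k, F t := by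
  rw [← lintegral_indicator measurableSet_Ioi, ← lintegral_indicator measurableSet_Ioi,
    ← lintegral_add_left_eq_self ((Ioi k).indicator F) k]
  congr 1; ext t
  simp [indicator]

lemma sh_call_layer {α : Measure ℝ} [IsFiniteMeasure α] (hα : Integrable (fun x : ℝ => x) α)
    (k : ℝ) : ∫⁻ t in Ioi k, α (Ioi t) = ENNReal.ofReal (ShCall α k) := by
  have h0 : 0 ≤ᵐ[α] fun x => max (x - k) 0 := Eventually.of_forall fun x => le_max_right _ _
  rw [ShCall, ofReal_integral_eq_lintegral_ofReal (sh_int hα k) h0,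
    lintegral_eq_lintegral_meas_lt α h0 (sh_int hα k).aemeasurable,
    ← sh_shift (fun t => α (Ioi t))]
  refine setLIntegral_congr_fun measurableSet_Ioi fun t ht => ?_
  have ht' : (0:ℝ) < t := ht
  congr 1; ext x
  simp only [mem_Ioi, mem_ofPred_eq, lt_max_iff]
  constructor
  · intro h; left; linarith
  · rintro (h | h) <;> linarith

lemma sh_meas_tail (α : Measure ℝ) : Measurable (fun t => α (Ioi t)) :=
  Antitone.measurable fun _ _ h => measure_mono (Ioi_subset_Ioi h)

lemma sh_right_eq {α : Measure ℝ} [IsFiniteMeasure α]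
    {φ : ℝ → ℝ} (hφ : ConvexOn ℝ univ φ) {x₀ : ℝ} (hmin : ∀ x, φ x₀ ≤ φ x) :
    ∫⁻ x, ENNReal.ofReal (φ (max x x₀) - φ x₀) ∂α =
      ∫⁻ s in Ioi 0, ∫⁻ t in {t | s < derivWithin φ (Ioi t) t} ∩ Ioi x₀, α (Ioi t) := by
  set r : ℝ → ℝ := fun t => derivWithin φ (Ioi t) t with hr
  have rm : Monotone r := sh_mono hφ
  have rnn : ∀ t, x₀ ≤ t → 0 ≤ r t := by
    intro t ht
    refine le_trans ?_ (rm ht)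
    have h3 := (hasDerivWithinAt_iff_tendsto_slope' (by simp)).1 (sh_rd hφ x₀)
    refine ge_of_tendsto h3 ?_
    filter_upwards [self_mem_nhdsWithin] with b hb
    rw [slope_def_field]
    exact div_nonneg (sub_nonneg.2 (hmin b)) (sub_nonneg.2 (le_of_lt hb))
  have g_int : ∀ t > (0:ℝ), IntervalIntegrable (fun t => r (x₀ + t)) volume 0 t := fun t _ =>
    (rm.comp (fun a b (h : a ≤ b) => by linarith : Monotone (fun t => x₀ + t))).intervalIntegrable
  have ftc : ∀ x, φ (max x x₀) - φ x₀ = ∫ t in (0:ℝ)..(max x x₀ - x₀), r (x₀ + t) := by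
    intro x
    have e := intervalIntegral.integral_comp_add_left (a := 0) (b := max x x₀ - x₀) r x₀
    rw [e]
    rw [add_zero, add_sub_cancel]
    symm
    refine intervalIntegral.integral_eq_sub_of_hasDeriv_right_of_le (le_max_right _ _)
      (sh_cont hφ).continuousOn (fun t _ => sh_rd hφ t) rm.intervalIntegrable
  simp only [ftc]
  rw [lintegral_comp_eq_lintegral_meas_lt_mul α
    (f := fun x => max x x₀ - x₀) (g := fun t => r (x₀ + t))
    (Eventually.of_forall fun x => sub_nonneg.2 (le_max_right _ _))
    (by fun_prop) g_int
    ((ae_restrict_iff' measurableSet_Ioi).2 (Eventually.of_forall fun t ht =>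
      rnn _ (by have := mem_Ioi.1 ht; linarith)))]
  have e1 : ∫⁻ t in Ioi 0, α {a | t < max a x₀ - x₀} * ENNReal.ofReal (r (x₀ + t)) =
      ∫⁻ t in Ioi 0, (fun t => α (Ioi t) * ENNReal.ofReal (r t)) (x₀ + t) := by
    refine setLIntegral_congr_fun measurableSet_Ioi fun t ht => ?_
    have ht' : (0:ℝ) < t := ht
    dsimp only
    congr 2; ext x
    simp only [mem_Ioi, mem_ofPred_eq, lt_sub_iff_add_lt, lt_max_iff]
    constructor
    · rintro (h | h) <;> linarith
    · intro h; left; linarith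
  rw [e1, sh_shift (fun t => α (Ioi t) * ENNReal.ofReal (r t)) x₀]
  set A := (volume.restrict (Ioi x₀)).withDensity (fun t => α (Ioi t)) with hA
  have e2 : ∫⁻ t in Ioi x₀, α (Ioi t) * ENNReal.ofReal (r t) = ∫⁻ t, ENNReal.ofReal (r t) ∂A := by
    rw [hA, lintegral_withDensity_eq_lintegral_mul _ (sh_meas_tail α)
      (rm.measurable.ennreal_ofReal)]
    rfl
  rw [e2, lintegral_eq_lintegral_meas_lt A ?_ rm.measurable.aemeasurable]
  · refine lintegral_congr fun s => ?_
    have ms : MeasurableSet {t | s < r t} := measurableSet_lt measurable_const rm.measurable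
    rw [hA, withDensity_apply _ ms, Measure.restrict_restrict ms]
  · refine (withDensity_absolutelyContinuous _ _).ae_le ?_
    exact (ae_restrict_iff' measurableSet_Ioi).2 (Eventually.of_forall fun t ht =>
      rnn _ (le_of_lt ht))

lemma sh_right {α β : Measure ℝ} [IsFiniteMeasure α] [IsFiniteMeasure β]
    (hα : Integrable (fun x : ℝ => x) α) (hβ : Integrable (fun x : ℝ => x) β)
    (hC : ∀ k, ShCall α k ≤ ShCall β k)
    {φ : ℝ → ℝ} (hφ : ConvexOn ℝ univ φ) {x₀ : ℝ} (hmin : ∀ x, φ x₀ ≤ φ x) :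
    ∫⁻ x, ENNReal.ofReal (φ (max x x₀) - φ x₀) ∂α ≤
      ∫⁻ x, ENNReal.ofReal (φ (max x x₀) - φ x₀) ∂β := by
  rw [sh_right_eq hφ hmin, sh_right_eq hφ hmin]
  refine lintegral_mono fun s => ?_
  dsimp only
  set U := {t | s < derivWithin φ (Ioi t) t} ∩ Ioi x₀ with hU
  rcases U.eq_empty_or_nonempty with h | hne
  · simp [h]
  · have hbdd : BddBelow U := ⟨x₀, fun t ht => le_of_lt ht.2⟩
    have h1 : Ioi (sInf U) ⊆ U := by
      intro t ht
      obtain ⟨u, hu, hut⟩ := (csInf_lt_iff hbdd hne).1 ht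
      exact ⟨lt_of_lt_of_le hu.1 (sh_mono hφ hut.le), lt_trans hu.2 hut⟩
    have h2 : U ⊆ Ici (sInf U) := fun t ht => csInf_le hbdd ht
    have hae : U =ᵐ[volume] Ioi (sInf U) :=
      (h2.eventuallyLE.trans Ioi_ae_eq_Ici.symm.le).antisymm h1.eventuallyLE
    rw [setLIntegral_congr hae, setLIntegral_congr hae, sh_call_layer hα, sh_call_layer hβ]
    exact ENNReal.ofReal_le_ofReal (hC _)

lemma sh_ext {α β : Measure ℝ} [IsFiniteMeasure α] [IsFiniteMeasure β]
    (hα : Integrable (fun x : ℝ => x) α) (hβ : Integrable (fun x : ℝ => x) β)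
    (hm : α univ ≤ β univ)
    (hC : ∀ k, ShCall α k ≤ ShCall β k)
    (hP : ∀ k, ∫ x, max (k - x) 0 ∂α ≤ ∫ x, max (k - x) 0 ∂β) : ExtConvexOrder α β := by
  have main : ∀ (φ : ℝ → ℝ) (x₀ : ℝ), ConvexOn ℝ univ φ → (∀ x, φ x₀ ≤ φ x) → 0 ≤ φ x₀ →
      ∫⁻ x, ENNReal.ofReal (φ x) ∂α ≤ ∫⁻ x, ENNReal.ofReal (φ x) ∂β := by
    intro φ x₀ hφ hmin h0
    have cφ := sh_cont hφ
    have hdec : ∀ x, ENNReal.ofReal (φ x) = ENNReal.ofReal (φ x₀) +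
        (ENNReal.ofReal (φ (max x x₀) - φ x₀) + ENNReal.ofReal (φ (min x x₀) - φ x₀)) := by
      intro x
      rw [← ENNReal.ofReal_add (sub_nonneg.2 (hmin _)) (sub_nonneg.2 (hmin _)),
        ← ENNReal.ofReal_add h0 (add_nonneg (sub_nonneg.2 (hmin _)) (sub_nonneg.2 (hmin _)))]
      congr 1
      rcases le_total x x₀ with h | h
      · rw [max_eq_right h, min_eq_left h]; ring
      · rw [max_eq_left h, min_eq_right h]; ring
    have mR : Measurable (fun x => ENNReal.ofReal (φ (max x x₀) - φ x₀)) := by fun_prop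
    rw [lintegral_congr (μ := α) hdec, lintegral_congr (μ := β) hdec]
    rw [lintegral_add_left measurable_const, lintegral_add_left measurable_const,
      lintegral_add_left mR, lintegral_add_left mR, lintegral_const, lintegral_const]
    refine add_le_add (mul_le_mul_right hm _) (add_le_add (sh_right hα hβ hC hφ hmin) ?_)
    -- reflection
    have hψ : ConvexOn ℝ univ (fun x => φ (-x)) := by
      refine ⟨convex_univ, fun a _ b _ s t hs ht hst => ?_⟩
      have := hφ.2 (mem_univ (-a)) (mem_univ (-b)) hs ht hst
      simp only [smul_eq_mul] at this ⊢
      rw [show -(s * a + t * b) = s * -a + t * -b by ring]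
      exact this
    have key := sh_right (α := α.map Neg.neg) (β := β.map Neg.neg) (φ := fun x => φ (-x))
      (x₀ := -x₀) ?_ ?_ ?_ hψ (fun x => by simpa using hmin (-x))
    · rw [lintegral_map (by fun_prop) measurable_neg,
        lintegral_map (by fun_prop) measurable_neg] at key
      simpa only [neg_neg, max_neg_neg] using key
    · exact (integrable_map_measure (by fun_prop) (by fun_prop)).2 hα.neg
    · exact (integrable_map_measure (by fun_prop) (by fun_prop)).2 hβ.neg
    · intro k
      have e : ∀ μ : Measure ℝ, ShCall (μ.map Neg.neg) k = ∫ x, max (-k - x) 0 ∂μ := by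
        intro μ
        rw [ShCall, integral_map (by fun_prop) (by fun_prop)]
        congr 1; ext x; congr 1; ring
      rw [e, e]; exact hP _
  intro φ hφ hnn
  have hbdd : BddBelow (range φ) := ⟨0, by rintro _ ⟨x, rfl⟩; exact hnn x⟩
  have step : ∀ ε : ℝ, 0 < ε → ∫⁻ x, ENNReal.ofReal (φ x) ∂α ≤
      ∫⁻ x, ENNReal.ofReal (φ x) ∂β + ENNReal.ofReal ε * β univ := by
    intro ε hε
    set c := (⨅ x, φ x) + ε with hc
    obtain ⟨x₀, hx₀⟩ := exists_lt_of_ciInf_lt (show (⨅ x, φ x) < c by linarith)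
    have hcx : ∀ x, c ≤ φ x + ε := fun x => by have := ciInf_le hbdd x; linarith
    have h1 := main (fun x => max (φ x) c) x₀ (hφ.sup (convexOn_const c convex_univ))
      (fun x => by rw [max_eq_right hx₀.le]; exact le_max_right _ _)
      (le_max_of_le_left (hnn _))
    calc ∫⁻ x, ENNReal.ofReal (φ x) ∂α ≤ ∫⁻ x, ENNReal.ofReal (max (φ x) c) ∂α :=
          lintegral_mono fun x => ENNReal.ofReal_le_ofReal (le_max_left _ _)
      _ ≤ ∫⁻ x, ENNReal.ofReal (max (φ x) c) ∂β := h1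
      _ ≤ ∫⁻ x, (ENNReal.ofReal (φ x) + ENNReal.ofReal ε) ∂β := by
          refine lintegral_mono fun x => ?_
          rw [← ENNReal.ofReal_add (hnn x) hε.le]
          exact ENNReal.ofReal_le_ofReal (max_le (by linarith) (hcx x))
      _ = _ := by rw [lintegral_add_right _ measurable_const, lintegral_const]
  have lim : Tendsto (fun ε : ℝ => ∫⁻ x, ENNReal.ofReal (φ x) ∂β + ENNReal.ofReal ε * β univ)
      (𝓝[>] 0) (𝓝 (∫⁻ x, ENNReal.ofReal (φ x) ∂β + ENNReal.ofReal 0 * β univ)) := by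
    refine tendsto_const_nhds.add (ENNReal.Tendsto.mul_const ?_ (Or.inr (measure_ne_top _ _)))
    exact (ENNReal.continuous_ofReal.tendsto 0).mono_left nhdsWithin_le_nhds
  have := ge_of_tendsto lim (by filter_upwards [self_mem_nhdsWithin] with ε hε using step ε hε)
  simpa using this

lemma sh_convex_add_affine {f : ℝ → ℝ} (hf : ConvexOn ℝ univ f) (a b : ℝ) :
    ConvexOn ℝ univ (fun k => f k + (a + b * k)) := by
  refine hf.add ⟨convex_univ, fun x _ y _ s t hs ht hst => le_of_eq ?_⟩
  simp only [smul_eq_mul]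
  linear_combination (-a) * hst

lemma shCall_add {μ ν : Measure ℝ} [IsFiniteMeasure μ] [IsFiniteMeasure ν]
    (hμ : Integrable (fun x : ℝ => x) μ) (hν : Integrable (fun x : ℝ => x) ν) (k : ℝ) :
    ShCall (μ + ν) k = ShCall μ k + ShCall ν k :=
  integral_add_measure (sh_int hμ k) (sh_int hν k)

lemma sh_ofExt {μ ν : Measure ℝ} (h : ExtConvexOrder μ ν)
    {φ : ℝ → ℝ} (hφ : ConvexOn ℝ univ φ) (h0 : ∀ x, 0 ≤ φ x) (h1 : Integrable φ μ)
    (h2 : Integrable φ ν) : ∫ x, φ x ∂μ ≤ ∫ x, φ x ∂ν := by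
  have := h φ hφ h0
  rw [← ofReal_integral_eq_lintegral_ofReal h1 (Eventually.of_forall h0),
    ← ofReal_integral_eq_lintegral_ofReal h2 (Eventually.of_forall h0)] at this
  exact (ENNReal.ofReal_le_ofReal_iff (integral_nonneg h0)).1 this

lemma sh_hinge (a b : ℝ) : ConvexOn ℝ univ (fun x : ℝ => max (a + b * x) 0) := by
  refine ConvexOn.sup ⟨convex_univ, fun x _ y _ s t hs ht hst => le_of_eq ?_⟩
    (convexOn_const 0 convex_univ)
  simp only [smul_eq_mul]
  linear_combination (-a) * hst

/-- associativity of shadows. -/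
theorem shadow_sum_assoc
    (γ₁ γ₂ ν S₁ : MeasureTheory.Measure ℝ)
    [MeasureTheory.IsFiniteMeasure γ₁] [MeasureTheory.IsFiniteMeasure γ₂]
    [MeasureTheory.IsFiniteMeasure ν]
    (h₁ : MeasureTheory.Integrable (fun x : ℝ => x) γ₁)
    (h₂ : MeasureTheory.Integrable (fun x : ℝ => x) γ₂)
    (hν : MeasureTheory.Integrable (fun x : ℝ => x) ν)
    (hord : ExtConvexOrder (γ₁ + γ₂) ν)
    (hS₁ : IsShadow γ₁ ν S₁) :
    ExtConvexOrder γ₂ (ν - S₁) ∧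
    ∀ S₂ : MeasureTheory.Measure ℝ, IsShadow γ₂ (ν - S₁) S₂ →
      IsShadow (γ₁ + γ₂) ν (S₁ + S₂) := by
  have hS₁ν : S₁ ≤ ν := hS₁.1
  have : IsFiniteMeasure S₁ := isFiniteMeasure_of_le ν hS₁ν
  have hS₁i : Integrable (fun x : ℝ => x) S₁ := hν.mono_measure hS₁ν
  have hβi : Integrable (fun x : ℝ => x) (ν - S₁) := hν.mono_measure Measure.sub_le
  have hd : ν - S₁ + S₁ = ν := Measure.sub_add_cancel_of_le hS₁ν
  have hcd : ∀ k, ShCall ν k = ShCall (ν - S₁) k + ShCall S₁ k := by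
    intro k
    conv_lhs => rw [← hd]
    exact shCall_add hβi hS₁i k
  have hmeand : (∫ x, x ∂ν) = (∫ x, x ∂(ν - S₁)) + ∫ x, x ∂S₁ := by
    conv_lhs => rw [← hd]
    exact integral_add_measure hβi hS₁i
  have hmd : ν univ = (ν - S₁) univ + S₁ univ := by
    conv_lhs => rw [← hd]
    rfl
  have hmrd : ν.real univ = (ν - S₁).real univ + S₁.real univ := by
    rw [measureReal_def, hmd, ENNReal.toReal_add (measure_ne_top _ _) (measure_ne_top _ _)]
    rfl
  obtain ⟨c1, c2, c3⟩ := hS₁.2.1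
  have c1r : γ₁.real univ = S₁.real univ := by rw [measureReal_def, c1, measureReal_def]
  have h12 : Integrable (fun x : ℝ => x) (γ₁ + γ₂) := h₁.add_measure h₂
  refine ⟨sh_ext h₂ hβi ?_ ?_ ?_, ?_⟩
  · have := hord (fun _ => 1) (convexOn_const 1 convex_univ) (fun _ => zero_le_one)
    simp only [lintegral_const, ENNReal.ofReal_one, one_mul, Measure.add_apply] at this
    rw [hmd, c1, add_comm] at this
    exact (ENNReal.add_le_add_iff_right (measure_ne_top _ _)).1 this
  · intro k
    have := sh_key h₁ hν hS₁ (shCall_convex h₂) (fun k => by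
      have := sh_ofExt hord (φ := fun x => max (x - k) 0)
        (by have := sh_hinge (-k) 1; convert this using 3; ring)
        (fun x => le_max_right _ _) (sh_int h12 k) (sh_int hν k)
      change ShCall _ _ ≤ ShCall _ _ at this
      rw [shCall_add h₁ h₂] at this
      linarith) k
    have := hcd k
    linarith
  · intro k
    have := sh_key h₁ hν hS₁ (sh_convex_add_affine (shCall_convex h₂)
      (((∫ x, x ∂ν) - ∫ x, x ∂γ₁) - ∫ x, x ∂γ₂)
      (-(ν.real univ - γ₁.real univ - γ₂.real univ))) (fun k => by
      have i12 : Integrable (fun x => max (k - x) 0) (γ₁ + γ₂) :=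
        ((integrable_const k).sub h12).sup (integrable_zero _ _ _)
      have iν : Integrable (fun x => max (k - x) 0) ν :=
        ((integrable_const k).sub hν).sup (integrable_zero _ _ _)
      have := sh_ofExt hord (φ := fun x => max (k - x) 0)
        (by have := sh_hinge k (-1); convert this using 3; ring)
        (fun x => le_max_right _ _) i12 iν
      rw [integral_add_measure (i12.mono_measure (Measure.le_add_right le_rfl))
        (i12.mono_measure (Measure.le_add_left le_rfl)), ← shCall_put h₁, ← shCall_put h₂,
        ← shCall_put hν] at this
      linarith) k
    rw [← shCall_put h₂, ← shCall_put hβi]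
    have := hcd k
    rw [hmeand, hmrd, c1r, c2] at *
    linarith
  · intro S₂ hS₂
    have hS₂β : S₂ ≤ ν - S₁ := hS₂.1
    have : IsFiniteMeasure S₂ := isFiniteMeasure_of_le _ hS₂β
    have hS₂i : Integrable (fun x : ℝ => x) S₂ := hβi.mono_measure hS₂β
    obtain ⟨d1, d2, d3⟩ := hS₂.2.1
    have hmean1 : (∫ x, x ∂(γ₁ + γ₂)) = (∫ x, x ∂γ₁) + ∫ x, x ∂γ₂ := integral_add_measure h₁ h₂
    have hmean2 : (∫ x, x ∂(S₁ + S₂)) = (∫ x, x ∂S₁) + ∫ x, x ∂S₂ :=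
      integral_add_measure hS₁i hS₂i
    have hm12 : (γ₁ + γ₂) univ = (S₁ + S₂) univ := by
      rw [Measure.add_apply, Measure.add_apply, c1, d1]
    have hmm : (∫ x, x ∂(γ₁ + γ₂)) = ∫ x, x ∂(S₁ + S₂) := by rw [hmean1, hmean2, c2, d2]
    refine ⟨?_, ⟨hm12, hmm, fun k => ?_⟩, ?_⟩
    · rw [← hd, add_comm]
      exact add_le_add_left hS₂β _
    · change ShCall _ _ ≤ ShCall _ _
      rw [shCall_add h₁ h₂, shCall_add hS₁i hS₂i]
      exact add_le_add (c3 k) (d3 k)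
    · intro η hην ⟨e1, e2, e3⟩
      refine ⟨hm12.symm.trans e1, hmm.symm.trans e2, fun k => ?_⟩
      change ShCall _ _ ≤ ShCall _ _
      rw [shCall_add hS₁i hS₂i]
      have : IsFiniteMeasure η := isFiniteMeasure_of_le _ hην
      have hηi : Integrable (fun x : ℝ => x) η := hν.mono_measure hην
      have hρi : Integrable (fun x : ℝ => x) (ν - η) := hν.mono_measure Measure.sub_le
      have hdη : ν - η + η = ν := Measure.sub_add_cancel_of_le hην
      have hcη : ∀ k, ShCall ν k = ShCall (ν - η) k + ShCall η k := by
        intro k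
        conv_lhs => rw [← hdη]
        exact shCall_add hρi hηi k
      have e3' : ∀ k, ShCall γ₁ k + ShCall γ₂ k ≤ ShCall η k := by
        intro k
        rw [← shCall_add h₁ h₂]
        exact e3 k
      have k1 := sh_key h₁ hν hS₁ ((shCall_convex hρi).add (shCall_convex h₂)) (fun k => by
        have := e3' k
        have := hcη k
        simp only [Pi.add_apply]
        linarith)
      have k2 := sh_key h₂ hβi hS₂ (shCall_convex hρi) (fun k => by
        have := k1 k
        have := hcd k
        simp only [Pi.add_apply] at *
        linarith) k
      have := hcd k
      have := hcη k
      linarith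
end
end
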